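/- Every finite-dimensional irreducible contact Lie algebra is isomorphic, as a contact (filtered) Lie algebra, to exactly one of the following: (I) one of the six graded subalgebras h of L listed in the graded classification — namely span{1,x,y,z,x²,xz,z²,x(2y−xz),z(2y−xz),(2y−xz)²}; span{1,x,y,z,x²,xz,z²}; span{1,x,z,x²,xz,z²}; span{1,x,z,x²+z²,2y−xz,x(x²+z²)−2z(2y−xz),z(x²+z²)+2x(2y−xz),(x²+z²)²+4(2y−xz)²}; span{1,x,z,x²+z²,2y−xz}; span{1,x,z,x²+z²+α(2y−xz)} with α ≥ 0 — equipped with the filtration g_p = ⊕_{q≥p}(h ∩ L_q); (II.1) the Lie algebra gl(2,ℝ) with filtration g_p = 0 for p ≥ 1, g₀ = ℝ·[[1,1],[−1,1]], g_{−1} = {[[a+b, a+c],[c−a, a−b]] : a,b,c ∈ ℝ}, g_p = gl(2,ℝ) for p ≤ −2; (II.2) the real Lie algebra spanned by the complex 2×2 matrices [[a+ib, a+ic],[ic−a, a−ib]] (a,b,c ∈ ℝ) together with [[1,1],[−1,1]], which is isomorphic to u(2), with filtration g_p = 0 for p ≥ 1, g₀ = ℝ·[[1,1],[−1,1]], g_{−1}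 = {[[a+ib, a+ic],[ic−a, a−ib]] : a,b,c ∈ ℝ} + g₀, g_p = g for p ≤ −2. -/

import Mathlib

noncomputable section

open MvPolynomial Matrix

/-- The polynomial algebra `L = ℝ[x, y, z]`, with `x = X 0`, `y = X 1`, `z = X 2`. -/
abbrev PL : Type := MvPolynomial (Fin 3) ℝ

/-- The Lagrange bracket
`{f,g} = f_x g_z − f_z g_x + z (f_y g_z − f_z g_y) + f g_y − g f_y` on `L`. -/
noncomputable def lagr (f g : PL) : PL :=
  pderiv 0 f * pderiv 2 g - pderiv 2 f * pderiv 0 g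
    + X 2 * (pderiv 1 f * pderiv 2 g - pderiv 2 f * pderiv 1 g)
    + f * pderiv 1 g - g * pderiv 1 f

/-- `L_p`: the span of the monomials of total weight `p + 2`, where the variables
`x, y, z` have weights `1, 2, 1` respectively. -/
def Lgrade (p : ℤ) : Submodule ℝ PL where
  carrier := {f | ∀ m ∈ f.support, (m 0 : ℤ) + 2 * m 1 + m 2 = p + 2}
  add_mem' := fun {f g} hf hg m hm => by
    rcases Finset.mem_union.mp (MvPolynomial.support_add hm) with hh | hh
    · exact hf m hh
    · exact hg m hh
  zero_mem' := by
    intro m hm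
    simp [MvPolynomial.support_zero] at hm
  smul_mem' := fun c f hf m hm => hf m (MvPolynomial.support_smul hm)

/-- The six candidate graded contact subalgebras of `L` (cases `1°`–`5°` indexed by
`Fin 5`, and the family `6°` indexed by the real parameter `α`). -/
noncomputable def Tgt : Fin 5 ⊕ ℝ → Submodule ℝ PL
  | Sum.inl i =>
      ![Submodule.span ℝ
          {1, X 0, X 1, X 2, X 0 ^ 2, X 0 * X 2, X 2 ^ 2,
            X 0 * (2 * X 1 - X 0 * X 2), X 2 * (2 * X 1 - X 0 * X 2),
            (2 * X 1 - X 0 * X 2) ^ 2},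
        Submodule.span ℝ {1, X 0, X 1, X 2, X 0 ^ 2, X 0 * X 2, X 2 ^ 2},
        Submodule.span ℝ {1, X 0, X 2, X 0 ^ 2, X 0 * X 2, X 2 ^ 2},
        Submodule.span ℝ
          {1, X 0, X 2, X 0 ^ 2 + X 2 ^ 2, 2 * X 1 - X 0 * X 2,
            X 0 * (X 0 ^ 2 + X 2 ^ 2) - 2 * X 2 * (2 * X 1 - X 0 * X 2),
            X 2 * (X 0 ^ 2 + X 2 ^ 2) + 2 * X 0 * (2 * X 1 - X 0 * X 2),
            (X 0 ^ 2 + X 2 ^ 2) ^ 2 + 4 * (2 * X 1 - X 0 * X 2) ^ 2},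
        Submodule.span ℝ {1, X 0, X 2, X 0 ^ 2 + X 2 ^ 2, 2 * X 1 - X 0 * X 2}] i
  | Sum.inr α =>
      Submodule.span ℝ
        {1, X 0, X 2, X 0 ^ 2 + X 2 ^ 2 + C α * (2 * X 1 - X 0 * X 2)}

/-- `gl(2,ℝ)`. -/
abbrev M2R : Type := Matrix (Fin 2) (Fin 2) ℝ

/-- `gl(2,ℂ)`. -/
abbrev M2C : Type := Matrix (Fin 2) (Fin 2) ℂ

/-- `g₀` of case II.1: the span of `[[1,1],[−1,1]]`. -/
noncomputable def G0R : Submodule ℝ M2R := Submodule.span ℝ {!![1, 1; -1, 1]}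

/-- `g_{−1}` of case II.1: the matrices `[[a+b, a+c],[c−a, a−b]]`, `a, b, c ∈ ℝ`. -/
noncomputable def Gm1R : Submodule ℝ M2R :=
  Submodule.span ℝ {!![1, 1; -1, 1], !![1, 0; 0, -1], !![0, 1; 1, 0]}

/-- The filtration of case II.1 on `gl(2,ℝ)`. -/
noncomputable def FiltII1 : ℤ → Submodule ℝ M2R := fun p =>
  if 1 ≤ p then ⊥ else if p = 0 then G0R else if p = -1 then Gm1R else ⊤

/-- `g₀` of case II.2: the span of `[[1,1],[−1,1]]` inside `gl(2,ℂ)`. -/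
noncomputable def G0C : Submodule ℝ M2C := Submodule.span ℝ {!![1, 1; -1, 1]}

/-- `g_{−1}` of case II.2: the matrices `[[a+ib, a+ic],[ic−a, a−ib]]`, `a, b, c ∈ ℝ`
(it contains `g₀`). -/
noncomputable def Gm1C : Submodule ℝ M2C :=
  Submodule.span ℝ
    {!![1, 1; -1, 1], !![Complex.I, 0; 0, -Complex.I], !![0, Complex.I; Complex.I, 0]}

/-- The copy of `u(2)` of case II.2: the real span of `g_{−1}` together with the
bracket `[[0,−1],[1,0]]` of its elements. -/
noncomputable def TopC : Submodule ℝ M2C :=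
  Gm1C ⊔ Submodule.span ℝ {!![0, -1; 1, 0]}

/-- The filtration of case II.2. -/
noncomputable def FiltII2 : ℤ → Submodule ℝ M2C := fun p =>
  if 1 ≤ p then ⊥ else if p = 0 then G0C else if p = -1 then Gm1C else TopC

/-- The span of all brackets `⁅u, w⁆`, `u ∈ V`, `w ∈ W`. -/
def bracketSpan {g : Type} [LieRing g] [LieAlgebra ℝ g] (V W : Submodule ℝ g) :
    Submodule ℝ g :=
  Submodule.span ℝ {z | ∃ u ∈ V, ∃ w ∈ W, z = ⁅u, w⁆}

/-- The filtered Lie algebra `(g, F)` is isomorphic, as a contact (filtered) Lie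
algebra, to the model indicated by the index: `Sum.inl i` are the models of type I
(graded subalgebras of `L` with filtration `g_p = ⊕_{q ≥ p} (h ∩ L_q)`), `Sum.inr 0` is
`gl(2,ℝ)` with the filtration of case II.1, and `Sum.inr 1` is the real form of `u(2)`
inside `gl(2,ℂ)` with the filtration of case II.2. -/
def Iso16 (g : Type) [LieRing g] [LieAlgebra ℝ g] (F : ℤ → Submodule ℝ g) :
    (Fin 5 ⊕ ℝ) ⊕ Fin 2 → Prop
  | Sum.inl i =>
      ∃ φ : g →ₗ[ℝ] PL, Function.Injective φ ∧ LinearMap.range φ = Tgt i ∧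
        (∀ u v : g, φ ⁅u, v⁆ = lagr (φ u) (φ v)) ∧
        (∀ p : ℤ, Submodule.map φ (F p) = ⨆ q : ℤ, ⨆ _ : p ≤ q, Tgt i ⊓ Lgrade q)
  | Sum.inr i =>
      if i = 0 then
        ∃ φ : g →ₗ[ℝ] M2R, Function.Bijective φ ∧
          (∀ u v : g, φ ⁅u, v⁆ = φ u * φ v - φ v * φ u) ∧
          (∀ p : ℤ, Submodule.map φ (F p) = FiltII1 p)
      else
        (∃ φ : g →ₗ[ℝ] M2C, Function.Injective φ ∧
          (∀ u v : g, φ ⁅u, v⁆ = φ u * φ v - φ v * φ u) ∧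
          (∀ p : ℤ, Submodule.map φ (F p) = FiltII2 p)) ∧
        (∃ χ : g →ₗ[ℝ] M2C, Function.Injective χ ∧
          (∀ u v : g, χ ⁅u, v⁆ = χ u * χ v - χ v * χ u) ∧
          (∀ v : g, (χ v)ᴴ = -(χ v)) ∧
          (∀ m : M2C, mᴴ = -m → m ∈ LinearMap.range χ))

section

set_option linter.unusedSimpArgs false

/-! ### Polynomial facts -/

/-- The grading element `T = 2y - xz`. -/
abbrev TT : PL := 2 * X 1 - X 0 * X 2

theorem C_two : (C 2 : PL) = 2 := map_ofNat C 2
theorem C_three : (C 3 : PL) = 3 := map_ofNat C 3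
theorem C_four : (C 4 : PL) = 4 := map_ofNat C 4

theorem pderiv_two (i : Fin 3) : pderiv i (2 : PL) = 0 := by rw [← C_two, pderiv_C]
theorem pderiv_three (i : Fin 3) : pderiv i (3 : PL) = 0 := by rw [← C_three, pderiv_C]
theorem pderiv_four (i : Fin 3) : pderiv i (4 : PL) = 0 := by rw [← C_four, pderiv_C]

theorem pderiv_comm' (i j : Fin 3) (f : PL) :
    pderiv i (pderiv j f) = pderiv j (pderiv i f) := by
  ext m
  simp only [coeff_pderiv]
  by_cases h : i = j
  · subst h; rfl
  · have h' : j ≠ i := fun e => h e.symm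
    simp [Finsupp.single_apply, h, h', add_right_comm]
    ring

theorem lagr_X2 (f : PL) : lagr (X 2) f = - pderiv 0 f := by
  simp [lagr, pderiv_X]

theorem lagr_X0 (f : PL) : lagr (X 0) f = pderiv 2 f + X 0 * pderiv 1 f := by
  simp [lagr, pderiv_X]

theorem lagr_one (f : PL) : lagr 1 f = pderiv 1 f := by
  simp [lagr]

theorem lagr_C (a : ℝ) (f : PL) : lagr (C a) f = C a * pderiv 1 f := by
  simp [lagr]

theorem lagr_skew (f g : PL) : lagr f g = - lagr g f := by
  simp only [lagr]; ring

theorem lagr_add_right (f g h : PL) : lagr f (g + h) = lagr f g + lagr f h := by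
  simp only [lagr, map_add]; ring

theorem lagr_add_left (f g h : PL) : lagr (f + g) h = lagr f h + lagr g h := by
  simp only [lagr, map_add]; ring

theorem lagr_smul_right (a : ℝ) (f g : PL) : lagr f (a • g) = a • lagr f g := by
  simp only [lagr, smul_eq_C_mul, pderiv_C_mul]; ring

theorem lagr_smul_left (a : ℝ) (f g : PL) : lagr (a • f) g = a • lagr f g := by
  simp only [lagr, smul_eq_C_mul, pderiv_C_mul]; ring

theorem lagr_zero_right (f : PL) : lagr f 0 = 0 := by simp [lagr]
theorem lagr_zero_left (f : PL) : lagr 0 f = 0 := by simp [lagr]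

theorem lagr_neg_right (f g : PL) : lagr f (-g) = - lagr f g := by
  simp only [lagr, map_neg]; ring

theorem lagr_sub_right (f g h : PL) : lagr f (g - h) = lagr f g - lagr f h := by
  simp only [lagr, map_sub]; ring

theorem lagr_jac_X2 (f g : PL) :
    lagr (X 2) (lagr f g) = lagr (lagr (X 2) f) g + lagr f (lagr (X 2) g) := by
  simp only [lagr_X2]
  simp only [lagr, map_add, map_sub, map_neg, pderiv_mul, pderiv_X]
  simp only [pderiv_comm' 1 0, pderiv_comm' 2 0, pderiv_comm' 2 1]
  simp
  ring

theorem lagr_jac_X0 (f g : PL) :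
    lagr (X 0) (lagr f g) = lagr (lagr (X 0) f) g + lagr f (lagr (X 0) g) := by
  simp only [lagr_X0]
  simp only [lagr, map_add, map_sub, map_neg, pderiv_mul, pderiv_X]
  simp only [pderiv_comm' 1 0, pderiv_comm' 2 0, pderiv_comm' 2 1]
  simp
  ring

theorem lagr_compat (f : PL) :
    lagr (X 0) (lagr (X 2) f) - lagr (X 2) (lagr (X 0) f) = pderiv 1 f := by
  simp only [lagr_X0, lagr_X2, map_add, map_neg, pderiv_mul, pderiv_X]
  simp only [pderiv_comm' 1 0, pderiv_comm' 2 0, pderiv_comm' 2 1]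
  simp
  ring

/-- weight of an exponent -/
def wt (m : Fin 3 →₀ ℕ) : ℤ := (m 0 : ℤ) + 2 * m 1 + m 2

theorem wt_add (m n : Fin 3 →₀ ℕ) : wt (m + n) = wt m + wt n := by
  simp [wt]; ring

theorem mem_Lgrade {p : ℤ} {f : PL} : f ∈ Lgrade p ↔ ∀ m, coeff m f ≠ 0 → wt m = p + 2 := by
  simp only [← mem_support_iff]; rfl

theorem mul_mem_Lgrade {p q : ℤ} {f g : PL} (hf : f ∈ Lgrade p) (hg : g ∈ Lgrade q) :
    f * g ∈ Lgrade (p + q + 2) := by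
  rw [mem_Lgrade] at *
  intro m hm
  rw [coeff_mul] at hm
  obtain ⟨⟨a, b⟩, hab, hne⟩ := Finset.exists_ne_zero_of_sum_ne_zero hm
  rw [Finset.HasAntidiagonal.mem_antidiagonal] at hab
  simp only at hab hne
  rw [← hab, wt_add, hf a (left_ne_zero_of_mul hne), hg b (right_ne_zero_of_mul hne)]
  ring

theorem pderiv_mem_Lgrade {p : ℤ} {f : PL} (hf : f ∈ Lgrade p) (i : Fin 3) :
    pderiv i f ∈ Lgrade (p - wt (Finsupp.single i 1)) := by
  rw [mem_Lgrade] at *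
  intro m hm
  rw [coeff_pderiv] at hm
  have := hf _ (left_ne_zero_of_mul hm)
  rw [wt_add] at this
  linarith

theorem pd0_mem {p : ℤ} {f : PL} (hf : f ∈ Lgrade p) : pderiv 0 f ∈ Lgrade (p - 1) := by
  simpa [wt] using pderiv_mem_Lgrade hf 0
theorem pd1_mem {p : ℤ} {f : PL} (hf : f ∈ Lgrade p) : pderiv 1 f ∈ Lgrade (p - 2) := by
  simpa [wt] using pderiv_mem_Lgrade hf 1
theorem pd2_mem {p : ℤ} {f : PL} (hf : f ∈ Lgrade p) : pderiv 2 f ∈ Lgrade (p - 1) := by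
  simpa [wt, Finsupp.single_apply] using pderiv_mem_Lgrade hf 2

theorem X_mem_Lgrade (i : Fin 3) : (X i : PL) ∈ Lgrade (wt (Finsupp.single i 1) - 2) := by
  rw [mem_Lgrade]
  intro m hm
  rw [coeff_X] at hm
  have : Finsupp.single i 1 = m := by by_contra h; simp [h] at hm
  rw [← this]; ring

theorem X0_mem : (X 0 : PL) ∈ Lgrade (-1) := by simpa [wt] using X_mem_Lgrade 0
theorem X1_mem : (X 1 : PL) ∈ Lgrade 0 := by simpa [wt] using X_mem_Lgrade 1
theorem X2_mem : (X 2 : PL) ∈ Lgrade (-1) := by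
  simpa [wt, Finsupp.single_apply] using X_mem_Lgrade 2

theorem C_mem (a : ℝ) : (C a : PL) ∈ Lgrade (-2) := by
  rw [mem_Lgrade]
  intro m hm
  rw [coeff_C] at hm
  have : 0 = m := by by_contra h; simp [h] at hm
  rw [← this]; simp [wt]

theorem one_mem_L : (1 : PL) ∈ Lgrade (-2) := by simpa using C_mem 1

theorem Lg_cast {p q : ℤ} {f : PL} (hf : f ∈ Lgrade p) (h : p = q) : f ∈ Lgrade q := h ▸ hf

theorem TT_mem : TT ∈ Lgrade 0 := by
  refine Submodule.sub_mem _ ?_ (Lg_cast (mul_mem_Lgrade X0_mem X2_mem) (by norm_num))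
  exact Lg_cast (mul_mem_Lgrade (C_mem 2) X1_mem) (by norm_num)

theorem lagr_mem {p q : ℤ} {f g : PL} (hf : f ∈ Lgrade p) (hg : g ∈ Lgrade q) :
    lagr f g ∈ Lgrade (p + q) := by
  unfold lagr
  refine Submodule.sub_mem _ (Submodule.add_mem _ (Submodule.add_mem _
    (Submodule.sub_mem _ ?_ ?_) ?_) ?_) ?_
  · exact Lg_cast (mul_mem_Lgrade (pd0_mem hf) (pd2_mem hg)) (by ring)
  · exact Lg_cast (mul_mem_Lgrade (pd2_mem hf) (pd0_mem hg)) (by ring)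
  · rw [mul_sub]
    refine Submodule.sub_mem _ ?_ ?_
    · exact Lg_cast (mul_mem_Lgrade X2_mem (mul_mem_Lgrade (pd1_mem hf) (pd2_mem hg))) (by ring)
    · exact Lg_cast (mul_mem_Lgrade X2_mem (mul_mem_Lgrade (pd2_mem hf) (pd1_mem hg))) (by ring)
  · exact Lg_cast (mul_mem_Lgrade hf (pd1_mem hg)) (by ring)
  · exact Lg_cast (mul_mem_Lgrade hg (pd1_mem hf)) (by ring)

/-- Transitivity of `L`. -/
theorem L_trans {p : ℤ} (hp : -1 ≤ p) {f : PL} (hf : f ∈ Lgrade p)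
    (h0 : lagr (X 0) f = 0) (h2 : lagr (X 2) f = 0) : f = 0 := by
  have e1 : pderiv 1 f = 0 := by
    rw [← lagr_compat, h0, h2, lagr_zero_right, lagr_zero_right, sub_zero]
  have e0 : pderiv 0 f = 0 := by rw [lagr_X2] at h2; exact neg_eq_zero.mp h2
  have e2 : pderiv 2 f = 0 := by rw [lagr_X0, e1] at h0; simpa using h0
  have key : ∀ i : Fin 3, pderiv i f = 0 := by
    intro i; fin_cases i
    · exact e0
    · exact e1
    · exact e2
  ext m
  rw [coeff_zero]
  by_contra hm
  have hw := mem_Lgrade.mp hf m hm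
  have hz : ∀ i, m i = 0 := by
    intro i
    by_contra hi
    have hle : Finsupp.single i 1 ≤ m := by
      rw [Finsupp.single_le_iff]; omega
    have := congrArg (coeff (m - Finsupp.single i 1)) (key i)
    rw [coeff_pderiv, tsub_add_cancel_of_le hle, coeff_zero] at this
    rcases mul_eq_zero.mp this with h | h
    · exact hm h
    · exact absurd h (by positivity)
  simp [wt, hz] at hw
  omega

theorem L_trans_eq {p : ℤ} (hp : -1 ≤ p) {f f' : PL} (hf : f ∈ Lgrade p) (hf' : f' ∈ Lgrade p)
    (h0 : lagr (X 0) f = lagr (X 0) f') (h2 : lagr (X 2) f = lagr (X 2) f') : f = f' := by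
  rw [← sub_eq_zero]
  apply L_trans hp (Submodule.sub_mem _ hf hf')
  · rw [lagr_sub_right, h0, sub_self]
  · rw [lagr_sub_right, h2, sub_self]

theorem L_neg {p : ℤ} (hp : p < -2) {f : PL} (hf : f ∈ Lgrade p) : f = 0 := by
  ext m
  by_contra hm
  have hw := mem_Lgrade.mp hf m hm
  simp only [wt] at hw
  omega

theorem L_m2 {f : PL} (hf : f ∈ Lgrade (-2)) : ∃ a : ℝ, f = C a := by
  refine ⟨coeff 0 f, ?_⟩
  ext m
  rw [coeff_C]
  split_ifs with h
  · rw [h]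
  · by_contra hm
    have hw := mem_Lgrade.mp hf m hm
    apply h
    simp only [wt] at hw
    ext i; fin_cases i <;> simp <;> omega

theorem L_m1 {f : PL} (hf : f ∈ Lgrade (-1)) : ∃ a b : ℝ, f = C a * X 0 + C b * X 2 := by
  obtain ⟨a, ha⟩ := L_m2 (Lg_cast (lagr_mem X2_mem hf) (by norm_num))
  obtain ⟨b, hb⟩ := L_m2 (Lg_cast (lagr_mem X0_mem hf) (by norm_num))
  refine ⟨-a, b, L_trans_eq le_rfl hf ?_ ?_ ?_⟩
  · exact Submodule.add_mem _ (Lg_cast (mul_mem_Lgrade (C_mem _) X0_mem) (by norm_num))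
      (Lg_cast (mul_mem_Lgrade (C_mem _) X2_mem) (by norm_num))
  · rw [hb, lagr_X0]; simp [pderiv_X]
  · rw [ha, lagr_X2]; simp [pderiv_X]

theorem sq_mem : (X 0 ^ 2 : PL) ∈ Lgrade 0 ∧ (X 0 * X 2 : PL) ∈ Lgrade 0 ∧
    (X 2 ^ 2 : PL) ∈ Lgrade 0 := by
  simp only [pow_two]
  exact ⟨Lg_cast (mul_mem_Lgrade X0_mem X0_mem) (by norm_num),
    Lg_cast (mul_mem_Lgrade X0_mem X2_mem) (by norm_num),
    Lg_cast (mul_mem_Lgrade X2_mem X2_mem) (by norm_num)⟩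

/-- general element of `L_0` -/
def q4 (a b c d : ℝ) : PL := a • X 0 ^ 2 + b • (X 0 * X 2) + c • X 2 ^ 2 + d • TT

theorem q4_mem (a b c d : ℝ) : q4 a b c d ∈ Lgrade 0 :=
  Submodule.add_mem _ (Submodule.add_mem _ (Submodule.add_mem _
    (Submodule.smul_mem _ _ sq_mem.1) (Submodule.smul_mem _ _ sq_mem.2.1))
    (Submodule.smul_mem _ _ sq_mem.2.2)) (Submodule.smul_mem _ _ TT_mem)

theorem q4_X0 (a b c d : ℝ) :
    lagr (X 0) (q4 a b c d) = C (b + d) * X 0 + C (2 * c) * X 2 := by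
  rw [lagr_X0]
  simp [q4, TT, smul_eq_C_mul, pderiv_mul, pderiv_X, pderiv_pow, pderiv_two, C_two]
  ring

theorem q4_X2 (a b c d : ℝ) :
    lagr (X 2) (q4 a b c d) = C (-2 * a) * X 0 + C (d - b) * X 2 := by
  rw [lagr_X2]
  simp [q4, TT, smul_eq_C_mul, pderiv_mul, pderiv_X, pderiv_pow, pderiv_two, C_two]
  ring

theorem L_0 {f : PL} (hf : f ∈ Lgrade 0) : ∃ a b c d : ℝ, f = q4 a b c d := by
  obtain ⟨a, b, h2⟩ := L_m1 (Lg_cast (lagr_mem X2_mem hf) (by norm_num))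
  obtain ⟨c, d, h0⟩ := L_m1 (Lg_cast (lagr_mem X0_mem hf) (by norm_num))
  refine ⟨-a / 2, (c - b) / 2, d / 2, (c + b) / 2,
    L_trans_eq (by norm_num) hf (q4_mem _ _ _ _) ?_ ?_⟩
  · rw [h0, q4_X0]; congr 3 <;> ring
  · rw [h2, q4_X2]; congr 3 <;> ring

end

section

set_option linter.unusedSimpArgs false

/-! ### Filtered Lie algebras, frames and symbols -/

/-- The part of the contact axioms used throughout. -/
structure CLA {g : Type} [LieRing g] [LieAlgebra ℝ g] (F : ℤ → Submodule ℝ g) : Prop where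
  neg : ∀ p : ℤ, p ≤ -2 → F p = ⊤
  dec : ∀ p : ℤ, F (p + 1) ≤ F p
  br : ∀ p q : ℤ, ∀ x ∈ F p, ∀ y ∈ F q, ⁅x, y⁆ ∈ F (p + q)
  step : ∀ p : ℤ, 0 ≤ p → ∀ x : g,
      (x ∈ F (p + 1) ↔ x ∈ F p ∧ ∀ y ∈ F (-1), ⁅x, y⁆ ∈ F p)
  bot : ∃ n : ℤ, F n = ⊥

/-- A contact frame. -/
structure Frame {g : Type} [LieRing g] [LieAlgebra ℝ g] (F : ℤ → Submodule ℝ g)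
    (wx wz : g) (lam : g →ₗ[ℝ] ℝ) : Prop where
  mx : wx ∈ F (-1)
  mz : wz ∈ F (-1)
  ker : ∀ u, lam u = 0 ↔ u ∈ F (-1)
  nrm : lam ⁅wx, wz⁆ = 1
  spn : ∀ y ∈ F (-1), ∃ a b : ℝ, y - a • wx - b • wz ∈ F 0

variable {g : Type} [LieRing g] [LieAlgebra ℝ g] {F : ℤ → Submodule ℝ g}

theorem CLA.anti (H : CLA F) {p q : ℤ} (h : p ≤ q) : F q ≤ F p := by
  induction q, h using Int.leInduction with
  | base => exact le_rfl
  | succ n _ ih => exact (H.dec n).trans ih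

theorem CLA.top_mem (H : CLA F) {p : ℤ} (h : p ≤ -2) (u : g) : u ∈ F p := by
  rw [H.neg p h]; trivial

theorem CLA.br' (H : CLA F) {p q r : ℤ} {x y : g} (hx : x ∈ F p) (hy : y ∈ F q)
    (h : r ≤ p + q) : ⁅x, y⁆ ∈ F r := H.anti h (H.br p q x hx y hy)

/-- operators of filtered degree `d` -/
def Deg (F : ℤ → Submodule ℝ g) (d : ℤ) (X : Module.End ℝ g) : Prop :=
  ∀ p : ℤ, ∀ u ∈ F p, X u ∈ F (p + d)

theorem Deg.mul {d e : ℤ} {X Y : Module.End ℝ g} (hX : Deg F d X) (hY : Deg F e Y) :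
    Deg F (d + e) (X * Y) := by
  intro p u hu
  have := hX _ _ (hY p u hu)
  rwa [show p + e + d = p + (d + e) by ring] at this

theorem Deg.add {d : ℤ} {X Y : Module.End ℝ g} (hX : Deg F d X) (hY : Deg F d Y) :
    Deg F d (X + Y) := fun p u hu => Submodule.add_mem _ (hX p u hu) (hY p u hu)

theorem Deg.sub {d : ℤ} {X Y : Module.End ℝ g} (hX : Deg F d X) (hY : Deg F d Y) :
    Deg F d (X - Y) := fun p u hu => Submodule.sub_mem _ (hX p u hu) (hY p u hu)

theorem Deg.neg {d : ℤ} {X : Module.End ℝ g} (hX : Deg F d X) :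
    Deg F d (-X) := fun p u hu => Submodule.neg_mem _ (hX p u hu)

theorem Deg.smul {d : ℤ} {X : Module.End ℝ g} (a : ℝ) (hX : Deg F d X) :
    Deg F d (a • X) := fun p u hu => Submodule.smul_mem _ a (hX p u hu)

theorem Deg.cast {d e : ℤ} {X : Module.End ℝ g} (hX : Deg F d X) (h : d = e) :
    Deg F e X := h ▸ hX

theorem Deg.one : Deg F 0 (1 : Module.End ℝ g) := fun p u hu => by simpa using hu

theorem Deg.zero {d : ℤ} : Deg F d (0 : Module.End ℝ g) := fun p u hu => by simp

theorem Deg.pow {d : ℤ} {X : Module.End ℝ g} (hX : Deg F d X) (n : ℕ) :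
    Deg F (n * d) (X ^ n) := by
  induction n with
  | zero => exact Deg.one.cast (by simp)
  | succ n ih => rw [pow_succ]; exact (ih.mul hX).cast (by push_cast; ring)

theorem CLA.deg_ad (H : CLA F) {p : ℤ} {w : g} (hw : w ∈ F p) : Deg F p (LieAlgebra.ad ℝ g w) := by
  intro q u hu
  rw [LieAlgebra.ad_apply]
  exact H.br' hw hu (by linarith)

theorem deg_comm {a b : ℤ} {X Y : Module.End ℝ g} (hX : Deg F a X)
    (h : Deg F (a + b + 1) (X * Y - Y * X)) (n : ℕ) :
    Deg F (n * a + b + 1) (X ^ n * Y - Y * X ^ n) := by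
  induction n with
  | zero => simpa using Deg.zero
  | succ n ih =>
    have : X ^ (n + 1) * Y - Y * X ^ (n + 1)
        = X ^ n * (X * Y - Y * X) + (X ^ n * Y - Y * X ^ n) * X := by
      rw [pow_succ]; noncomm_ring
    rw [this]
    exact (((hX.pow n).mul h).cast (by push_cast; ring)).add ((ih.mul hX).cast (by push_cast; ring))

section ops
variable (wx wz : g)

/-- `ad wx` -/
def opA : Module.End ℝ g := LieAlgebra.ad ℝ g wx
/-- `-ad wz` -/
def opB : Module.End ℝ g := - LieAlgebra.ad ℝ g wz
/-- `ad [wx,wz]` -/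
def opT : Module.End ℝ g := LieAlgebra.ad ℝ g ⁅wx, wz⁆

theorem opBA : opB wz * opA wx = opA wx * opB wz + opT wx wz := by
  ext u
  simp only [opA, opB, opT, LinearMap.add_apply, Module.End.mul_apply, LinearMap.neg_apply,
    LieAlgebra.ad_apply]
  rw [lie_lie wx]
  simp only [lie_neg]; abel

theorem opBT : opB wz * opT wx wz - opT wx wz * opB wz = - LieAlgebra.ad ℝ g ⁅wz, ⁅wx, wz⁆⁆ := by
  ext u
  simp only [opB, opT, LinearMap.sub_apply, Module.End.mul_apply, LinearMap.neg_apply,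
    LieAlgebra.ad_apply]
  rw [lie_lie wz]
  simp only [lie_neg]; abel

theorem opTA : opT wx wz * opA wx - opA wx * opT wx wz = LieAlgebra.ad ℝ g ⁅⁅wx, wz⁆, wx⁆ := by
  ext u
  simp only [opA, opT, LinearMap.sub_apply, Module.End.mul_apply, LinearMap.neg_apply,
    LieAlgebra.ad_apply]
  rw [lie_lie _ wx]

/-- The operator attached to a monomial -/
def expo (m : Fin 3 →₀ ℕ) : Module.End ℝ g := opA wx ^ m 2 * opT wx wz ^ m 1 * opB wz ^ m 0

theorem S_fin (p : ℤ) : Set.Finite {m : Fin 3 →₀ ℕ | wt m = p + 2} := by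
  apply (Set.finite_Iic (Finsupp.equivFunOnFinite.symm (fun _ : Fin 3 => (p + 2).toNat))).subset
  intro m hm
  rw [Set.mem_Iic]
  intro i
  simp only [Set.mem_ofPred_eq, wt] at hm
  simp only [Finsupp.equivFunOnFinite_symm_apply_apply]
  fin_cases i <;> simp <;> omega

/-- product of factorials -/
def fac (m : Fin 3 →₀ ℕ) : ℝ := (m 0).factorial * (m 1).factorial * (m 2).factorial

theorem fac_ne (m) : fac m ≠ 0 := by unfold fac; positivity

/-- the symbol map of degree `p` -/
def sg (lam : g →ₗ[ℝ] ℝ) (p : ℤ) : g →ₗ[ℝ] PL :=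
  ∑ m ∈ (S_fin p).toFinset, (monomial m : ℝ →ₗ[ℝ] PL) ∘ₗ ((fac m)⁻¹ • (lam ∘ₗ expo wx wz m))

theorem coeff_sg (lam : g →ₗ[ℝ] ℝ) (p : ℤ) (u : g) (m : Fin 3 →₀ ℕ) :
    coeff m (sg wx wz lam p u) = if wt m = p + 2 then (fac m)⁻¹ * lam (expo wx wz m u) else 0 := by
  simp only [sg, LinearMap.sum_apply, LinearMap.comp_apply, coeff_sum, coeff_monomial,
    LinearMap.smul_apply, smul_eq_mul]
  rw [Finset.sum_ite_eq' (S_fin p).toFinset m]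
  simp

theorem sg_mem (lam : g →ₗ[ℝ] ℝ) (p : ℤ) (u : g) : sg wx wz lam p u ∈ Lgrade p := by
  rw [mem_Lgrade]
  intro m hm
  rw [coeff_sg] at hm
  by_contra h
  simp [h] at hm

end ops

theorem Frame.degA (H : CLA F) {wx wz : g} {lam : g →ₗ[ℝ] ℝ} (f : Frame F wx wz lam) :
    Deg F (-1) (opA wx) := H.deg_ad f.mx

theorem Frame.degB (H : CLA F) {wx wz : g} {lam : g →ₗ[ℝ] ℝ} (f : Frame F wx wz lam) :
    Deg F (-1) (opB wz) := (H.deg_ad f.mz).neg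

theorem CLA.degT (H : CLA F) (wx wz : g) :
    Deg F (-2) (opT wx wz) := H.deg_ad (H.top_mem le_rfl _)

theorem Frame.degE (H : CLA F) {wx wz : g} {lam : g →ₗ[ℝ] ℝ} (f : Frame F wx wz lam)
    (m : Fin 3 →₀ ℕ) : Deg F (- wt m) (expo wx wz m) :=
  ((((f.degA H).pow (m 2)).mul ((H.degT wx wz).pow (m 1))).mul ((f.degB H).pow (m 0))).cast
    (by simp only [wt]; ring)

theorem Frame.lam0 {wx wz : g} {lam : g →ₗ[ℝ] ℝ} (H : CLA F) (f : Frame F wx wz lam)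
    {d p : ℤ} {X : Module.End ℝ g} (hX : Deg F d X) {u : g} (hu : u ∈ F p) (h : -1 ≤ p + d) :
    lam (X u) = 0 := (f.ker _).mpr (H.anti h (hX p u hu))

theorem Frame.sg_kill (H : CLA F) {wx wz : g} {lam : g →ₗ[ℝ] ℝ} (f : Frame F wx wz lam)
    {p : ℤ} {u : g} (hu : u ∈ F (p + 1)) : sg wx wz lam p u = 0 := by
  ext m
  rw [coeff_sg, coeff_zero]
  split_ifs with h
  · rw [f.lam0 H (f.degE H m) hu (by rw [h]; linarith), mul_zero]
  · rfl

theorem wt_e0 : wt (Finsupp.single 0 1) = 1 := by simp [wt]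
theorem wt_e1 : wt (Finsupp.single 1 1) = 2 := by simp [wt]
theorem wt_e2 : wt (Finsupp.single 2 1) = 1 := by simp [wt, Finsupp.single_apply]

theorem fac_e0 (m) : fac (m + Finsupp.single 0 1) = (m 0 + 1) * fac m := by
  simp [fac, Nat.factorial_succ]; ring
theorem fac_e1 (m) : fac (m + Finsupp.single 1 1) = (m 1 + 1) * fac m := by
  simp [fac, Nat.factorial_succ]; ring
theorem fac_e2 (m) : fac (m + Finsupp.single 2 1) = (m 2 + 1) * fac m := by
  simp [fac, Nat.factorial_succ, Finsupp.single_apply]; ring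

theorem fac_aux (c : ℝ) (hc : c ≠ 0) (e : ℝ) (he : e ≠ 0) (y : ℝ) :
    (c * e)⁻¹ * y * c = e⁻¹ * y := by field_simp

theorem pd0_sg (wx wz : g) (lam : g →ₗ[ℝ] ℝ) (p : ℤ) (u : g) :
    pderiv 0 (sg wx wz lam p u) = sg wx wz lam (p - 1) (opB wz u) := by
  ext m
  rw [coeff_pderiv, coeff_sg, coeff_sg, wt_add, wt_e0, fac_e0]
  by_cases h : wt m = p - 1 + 2
  · rw [if_pos h, if_pos (by linarith), fac_aux _ (by positivity) _ (fac_ne m)]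
    congr 2
    simp only [expo, Finsupp.add_apply, Finsupp.single_apply, Module.End.mul_apply]
    simp [pow_succ]
  · rw [if_neg h, if_neg (fun h' => h (by linarith)), zero_mul]

theorem Frame.pd1_sg (H : CLA F) {wx wz : g} {lam : g →ₗ[ℝ] ℝ} (f : Frame F wx wz lam) {p : ℤ}
    {u : g} (hu : u ∈ F p) :
    pderiv 1 (sg wx wz lam p u) = sg wx wz lam (p - 2) (opT wx wz u) := by
  ext m
  rw [coeff_pderiv, coeff_sg, coeff_sg, wt_add, wt_e1, fac_e1]
  by_cases h : wt m = p - 2 + 2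
  · rw [if_pos h, if_pos (by linarith), fac_aux _ (by positivity) _ (fac_ne m)]
    congr 1
    have hd : Deg F (-1 + -2 + 1) (opB wz * opT wx wz - opT wx wz * opB wz) := by
      rw [opBT]; exact (H.deg_ad (H.top_mem le_rfl _)).neg
    have h1 := deg_comm (f.degB H) hd (m 0)
    have h2 := f.lam0 H ((((f.degA H).pow (m 2)).mul ((H.degT wx wz).pow (m 1))).mul h1) hu
      (by simp only [wt] at h; linarith)
    have : expo wx wz (m + Finsupp.single 1 1) u = expo wx wz m (opT wx wz u) -
      ((opA wx ^ m 2 * opT wx wz ^ m 1) *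
        (opB wz ^ m 0 * opT wx wz - opT wx wz * opB wz ^ m 0)) u := by
      simp only [expo, Finsupp.add_apply, Finsupp.single_apply]
      simp [pow_succ, Module.End.mul_apply, mul_sub]
    rw [this, map_sub, h2, sub_zero]
  · rw [if_neg h, if_neg (fun h' => h (by linarith)), zero_mul]

theorem Frame.BA (H : CLA F) {wx wz : g} {lam : g →ₗ[ℝ] ℝ} (f : Frame F wx wz lam) (i : ℕ) :
    Deg F (-(i + 1)) (opB wz ^ (i + 1) * opA wx - opA wx * opB wz ^ (i + 1)
      - ((i : ℝ) + 1) • (opT wx wz * opB wz ^ i)) := by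
  induction i with
  | zero =>
    have : opB wz ^ (0 + 1) * opA wx - opA wx * opB wz ^ (0 + 1)
      - (((0 : ℕ) : ℝ) + 1) • (opT wx wz * opB wz ^ 0) = 0 := by
      simp [opBA]
    rw [this]; exact Deg.zero
  | succ i ih =>
    have hd : Deg F (-2) (opB wz * opT wx wz - opT wx wz * opB wz) := by
      rw [opBT]; exact (H.deg_ad (H.top_mem le_rfl _)).neg
    have : opB wz ^ (i + 1 + 1) * opA wx - opA wx * opB wz ^ (i + 1 + 1)
      - (((i + 1 : ℕ) : ℝ) + 1) • (opT wx wz * opB wz ^ (i + 1))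
      = opB wz * (opB wz ^ (i + 1) * opA wx - opA wx * opB wz ^ (i + 1)
      - ((i : ℝ) + 1) • (opT wx wz * opB wz ^ i))
      + ((i : ℝ) + 1) • ((opB wz * opT wx wz - opT wx wz * opB wz) * opB wz ^ i) := by
      have e : opB wz * (opA wx * opB wz ^ (i+1)) =
          (opA wx * opB wz + opT wx wz) * opB wz ^ (i+1) := by
        rw [← mul_assoc, opBA]
      rw [mul_sub, mul_sub, e]
      simp only [mul_smul_comm, sub_mul, smul_sub, add_mul, mul_assoc, pow_succ']
      push_cast
      module
    rw [this]
    exact (((f.degB H).mul ih).cast (by push_cast; ring)).add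
      (((hd.mul ((f.degB H).pow i)).cast (by push_cast; ring)).smul _)

theorem Frame.pd2_sg (H : CLA F) {wx wz : g} {lam : g →ₗ[ℝ] ℝ} (f : Frame F wx wz lam) {p : ℤ}
    {u : g} (hu : u ∈ F p) :
    pderiv 2 (sg wx wz lam p u) + X 0 * pderiv 1 (sg wx wz lam p u)
      = sg wx wz lam (p - 1) (opA wx u) := by
  ext m
  have hd : Deg F (-2 + -1 + 1) (opT wx wz * opA wx - opA wx * opT wx wz) := by
    rw [opTA]; exact H.deg_ad (H.top_mem le_rfl _)
  have hTA := deg_comm (H.degT wx wz) hd (m 1)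
  rw [coeff_add, coeff_pderiv, coeff_sg, coeff_sg, wt_add, wt_e2, fac_e2]
  by_cases h : wt m = p - 1 + 2
  · rw [if_pos h, if_pos (by linarith), fac_aux _ (by positivity) _ (fac_ne m)]
    have h2 := f.lam0 H ((((f.degA H).pow (m 2)).mul hTA).mul ((f.degB H).pow (m 0))) hu
      (by simp only [wt] at h; linarith)
    by_cases h0 : m 0 = 0
    · have : coeff m (X 0 * pderiv 1 (sg wx wz lam p u)) = 0 := by
        rw [coeff_X_mul', if_neg (by simp [h0])]
      rw [this, add_zero]
      congr 1
      have e : expo wx wz (m + Finsupp.single 2 1) u = expo wx wz m (opA wx u) -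
        (opA wx ^ m 2 * (opT wx wz ^ m 1 * opA wx - opA wx * opT wx wz ^ m 1)
          * opB wz ^ m 0) u := by
        simp only [expo, Finsupp.add_apply, Finsupp.single_apply, h0]
        simp [pow_succ, Module.End.mul_apply, mul_sub]
      rw [e, map_sub, h2, sub_zero]
    · obtain ⟨i, hi⟩ := Nat.exists_eq_succ_of_ne_zero h0
      obtain ⟨n, rfl⟩ : ∃ n, m = Finsupp.single 0 1 + n := by
        refine ⟨m - Finsupp.single 0 1, (add_tsub_cancel_of_le ?_).symm⟩
        rw [Finsupp.single_le_iff]; omega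
      rw [coeff_X_mul, coeff_pderiv, coeff_sg]
      have hn0 : n 0 = i := by simp at hi; omega
      have hw : wt (n + Finsupp.single 1 1) = p + 2 := by
        rw [wt_add, wt_e1]; rw [wt_add, wt_e0] at h; linarith
      rw [if_pos hw, fac_e1, fac_aux _ (by positivity) _ (fac_ne n), add_comm _ n, fac_e0]
      have h3 := f.lam0 H ((((f.degA H).pow (n 2)).mul ((H.degT wx wz).pow (n 1))).mul
        (f.BA H i)) hu (by
          rw [wt_add, wt_e0] at h; simp only [wt] at h; rw [hn0] at h; linarith)
      have e : expo wx wz (n + Finsupp.single 0 1 + Finsupp.single 2 1) u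
          + ((n 0 : ℝ) + 1) • expo wx wz (n + Finsupp.single 1 1) u
          = expo wx wz (n + Finsupp.single 0 1) (opA wx u) -
        (opA wx ^ n 2 * (opT wx wz ^ n 1 * opA wx - opA wx * opT wx wz ^ n 1)
          * opB wz ^ (n 0 + 1)) u - 
          (opA wx ^ n 2 * opT wx wz ^ n 1 * (opB wz ^ (i + 1) * opA wx - opA wx * opB wz ^ (i + 1)
      - ((i : ℝ) + 1) • (opT wx wz * opB wz ^ i))) u := by
        simp only [expo, Finsupp.add_apply, Finsupp.single_apply, hn0]
        simp [pow_succ, Module.End.mul_apply, mul_sub]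
        abel
      have h2' : lam ((opA wx ^ n 2 * (opT wx wz ^ n 1 * opA wx - opA wx * opT wx wz ^ n 1)
          * opB wz ^ (n 0 + 1)) u) = 0 := by
        have := h2
        simpa [add_comm] using this
      have e' := congrArg lam e
      rw [map_add, map_sub, map_sub, h3, h2', map_smul, sub_zero, sub_zero, smul_eq_mul] at e'
      rw [← e']
      have := fac_ne n
      field_simp
  · rw [if_neg h, if_neg (fun h' => h (by linarith)), zero_mul, zero_add]
    have := mem_Lgrade.mp (mul_mem_Lgrade X0_mem (pd1_mem (sg_mem wx wz lam p u))) m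
    by_contra h'
    exact h (by rw [this h']; ring)

end

section

set_option linter.unusedSimpArgs false

variable {g : Type} [LieRing g] [LieAlgebra ℝ g] {F : ℤ → Submodule ℝ g}

section
variable {wx wz : g} {lam : g →ₗ[ℝ] ℝ}

theorem sgX2 (wx wz : g) (lam : g →ₗ[ℝ] ℝ) (p : ℤ) (u : g) :
    lagr (X 2) (sg wx wz lam p u) = sg wx wz lam (p - 1) ⁅wz, u⁆ := by
  rw [lagr_X2, pd0_sg]
  simp only [opB, LinearMap.neg_apply, LieAlgebra.ad_apply, map_neg, neg_neg]

theorem Frame.sgX0 (H : CLA F) (f : Frame F wx wz lam) {p : ℤ} {u : g} (hu : u ∈ F p) :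
    lagr (X 0) (sg wx wz lam p u) = sg wx wz lam (p - 1) ⁅wx, u⁆ := by
  rw [lagr_X0, f.pd2_sg H hu]
  simp [opA]

theorem Frame.sg1 (H : CLA F) (f : Frame F wx wz lam) {p : ℤ} {u : g} (hu : u ∈ F p) :
    pderiv 1 (sg wx wz lam p u) = sg wx wz lam (p - 2) ⁅⁅wx, wz⁆, u⁆ := by
  rw [f.pd1_sg H hu]
  simp [opT]

theorem sg_m2 (wx wz : g) (lam : g →ₗ[ℝ] ℝ) (u : g) : sg wx wz lam (-2) u = C (lam u) := by
  obtain ⟨a, ha⟩ := L_m2 (sg_mem wx wz lam (-2) u)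
  have h := coeff_sg wx wz lam (-2) u 0
  rw [ha] at h ⊢
  simp [wt, fac, expo] at h
  rw [h]

theorem sg_neg (wx wz : g) (lam : g →ₗ[ℝ] ℝ) {p : ℤ} (hp : p < -2) (u : g) :
    sg wx wz lam p u = 0 := L_neg hp (sg_mem wx wz lam p u)

theorem Frame.sg_wx (H : CLA F) (f : Frame F wx wz lam) : sg wx wz lam (-1) wx = X 0 := by
  apply L_trans_eq le_rfl (sg_mem _ _ _ _ _) X0_mem
  · rw [f.sgX0 H f.mx]; simp [lagr_X0, pderiv_X]
  · rw [sgX2]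
    norm_num
    rw [sg_m2, ← lie_skew, map_neg, f.nrm]; simp [lagr_X2]

theorem Frame.sg_wz (H : CLA F) (f : Frame F wx wz lam) : sg wx wz lam (-1) wz = X 2 := by
  apply L_trans_eq le_rfl (sg_mem _ _ _ _ _) X2_mem
  · rw [f.sgX0 H f.mz]
    norm_num
    rw [sg_m2, f.nrm]; simp [lagr_X0, pderiv_X]
  · rw [sgX2]; simp [lagr_X2, pderiv_X]

theorem Frame.sg_m1 (H : CLA F) (f : Frame F wx wz lam) {u : g} {a b : ℝ}
    (h : u - a • wx - b • wz ∈ F 0) : sg wx wz lam (-1) u = a • X 0 + b • X 2 := by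
  have := f.sg_kill H (p := -1) (by simpa using h)
  rw [map_sub, map_sub, map_smul, map_smul, f.sg_wx H, f.sg_wz H] at this
  rw [← sub_eq_zero, ← this]; abel

theorem X02_indep {a b : ℝ} (h : (a • X 0 + b • X 2 : PL) = 0) : a = 0 ∧ b = 0 := by
  have h1 := congrArg (eval (![1, 0, 0] : Fin 3 → ℝ)) h
  have h2 := congrArg (eval (![0, 0, 1] : Fin 3 → ℝ)) h
  simp [smul_eq_C_mul] at h1 h2
  exact ⟨h1, h2⟩

/-- membership in `F p` from brackets with the frame -/
theorem Frame.mem_step (H : CLA F) (f : Frame F wx wz lam) {p : ℤ} (hp : 0 ≤ p) {u : g}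
    (hu : u ∈ F p) (hx : ⁅wx, u⁆ ∈ F p) (hz : ⁅wz, u⁆ ∈ F p) : u ∈ F (p + 1) := by
  rw [H.step p hp]
  refine ⟨hu, fun y hy => ?_⟩
  obtain ⟨a, b, hab⟩ := f.spn y hy
  have : ⁅u, y⁆ = ⁅u, y - a • wx - b • wz⁆ - a • ⁅wx, u⁆ - b • ⁅wz, u⁆ := by
    simp only [lie_sub, lie_smul, ← lie_skew u wx, ← lie_skew u wz]
    module
  rw [this]
  exact Submodule.sub_mem _ (Submodule.sub_mem _ (H.br' hu hab (by simp))
    (Submodule.smul_mem _ _ hx)) (Submodule.smul_mem _ _ hz)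

theorem Frame.sg_ker (H : CLA F) (f : Frame F wx wz lam) {p : ℤ} (hp : -2 ≤ p) {u : g}
    (hu : u ∈ F p) (h : sg wx wz lam p u = 0) : u ∈ F (p + 1) := by
  rcases hp.lt_or_eq with hp | rfl
  · have hp' : -1 ≤ p := by omega
    clear hp
    induction p, hp' using Int.leInduction generalizing u with
    | base =>
      obtain ⟨a, b, hab⟩ := f.spn u hu
      rw [f.sg_m1 H hab] at h
      obtain ⟨rfl, rfl⟩ := X02_indep h
      simpa using hab
    | succ p hp ih =>
      apply f.mem_step H (by omega) hu
      · apply ih (by omega) (H.br' f.mx hu (by linarith))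
        have := f.sgX0 H hu
        rw [h, lagr_zero_right] at this
        simpa using this.symm
      · apply ih (by omega) (H.br' f.mz hu (by linarith))
        have := sgX2 wx wz lam (p+1) u
        rw [h, lagr_zero_right] at this
        simpa using this.symm
  · rw [sg_m2] at h
    have : lam u = 0 := by simpa using h
    simpa using (f.ker u).mp this

theorem Frame.sg_lie_m2 (H : CLA F) (f : Frame F wx wz lam) {q : ℤ} {u v : g}
    (hv : v ∈ F q) :
    sg wx wz lam (-2 + q) ⁅u, v⁆ = lagr (sg wx wz lam (-2) u) (sg wx wz lam q v) := by
  have hu : u - lam u • ⁅wx, wz⁆ ∈ F (-1) := by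
    rw [← f.ker]; simp [f.nrm]
  have h := f.sg_kill H (p := -2 + q) (H.br' hu hv (by linarith))
  rw [sub_lie, map_sub, smul_lie, map_smul, sub_eq_zero] at h
  rw [h, sg_m2, lagr_C, f.sg1 H hv, smul_eq_C_mul, show -2 + q = q - 2 by ring]

theorem Frame.sg_lie_m1 (H : CLA F) (f : Frame F wx wz lam) {q : ℤ} {u v : g}
    (hu : u ∈ F (-1)) (hv : v ∈ F q) :
    sg wx wz lam (-1 + q) ⁅u, v⁆ = lagr (sg wx wz lam (-1) u) (sg wx wz lam q v) := by
  obtain ⟨a, b, hab⟩ := f.spn u hu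
  have h := f.sg_kill H (p := -1 + q) (H.br' hab hv (by linarith))
  rw [sub_lie, sub_lie, map_sub, map_sub, smul_lie, smul_lie, map_smul, map_smul] at h
  rw [f.sg_m1 H hab, lagr_add_left, lagr_smul_left, lagr_smul_left, f.sgX0 H hv, sgX2,
    ← sub_eq_zero, ← h, show -1 + q = q - 1 by ring]
  abel

theorem Frame.sg_lie (H : CLA F) (f : Frame F wx wz lam) {p q : ℤ} (hp : -2 ≤ p) (hq : -2 ≤ q)
    {u v : g} (hu : u ∈ F p) (hv : v ∈ F q) :
    sg wx wz lam (p + q) ⁅u, v⁆ = lagr (sg wx wz lam p u) (sg wx wz lam q v) := by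
  obtain ⟨n, hn⟩ : ∃ n : ℕ, p + q + 4 ≤ n := ⟨(p + q + 4).toNat, Int.self_le_toNat _⟩
  induction n generalizing p q u v with
  | zero =>
    have h1 : p = -2 := by push_cast at hn; omega
    subst h1
    exact f.sg_lie_m2 H hv
  | succ n ih =>
    rcases eq_or_ne p (-2) with rfl | hp2
    · exact f.sg_lie_m2 H hv
    rcases eq_or_ne p (-1) with rfl | hp1
    · exact f.sg_lie_m1 H hu hv
    rcases eq_or_ne q (-2) with rfl | hq2
    · rw [← lie_skew, map_neg, lagr_skew, ← f.sg_lie_m2 H hu, add_comm]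
    rcases eq_or_ne q (-1) with rfl | hq1
    · rw [← lie_skew, map_neg, lagr_skew, ← f.sg_lie_m1 H hv hu, add_comm]
    have key : ∀ w ∈ F (-1), sg wx wz lam (p + q - 1) ⁅w, ⁅u, v⁆⁆ =
        lagr (sg wx wz lam (p - 1) ⁅w, u⁆) (sg wx wz lam q v) +
        lagr (sg wx wz lam p u) (sg wx wz lam (q - 1) ⁅w, v⁆) := by
      intro w hw
      rw [leibniz_lie, map_add,
        ← ih (by omega) hq (H.br' hw hu (by linarith)) hv (by push_cast at hn; omega),
        ← ih hp (by omega) hu (H.br' hw hv (by linarith)) (by push_cast at hn; omega),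
        show p - 1 + q = p + q - 1 by ring, show p + (q - 1) = p + q - 1 by ring]
    apply L_trans_eq (p := p + q) (by omega) (sg_mem _ _ _ _ _)
      (lagr_mem (sg_mem _ _ _ _ _) (sg_mem _ _ _ _ _))
    · rw [f.sgX0 H (H.br p q u hu v hv), lagr_jac_X0, f.sgX0 H hu, f.sgX0 H hv]
      exact key wx f.mx
    · rw [sgX2, lagr_jac_X2, sgX2, sgX2]
      exact key wz f.mz

/-- The symbol space of degree `p`. -/
def hh (F : ℤ → Submodule ℝ g) (wx wz : g) (lam : g →ₗ[ℝ] ℝ) (p : ℤ) : Submodule ℝ PL :=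
  Submodule.map (sg wx wz lam p) (F p)

theorem hh_le (p : ℤ) : hh F wx wz lam p ≤ Lgrade p := by
  rintro _ ⟨u, _, rfl⟩; exact sg_mem _ _ _ _ _

theorem hh_neg {p : ℤ} (hp : p < -2) : hh F wx wz lam p = ⊥ := by
  rw [eq_bot_iff]; rintro _ ⟨u, _, rfl⟩; exact sg_neg _ _ _ hp u

theorem Frame.hh_lie (H : CLA F) (f : Frame F wx wz lam) {p q r : ℤ} (hp : -2 ≤ p) (hq : -2 ≤ q)
    {a b : PL} (ha : a ∈ hh F wx wz lam p) (hb : b ∈ hh F wx wz lam q) (hr : p + q = r) :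
    lagr a b ∈ hh F wx wz lam r := by
  subst hr
  obtain ⟨u, hu, rfl⟩ := ha
  obtain ⟨v, hv, rfl⟩ := hb
  rw [← f.sg_lie H hp hq hu hv]
  exact ⟨_, H.br p q u hu v hv, rfl⟩

theorem Frame.hh_m2 (H : CLA F) (f : Frame F wx wz lam) :
    hh F wx wz lam (-2) = Submodule.span ℝ {1} := by
  apply le_antisymm
  · rintro _ ⟨u, _, rfl⟩
    rw [sg_m2, Submodule.mem_span_singleton]
    exact ⟨lam u, by simp [smul_eq_C_mul]⟩
  · rw [Submodule.span_le, Set.singleton_subset_iff]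
    exact ⟨⁅wx, wz⁆, H.top_mem le_rfl _, by rw [sg_m2, f.nrm, C_1]⟩

theorem Frame.hh_m1 (H : CLA F) (f : Frame F wx wz lam) :
    hh F wx wz lam (-1) = Submodule.span ℝ {X 0, X 2} := by
  apply le_antisymm
  · rintro _ ⟨u, hu, rfl⟩
    obtain ⟨a, b, hab⟩ := f.spn u hu
    rw [f.sg_m1 H hab, Submodule.mem_span_pair]
    exact ⟨a, b, rfl⟩
  · rw [Submodule.span_le]
    rintro _ (rfl | rfl)
    · exact ⟨wx, f.mx, f.sg_wx H⟩
    · exact ⟨wz, f.mz, f.sg_wz H⟩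

/-- `h_p = 0` iff `F_p = F_{p+1}`. -/
theorem Frame.eq_of_hh (H : CLA F) (f : Frame F wx wz lam) {p : ℤ} (hp : -2 ≤ p)
    (h : hh F wx wz lam p = ⊥) : F p ≤ F (p + 1) := by
  intro u hu
  apply f.sg_ker H hp hu
  have : sg wx wz lam p u ∈ hh F wx wz lam p := ⟨u, hu, rfl⟩
  rwa [h, Submodule.mem_bot] at this

theorem Frame.hh_bot (H : CLA F) {n : ℤ} (hn : F n = ⊥) {p : ℤ} (hp : n ≤ p) :
    hh F wx wz lam p = ⊥ := by
  have : F p = ⊥ := eq_bot_iff.mpr (hn ▸ H.anti hp)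
  rw [hh, this, Submodule.map_bot]

/-- Propagation of vanishing of the symbol spaces. -/
theorem Frame.hh_prop (H : CLA F) (f : Frame F wx wz lam) {p : ℤ} (hp : 0 ≤ p)
    (h : hh F wx wz lam p = ⊥) {q : ℤ} (hq : p ≤ q) : hh F wx wz lam q = ⊥ := by
  induction q, hq using Int.leInduction with
  | base => exact h
  | succ q hq ih =>
    rw [eq_bot_iff]
    intro a ha
    have h0 := f.hh_lie H (r := q) (by norm_num) (by omega)
      (show X 0 ∈ hh F wx wz lam (-1) from ⟨wx, f.mx, f.sg_wx H⟩) ha (by ring)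
    have h2 := f.hh_lie H (r := q) (by norm_num) (by omega)
      (show X 2 ∈ hh F wx wz lam (-1) from ⟨wz, f.mz, f.sg_wz H⟩) ha (by ring)
    rw [ih, Submodule.mem_bot] at h0 h2
    exact L_trans (by omega) (hh_le _ ha) h0 h2

theorem Frame.F_bot (H : CLA F) (f : Frame F wx wz lam) {p : ℤ} (hp : 0 ≤ p)
    (h : hh F wx wz lam p = ⊥) : F p = ⊥ := by
  obtain ⟨n, hn⟩ := H.bot
  have key : ∀ q, p ≤ q → F p ≤ F q := by
    intro q hq
    induction q, hq using Int.leInduction with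
    | base => exact le_rfl
    | succ q hq ih => exact ih.trans (f.eq_of_hh H (by omega) (f.hh_prop H hp h hq))
  rw [eq_bot_iff, ← hn]
  exact (key (max p n) (le_max_left _ _)).trans (H.anti (le_max_right _ _))

end

end

section

set_option linter.unusedSimpArgs false

/-! ### Computations in `L` -/

abbrev NN : PL := X 0 ^ 2 + X 2 ^ 2
abbrev PA : PL := X 0 * (X 0 ^ 2 + X 2 ^ 2) - 2 * X 2 * TT
abbrev PB : PL := X 2 * (X 0 ^ 2 + X 2 ^ 2) + 2 * X 0 * TT
abbrev PQ : PL := (X 0 ^ 2 + X 2 ^ 2) ^ 2 + 4 * TT ^ 2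

theorem xT_mem : (X 0 * TT : PL) ∈ Lgrade 1 := Lg_cast (mul_mem_Lgrade X0_mem TT_mem) (by norm_num)
theorem zT_mem : (X 2 * TT : PL) ∈ Lgrade 1 := Lg_cast (mul_mem_Lgrade X2_mem TT_mem) (by norm_num)
theorem TT2_mem : (TT ^ 2 : PL) ∈ Lgrade 2 := by
  rw [pow_two]; exact Lg_cast (mul_mem_Lgrade TT_mem TT_mem) (by norm_num)
theorem NN_mem : NN ∈ Lgrade 0 := Submodule.add_mem _ sq_mem.1 sq_mem.2.2
theorem two_mem : (2 : PL) ∈ Lgrade (-2) := by rw [← C_two]; exact C_mem 2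
theorem four_mem : (4 : PL) ∈ Lgrade (-2) := by rw [← C_four]; exact C_mem 4
theorem PA_mem : PA ∈ Lgrade 1 := by
  refine Submodule.sub_mem _ (Lg_cast (mul_mem_Lgrade X0_mem NN_mem) (by norm_num)) ?_
  rw [mul_assoc]
  exact Lg_cast (mul_mem_Lgrade two_mem zT_mem) (by norm_num)
theorem PB_mem : PB ∈ Lgrade 1 := by
  refine Submodule.add_mem _ (Lg_cast (mul_mem_Lgrade X2_mem NN_mem) (by norm_num)) ?_
  rw [mul_assoc]
  exact Lg_cast (mul_mem_Lgrade two_mem xT_mem) (by norm_num)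
theorem PQ_mem : PQ ∈ Lgrade 2 := by
  refine Submodule.add_mem _ ?_ (Lg_cast (mul_mem_Lgrade four_mem TT2_mem) (by norm_num))
  rw [pow_two]; exact Lg_cast (mul_mem_Lgrade NN_mem NN_mem) (by norm_num)

theorem pd1_X2 (f : PL) : pderiv 1 (lagr (X 2) f) = lagr (X 2) (pderiv 1 f) := by
  rw [lagr_X2, lagr_X2, map_neg, pderiv_comm']

theorem pd1_X0 (f : PL) : pderiv 1 (lagr (X 0) f) = lagr (X 0) (pderiv 1 f) := by
  rw [lagr_X0, lagr_X0, map_add, pderiv_comm', pderiv_mul]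
  simp [pderiv_X]

theorem pd1_q4 (a b c d : ℝ) : pderiv 1 (q4 a b c d) = C (2 * d) := by
  simp [q4, TT, smul_eq_C_mul, pderiv_mul, pderiv_X, pderiv_pow, pderiv_two, C_two]
  ring

theorem q4_inj {a b c d a' b' c' d' : ℝ} (h : q4 a b c d = q4 a' b' c' d') :
    a = a' ∧ b = b' ∧ c = c' ∧ d = d' := by
  have h1 := congrArg (eval (![1, 0, 0] : Fin 3 → ℝ)) h
  have h2 := congrArg (eval (![0, 0, 1] : Fin 3 → ℝ)) h
  have h3 := congrArg (eval (![0, 1, 0] : Fin 3 → ℝ)) h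
  have h4 := congrArg (eval (![1, 0, 1] : Fin 3 → ℝ)) h
  simp [q4, TT, smul_eq_C_mul] at h1 h2 h3 h4
  refine ⟨h1, ?_, h2, h3⟩
  rw [h1, h2, h3] at h4
  linarith

theorem lin_inj {a b a' b' : ℝ} (h : (C a * X 0 + C b * X 2 : PL) = C a' * X 0 + C b' * X 2) :
    a = a' ∧ b = b' := by
  have h1 := congrArg (eval (![1, 0, 0] : Fin 3 → ℝ)) h
  have h2 := congrArg (eval (![0, 0, 1] : Fin 3 → ℝ)) h
  simp at h1 h2
  exact ⟨h1, h2⟩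

/-- the cubic with given coefficients -/
def c6 (s0 s1 s2 s3 e k : ℝ) : PL :=
  s0 • X 0 ^ 3 + s1 • (X 0 ^ 2 * X 2) + s2 • (X 0 * X 2 ^ 2) + s3 • X 2 ^ 3
    + e • (X 0 * TT) + k • (X 2 * TT)

theorem c6_mem (s0 s1 s2 s3 e k : ℝ) : c6 s0 s1 s2 s3 e k ∈ Lgrade 1 := by
  have h1 : (X 0 ^ 3 : PL) ∈ Lgrade 1 := by
    rw [pow_succ]; exact Lg_cast (mul_mem_Lgrade sq_mem.1 X0_mem) (by norm_num)
  have h2 : (X 0 ^ 2 * X 2 : PL) ∈ Lgrade 1 :=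
    Lg_cast (mul_mem_Lgrade sq_mem.1 X2_mem) (by norm_num)
  have h3 : (X 0 * X 2 ^ 2 : PL) ∈ Lgrade 1 :=
    Lg_cast (mul_mem_Lgrade X0_mem sq_mem.2.2) (by norm_num)
  have h4 : (X 2 ^ 3 : PL) ∈ Lgrade 1 := by
    rw [pow_succ]; exact Lg_cast (mul_mem_Lgrade sq_mem.2.2 X2_mem) (by norm_num)
  unfold c6
  apply_rules [Submodule.add_mem, Submodule.smul_mem, xT_mem, zT_mem]

theorem c6_X2 (s0 s1 s2 s3 e k : ℝ) :
    lagr (X 2) (c6 s0 s1 s2 s3 e k) = q4 (-3 * s0) (-2 * s1 + e) (-s2 + k) (-e) := by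
  rw [lagr_X2]
  simp [c6, q4, TT, smul_eq_C_mul, pderiv_mul, pderiv_X, pderiv_pow, pderiv_two, C_two, C_three]
  ring

theorem c6_X0 (s0 s1 s2 s3 e k : ℝ) :
    lagr (X 0) (c6 s0 s1 s2 s3 e k) = q4 (s1 + e) (2 * s2 + k) (3 * s3) k := by
  rw [lagr_X0]
  simp [c6, q4, TT, smul_eq_C_mul, pderiv_mul, pderiv_X, pderiv_pow, pderiv_two, C_two, C_three]
  ring

theorem L_1' {f : PL} (hf : f ∈ Lgrade 1) {a b c d a' b' c' d' : ℝ}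
    (h2 : lagr (X 2) f = q4 a b c d) (h0 : lagr (X 0) f = q4 a' b' c' d') :
    b = -3 * d - 2 * a' ∧ b' = 3 * d' - 2 * c ∧
    f = c6 (-a / 3) (a' + d) (d' - c) (c' / 3) (-d) d' := by
  have hD := lagr_compat f
  rw [h2, h0, q4_X0, q4_X2] at hD
  have e2 := pd1_X2 f
  have e0 := pd1_X0 f
  rw [h2, pd1_q4, ← hD, lagr_X2] at e2
  rw [h0, pd1_q4, ← hD, lagr_X0] at e0
  have e2' := congrArg (eval (![0, 0, 0] : Fin 3 → ℝ)) e2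
  have e0' := congrArg (eval (![0, 0, 0] : Fin 3 → ℝ)) e0
  simp [pderiv_X] at e2' e0'
  have hb : b = -3 * d - 2 * a' := by linarith
  have hb' : b' = 3 * d' - 2 * c := by linarith
  refine ⟨hb, hb', L_trans_eq (by norm_num) hf (c6_mem _ _ _ _ _ _) ?_ ?_⟩
  · rw [h0, c6_X0, hb']; congr 1 <;> ring
  · rw [h2, c6_X2, hb]; congr 1 <;> ring

theorem L_1 {f : PL} (hf : f ∈ Lgrade 1) :
    ∃ s0 s1 s2 s3 e k : ℝ, f = c6 s0 s1 s2 s3 e k := by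
  obtain ⟨a, b, c, d, h2⟩ := L_0 (Lg_cast (lagr_mem X2_mem hf) (by norm_num))
  obtain ⟨a', b', c', d', h0⟩ := L_0 (Lg_cast (lagr_mem X0_mem hf) (by norm_num))
  exact ⟨_, _, _, _, _, _, (L_1' hf h2 h0).2.2⟩

theorem L_1_co {f : PL} (hf : f ∈ Lgrade 1) {a d a' d' : ℝ}
    (h2 : lagr (X 2) f = q4 a 0 a d) (h0 : lagr (X 0) f = q4 a' 0 a' d') :
    f = (-d' / 2) • PA + (a' / 3) • PB := by
  obtain ⟨e1, e2, h⟩ := L_1' hf h2 h0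
  have hd : d = -(2 / 3) * a' := by linarith
  have ha : a = 3 / 2 * d' := by linarith
  rw [h, hd, ha]
  rw [show -(3 / 2 * d') / 3 = -d' / 2 by ring, show a' + -(2/3) * a' = a' / 3 by ring,
    show d' - 3 / 2 * d' = -d' / 2 by ring, show -(-(2/3) * a') = 2 * (a' / 3) by ring,
    show c6 (-d' / 2) (a' / 3) (-d' / 2) (a' / 3) (2 * (a' / 3)) d' =
      c6 (-d' / 2) (a' / 3) (-d' / 2) (a' / 3) (2 * (a' / 3)) (-2 * (-d' / 2)) by
      congr 1; ring]
  generalize -d' / 2 = r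
  generalize a' / 3 = s
  simp [c6, TT, smul_eq_C_mul, C_two]
  ring

/-- brackets with the linear forms -/
theorem X2_xT : lagr (X 2) (X 0 * TT) = q4 0 1 0 (-1) := by
  have := c6_X2 0 0 0 0 1 0; simpa [c6] using this
theorem X0_xT : lagr (X 0) (X 0 * TT) = q4 1 0 0 0 := by
  have := c6_X0 0 0 0 0 1 0; simpa [c6] using this
theorem X2_zT : lagr (X 2) (X 2 * TT) = q4 0 0 1 0 := by
  have := c6_X2 0 0 0 0 0 1; simpa [c6] using this
theorem X0_zT : lagr (X 0) (X 2 * TT) = q4 0 1 0 1 := by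
  have := c6_X0 0 0 0 0 0 1; simpa [c6] using this

theorem q4_lin (r s a b c d a' b' c' d' : ℝ) : r • q4 a b c d + s • q4 a' b' c' d' =
    q4 (r * a + s * a') (r * b + s * b') (r * c + s * c') (r * d + s * d') := by
  simp [q4, smul_eq_C_mul]; ring

theorem q4_sub (a b c d a' b' c' d' : ℝ) : q4 a b c d - q4 a' b' c' d' =
    q4 (a - a') (b - b') (c - c') (d - d') := by
  simp [q4, smul_eq_C_mul]; ring

theorem X2_TT2 : lagr (X 2) (TT ^ 2) = (2:ℝ) • (X 2 * TT) := by
  rw [lagr_X2]; simp [TT, smul_eq_C_mul, pderiv_mul, pderiv_X, pderiv_pow, pderiv_two, C_two]; ring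
theorem X0_TT2 : lagr (X 0) (TT ^ 2) = (2:ℝ) • (X 0 * TT) := by
  rw [lagr_X0]; simp [TT, smul_eq_C_mul, pderiv_mul, pderiv_X, pderiv_pow, pderiv_two, C_two]; ring
theorem pd1_xT : pderiv 1 (X 0 * TT) = 2 * X 0 := by
  simp [TT, smul_eq_C_mul, pderiv_mul, pderiv_X, pderiv_pow, pderiv_two, C_two]; ring
theorem pd1_zT : pderiv 1 (X 2 * TT) = 2 * X 2 := by
  simp [TT, smul_eq_C_mul, pderiv_mul, pderiv_X, pderiv_pow, pderiv_two, C_two]; ring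

theorem lagr_lin (h f g : PL) (r s : ℝ) : lagr h (r • f + s • g) = r • lagr h f + s • lagr h g := by
  rw [lagr_add_right, lagr_smul_right, lagr_smul_right]
theorem lagr_lin' (h f g : PL) (r s : ℝ) : lagr h (r • f - s • g) = r • lagr h f - s • lagr h g := by
  rw [lagr_sub_right, lagr_smul_right, lagr_smul_right]
theorem pd1_lin (f g : PL) (r s : ℝ) :
    pderiv 1 (r • f + s • g) = r • pderiv 1 f + s • pderiv 1 g := by
  rw [map_add, Derivation.map_smul, Derivation.map_smul]

theorem L_2_gl {f : PL} (hf : f ∈ Lgrade 2) {a b c d : ℝ}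
    (h2 : lagr (X 2) f = a • (X 0 * TT) + b • (X 2 * TT))
    (h0 : lagr (X 0) f = c • (X 0 * TT) + d • (X 2 * TT)) : f = (b / 2) • TT ^ 2 := by
  have hD := lagr_compat f
  have e2 := pd1_X2 f
  have e0 := pd1_X0 f
  rw [h2, h0] at hD
  simp only [lagr_add_right, lagr_smul_right, X2_xT, X0_xT, X2_zT, X0_zT, q4_lin, q4_sub] at hD
  rw [h2, ← hD, q4_X2] at e2
  rw [h0, ← hD, q4_X0] at e0
  rw [pd1_lin, pd1_xT, pd1_zT] at e2 e0
  have e2' : (C (2 * a) * X 0 + C (2 * b) * X 2 : PL) = a • (2 * X 0) + b • (2 * X 2) := by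
    simp [smul_eq_C_mul, C_two]; ring
  have e0' : (C (2 * c) * X 0 + C (2 * d) * X 2 : PL) = c • (2 * X 0) + d • (2 * X 2) := by
    simp [smul_eq_C_mul, C_two]; ring
  obtain ⟨i1, i2⟩ := lin_inj (e2'.trans e2)
  obtain ⟨i3, i4⟩ := lin_inj (e0'.trans e0)
  have ha : a = 0 := by linarith
  have hd : d = 0 := by linarith
  have hc : c = b := by linarith
  subst ha hd hc
  apply L_trans_eq (by norm_num) hf (Submodule.smul_mem _ _ TT2_mem)
  · rw [h0, lagr_smul_right, X0_TT2]; module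
  · rw [h2, lagr_smul_right, X2_TT2]; module

theorem L_3_gl {f : PL} (hf : f ∈ Lgrade 3) {a b : ℝ}
    (h2 : lagr (X 2) f = a • TT ^ 2) (h0 : lagr (X 0) f = b • TT ^ 2) : f = 0 := by
  have hD := lagr_compat f
  have e2 := pd1_X2 f
  rw [h2, h0] at hD
  simp only [lagr_smul_right, X2_TT2, X0_TT2] at hD
  rw [h2, ← hD] at e2
  simp only [lagr_sub_right, lagr_smul_right, X2_xT, X2_zT] at e2
  have hp : pderiv 1 (TT ^ 2) = q4 0 0 0 4 := by
    simp [q4, TT, smul_eq_C_mul, pderiv_mul, pderiv_X, pderiv_pow, pderiv_two, C_four]; ring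
  rw [Derivation.map_smul, hp] at e2
  have e3 : q4 0 0 0 (4 * a) = q4 0 (2 * a) (- 2 * b) (- 2 * a) := by
    have l := q4_lin a 0 0 0 0 4 0 0 0 0
    have r := q4_lin (2 * a) (-2 * b) 0 1 0 (-1) 0 0 1 0
    calc q4 0 0 0 (4 * a) = a • q4 0 0 0 4 + (0:ℝ) • q4 0 0 0 0 := by
          rw [l]; congr 1 <;> ring
      _ = (2 * a) • q4 0 1 0 (-1) + (-2 * b) • q4 0 0 1 0 := by
          rw [zero_smul, add_zero, e2]; module
      _ = _ := by rw [r]; congr 1 <;> ring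
  obtain ⟨i1, i2, i3, i4⟩ := q4_inj e3
  have ha : a = 0 := by linarith
  have hb : b = 0 := by linarith
  subst ha hb
  exact L_trans (by norm_num) hf (by rw [h0]; simp) (by rw [h2]; simp)

theorem X2_PA : lagr (X 2) PA = q4 (-3) 0 (-3) 0 := by
  rw [lagr_X2]
  simp [PA, q4, TT, smul_eq_C_mul, pderiv_mul, pderiv_X, pderiv_pow, pderiv_two, C_three]; ring
theorem X0_PA : lagr (X 0) PA = q4 0 0 0 (-2) := by
  rw [lagr_X0]
  simp [PA, q4, TT, smul_eq_C_mul, pderiv_mul, pderiv_X, pderiv_pow, pderiv_two, C_two]; ring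
theorem X2_PB : lagr (X 2) PB = q4 0 0 0 (-2) := by
  rw [lagr_X2]
  simp [PB, q4, TT, smul_eq_C_mul, pderiv_mul, pderiv_X, pderiv_pow, pderiv_two, C_two]; ring
theorem X0_PB : lagr (X 0) PB = q4 3 0 3 0 := by
  rw [lagr_X0]
  simp [PB, q4, TT, smul_eq_C_mul, pderiv_mul, pderiv_X, pderiv_pow, pderiv_two, C_three]; ring
theorem X2_PQ : lagr (X 2) PQ = (-4:ℝ) • PA := by
  rw [lagr_X2]
  simp [PA, PQ, TT, smul_eq_C_mul, pderiv_mul, pderiv_X, pderiv_pow, pderiv_two, pderiv_four, C_four]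
  ring
theorem X0_PQ : lagr (X 0) PQ = (4:ℝ) • PB := by
  rw [lagr_X0]
  simp [PB, PQ, TT, smul_eq_C_mul, pderiv_mul, pderiv_X, pderiv_pow, pderiv_two, pderiv_four, C_four]
  ring
theorem pd1_PA : pderiv 1 PA = -4 * X 2 := by
  simp [PA, TT, smul_eq_C_mul, pderiv_mul, pderiv_X, pderiv_pow, pderiv_two, C_two]; ring
theorem pd1_PB : pderiv 1 PB = 4 * X 0 := by
  simp [PB, TT, smul_eq_C_mul, pderiv_mul, pderiv_X, pderiv_pow, pderiv_two, C_two]; ring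

theorem L_2_co {f : PL} (hf : f ∈ Lgrade 2) {a b c d : ℝ}
    (h2 : lagr (X 2) f = a • PA + b • PB)
    (h0 : lagr (X 0) f = c • PA + d • PB) : f = (-a / 4) • PQ := by
  have hD := lagr_compat f
  have e2 := pd1_X2 f
  have e0 := pd1_X0 f
  rw [h2, h0] at hD
  rw [lagr_lin, lagr_lin, X2_PA, X0_PA, X2_PB, X0_PB, q4_lin, q4_lin, q4_sub] at hD
  rw [h2, ← hD, q4_X2] at e2
  rw [h0, ← hD, q4_X0] at e0
  rw [pd1_lin, pd1_PA, pd1_PB] at e2 e0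
  have e2' : (C (4 * b) * X 0 + C (-4 * a) * X 2 : PL) = a • (-4 * X 2) + b • (4 * X 0) := by
    simp [smul_eq_C_mul, C_four]; ring
  have e0' : (C (4 * d) * X 0 + C (-4 * c) * X 2 : PL) = c • (-4 * X 2) + d • (4 * X 0) := by
    simp [smul_eq_C_mul, C_four]; ring
  obtain ⟨i1, i2⟩ := lin_inj (e2'.trans e2)
  obtain ⟨i3, i4⟩ := lin_inj (e0'.trans e0)
  have hb : b = 0 := by linarith
  have hc : c = 0 := by linarith
  have hd : d = -a := by linarith
  subst hb hc hd
  apply L_trans_eq (by norm_num) hf (Submodule.smul_mem _ _ PQ_mem)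
  · rw [h0, lagr_smul_right, X0_PQ]; module
  · rw [h2, lagr_smul_right, X2_PQ]; module

theorem L_3_co {f : PL} (hf : f ∈ Lgrade 3) {a b : ℝ}
    (h2 : lagr (X 2) f = a • PQ) (h0 : lagr (X 0) f = b • PQ) : f = 0 := by
  have hD := lagr_compat f
  have e2 := pd1_X2 f
  rw [h2, h0] at hD
  rw [lagr_smul_right, lagr_smul_right, X2_PQ, X0_PQ] at hD
  rw [h2, ← hD, lagr_lin', lagr_smul_right, lagr_smul_right, X2_PA, X2_PB] at e2
  have hp : pderiv 1 PQ = q4 0 0 0 16 := by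
    have : (C 16 : PL) = 16 := map_ofNat C 16
    simp [PQ, q4, TT, smul_eq_C_mul, pderiv_mul, pderiv_X, pderiv_pow, pderiv_two, pderiv_four, this]
    ring
  rw [Derivation.map_smul, hp] at e2
  have e3 : q4 0 0 0 (16 * a) = q4 (-12 * b) 0 (-12 * b) (- 8 * a) := by
    have l := q4_lin a 0 0 0 0 16 0 0 0 0
    have r := q4_lin (4 * a) (4 * b) 0 0 0 (-2) (-3) 0 (-3) 0
    calc q4 0 0 0 (16 * a) = a • q4 0 0 0 16 + (0:ℝ) • q4 0 0 0 0 := by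
          rw [l]; congr 1 <;> ring
      _ = (4 * a) • q4 0 0 0 (-2) + (4 * b) • q4 (-3) 0 (-3) 0 := by
          rw [zero_smul, add_zero, e2]; module
      _ = _ := by rw [r]; congr 1 <;> ring
  obtain ⟨i1, i2, i3, i4⟩ := q4_inj e3
  have ha : a = 0 := by linarith
  have hb : b = 0 := by linarith
  subst ha hb
  exact L_trans (by norm_num) hf (by rw [h0]; simp) (by rw [h2]; simp)

theorem br_xT_zT : lagr (X 0 * TT) (X 2 * TT) = TT ^ 2 := by
  simp [lagr, TT, pderiv_mul, pderiv_X, pderiv_pow, pderiv_two]; ring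
theorem br_PA_PB : lagr PA PB = PQ := by
  simp [lagr, PA, PB, PQ, TT, pderiv_mul, pderiv_X, pderiv_pow, pderiv_two]; ring

/-- brackets of degree zero elements -/
theorem br_q4 (a b c d a' b' c' d' : ℝ) : lagr (q4 a b c d) (q4 a' b' c' d') =
    q4 (2 * (a * b' - b * a')) (4 * (a * c' - c * a')) (2 * (b * c' - c * b')) 0 := by
  simp [lagr, q4, TT, smul_eq_C_mul, pderiv_mul, pderiv_X, pderiv_pow, pderiv_two, C_two, C_four]; ring

theorem xx_c6 (s0 s1 s2 s3 e k : ℝ) : lagr (X 0 ^ 2) (c6 s0 s1 s2 s3 e k) =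
    c6 (2 * s1) (4 * s2) (6 * s3) 0 (2 * k) 0 := by
  have : (C 6 : PL) = 6 := map_ofNat C 6
  simp [lagr, c6, TT, smul_eq_C_mul, pderiv_mul, pderiv_X, pderiv_pow, pderiv_two, C_two, C_four, this]; ring

theorem zz_c6 (s0 s1 s2 s3 e k : ℝ) : lagr (X 2 ^ 2) (c6 s0 s1 s2 s3 e k) =
    c6 0 (-6 * s0) (-4 * s1) (-2 * s2) 0 (-2 * e) := by
  have : (C 6 : PL) = 6 := map_ofNat C 6
  simp [lagr, c6, TT, smul_eq_C_mul, pderiv_mul, pderiv_X, pderiv_pow, pderiv_two, C_two, C_four, this]; ring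

theorem TT_act {p : ℤ} {f : PL} (hf : f ∈ Lgrade p) : lagr TT f = (p : ℝ) • f := by
  have e : lagr TT f = X 0 * pderiv 0 f + 2 * (X 1 * pderiv 1 f) + X 2 * pderiv 2 f - 2 * f := by
    simp [lagr, TT, pderiv_mul, pderiv_X, pderiv_two]; ring
  have hX : ∀ (i : Fin 3) (m : Fin 3 →₀ ℕ), coeff m (X i * pderiv i f) = m i * coeff m f := by
    intro i m
    rw [coeff_X_mul']
    split_ifs with h
    · have hle : Finsupp.single i 1 ≤ m := by
        rw [Finsupp.single_le_iff]
        have := Finsupp.mem_support_iff.mp h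
        omega
      rw [coeff_pderiv, tsub_add_cancel_of_le hle]
      have h1 : 1 ≤ m i := by rwa [Finsupp.single_le_iff] at hle
      have h2 : (m - Finsupp.single i 1 : Fin 3 →₀ ℕ) i = m i - 1 := by simp
      rw [h2]; push_cast [h1]; ring
    · simp at h; simp [h]
  rw [e]
  ext m
  rw [coeff_sub, coeff_add, coeff_add, ← C_two, coeff_C_mul, coeff_C_mul, hX, hX, hX, coeff_smul]
  by_cases hm : coeff m f = 0
  · simp [hm]
  · have := mem_Lgrade.mp hf m hm
    have h' : ((wt m : ℤ) : ℝ) = p + 2 := by rw [this]; push_cast; ring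
    simp only [wt] at h'; push_cast at h'
    rw [smul_eq_mul, show (p:ℝ) = m 0 + 2 * m 1 + m 2 - 2 by linarith]
    ring

end

section

/-! ### Graded subalgebras of `L` -/

structure GS (h : ℤ → Submodule ℝ PL) : Prop where
  le : ∀ p, h p ≤ Lgrade p
  br : ∀ p q r : ℤ, -2 ≤ p → -2 ≤ q → p + q = r → ∀ a ∈ h p, ∀ b ∈ h q, lagr a b ∈ h r
  x : X 0 ∈ h (-1)
  z : X 2 ∈ h (-1)
  bot : ∃ n : ℤ, ∀ p, n ≤ p → h p = ⊥

variable {h : ℤ → Submodule ℝ PL}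

theorem GS.d2 (H : GS h) {p r : ℤ} (hp : -2 ≤ p) (hr : -1 + p = r) {f : PL} (hf : f ∈ h p) :
    lagr (X 2) f ∈ h r := H.br (-1) p r (by norm_num) hp hr _ H.z _ hf
theorem GS.d0 (H : GS h) {p r : ℤ} (hp : -2 ≤ p) (hr : -1 + p = r) {f : PL} (hf : f ∈ h p) :
    lagr (X 0) f ∈ h r := H.br (-1) p r (by norm_num) hp hr _ H.x _ hf

theorem GS.prop (H : GS h) {p : ℤ} (hp : 0 ≤ p) (h0 : h p = ⊥) {q : ℤ} (hq : p ≤ q) : h q = ⊥ := by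
  induction q, hq using Int.leInduction with
  | base => exact h0
  | succ q hq ih =>
    rw [eq_bot_iff]
    intro a ha
    have h2 := H.d2 (by omega) (r := q) (by ring) ha
    have h0 := H.d0 (by omega) (r := q) (by ring) ha
    rw [ih, Submodule.mem_bot] at h2 h0
    exact L_trans (by omega) (H.le _ ha) h0 h2

theorem c6_inj {a b c d e k a' b' c' d' e' k' : ℝ}
    (hE : c6 a b c d e k = c6 a' b' c' d' e' k') :
    a = a' ∧ b = b' ∧ c = c' ∧ d = d' ∧ e = e' ∧ k = k' := by
  have h2 := congrArg (lagr (X 2)) hE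
  have h0 := congrArg (lagr (X 0)) hE
  rw [c6_X2, c6_X2] at h2
  rw [c6_X0, c6_X0] at h0
  obtain ⟨_, _, _, _⟩ := q4_inj h2
  obtain ⟨_, _, _, _⟩ := q4_inj h0
  refine ⟨?_, ?_, ?_, ?_, ?_, ?_⟩ <;> linarith

theorem GS.no_x3 (H : GS h) (hz : X 2 ^ 2 ∈ h 0) : (X 0 ^ 3 : PL) ∉ h 1 := by
  intro h3
  have e1 := H.br 0 1 1 (by norm_num) (by norm_num) rfl _ hz _ h3
  have e2 := zz_c6 1 0 0 0 0 0
  have e3 : c6 1 0 0 0 0 0 = X 0 ^ 3 := by simp [c6]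
  rw [e3] at e2
  rw [e2] at e1
  have e4 : (X 0 ^ 2 * X 2 : PL) ∈ h 1 := by
    have := Submodule.smul_mem _ (-6 : ℝ)⁻¹ e1
    convert this using 1
    simp [c6, smul_smul]
  have key : ∀ n : ℕ, (X 0 ^ (n + 3) : PL) ∈ h (n + 1) := by
    intro n
    induction n with
    | zero => simpa using h3
    | succ n ih =>
      have := H.br 1 (n + 1) ((n + 1 : ℕ) + 1) (by norm_num) (by omega) (by push_cast; ring) _ e4 _ ih
      have e : lagr (X 0 ^ 2 * X 2) (X 0 ^ (n + 3)) = (-(n + 3) : ℝ) • X 0 ^ (n + 1 + 3) := by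
        simp [lagr, pderiv_mul, pderiv_X, pderiv_pow, smul_eq_C_mul, C_three]; ring
      rw [e] at this
      have h' := Submodule.smul_mem _ (-(n + 3) : ℝ)⁻¹ this
      rwa [smul_smul, inv_mul_cancel₀ (by rw [neg_ne_zero]; positivity), one_smul] at h'
  obtain ⟨n, hn⟩ := H.bot
  have := key n.toNat
  rw [hn _ (by have := Int.self_le_toNat n; omega), Submodule.mem_bot] at this
  exact pow_ne_zero _ (X_ne_zero _) this

theorem GS.h1_sl (H : GS h) (hx : X 0 ^ 2 ∈ h 0) (hz : X 2 ^ 2 ∈ h 0) {f : PL}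
    (hf : f ∈ h 1) : ∃ e k : ℝ, f = e • (X 0 * TT) + k • (X 2 * TT) := by
  have XX : ∀ {s0 s1 s2 s3 e k : ℝ}, c6 s0 s1 s2 s3 e k ∈ h 1 →
      c6 (2 * s1) (4 * s2) (6 * s3) 0 (2 * k) 0 ∈ h 1 := by
    intro s0 s1 s2 s3 e k hm
    rw [← xx_c6 s0 s1 s2 s3 e k]; exact H.br 0 1 1 (by norm_num) (by norm_num) rfl _ hx _ hm
  have ZZ : ∀ {s0 s1 s2 s3 e k : ℝ}, c6 s0 s1 s2 s3 e k ∈ h 1 →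
      c6 0 (-6 * s0) (-4 * s1) (-2 * s2) 0 (-2 * e) ∈ h 1 := by
    intro s0 s1 s2 s3 e k hm
    rw [← zz_c6 s0 s1 s2 s3 e k]; exact H.br 0 1 1 (by norm_num) (by norm_num) rfl _ hz _ hm
  have key : ∀ s : ℝ, c6 s 0 0 0 0 0 ∈ h 1 → s = 0 := by
    intro s hs
    by_contra hne
    apply H.no_x3 hz
    have := Submodule.smul_mem _ s⁻¹ hs
    simpa [c6, smul_smul, inv_mul_cancel₀ hne] using this
  have k3 : ∀ {s0 s1 s2 s3 e k : ℝ}, c6 s0 s1 s2 s3 e k ∈ h 1 → s3 = 0 := by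
    intro s0 s1 s2 s3 e k hm
    have := XX (XX (XX hm))
    simp only [mul_zero] at this
    have := key _ this
    linarith
  have k2 : ∀ {s0 s1 s2 s3 e k : ℝ}, c6 s0 s1 s2 s3 e k ∈ h 1 → s2 = 0 := by
    intro s0 s1 s2 s3 e k hm
    have h3 := k3 hm
    subst h3
    have := XX (XX hm)
    simp only [mul_zero] at this
    have := key _ this
    linarith
  have k1 : ∀ {s0 s1 s2 s3 e k : ℝ}, c6 s0 s1 s2 s3 e k ∈ h 1 → s1 = 0 := by
    intro s0 s1 s2 s3 e k hm
    have := k2 (ZZ hm)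
    linarith
  have k0 : ∀ {s0 s1 s2 s3 e k : ℝ}, c6 s0 s1 s2 s3 e k ∈ h 1 → s0 = 0 := by
    intro s0 s1 s2 s3 e k hm
    have := k1 (ZZ hm)
    linarith
  obtain ⟨s0, s1, s2, s3, e, k, rfl⟩ := L_1 (H.le _ hf)
  refine ⟨e, k, ?_⟩
  rw [k0 hf, k1 hf, k2 hf, k3 hf]
  simp [c6]

theorem xTzT_X2 (e k : ℝ) : lagr (X 2) (e • (X 0 * TT) + k • (X 2 * TT)) = q4 0 e k (-e) := by
  have := c6_X2 0 0 0 0 e k; simpa [c6] using this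
theorem xTzT_X0 (e k : ℝ) : lagr (X 0) (e • (X 0 * TT) + k • (X 2 * TT)) = q4 e k 0 k := by
  have := c6_X0 0 0 0 0 e k; simpa [c6] using this

/-- no first prolongation for `sl(2)` -/
theorem GS.sl_bot (H : GS h) (hx : X 0 ^ 2 ∈ h 0) (hz : X 2 ^ 2 ∈ h 0)
    (h0 : ∀ a b c d : ℝ, q4 a b c d ∈ h 0 → d = 0) : h 1 = ⊥ := by
  rw [eq_bot_iff]
  intro f hf
  obtain ⟨e, k, rfl⟩ := H.h1_sl hx hz hf
  have e2 := H.d2 (by norm_num) (r := 0) rfl hf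
  have e0 := H.d0 (by norm_num) (r := 0) rfl hf
  rw [xTzT_X2] at e2
  rw [xTzT_X0] at e0
  have i1 := h0 _ _ _ _ e2
  have i2 := h0 _ _ _ _ e0
  rw [show e = 0 by linarith, i2]; simp

theorem q4_1000 : q4 1 0 0 0 = X 0 ^ 2 := by simp [q4]
theorem q4_0010 : q4 0 0 1 0 = X 2 ^ 2 := by simp [q4]
theorem q4_0100 : q4 0 1 0 0 = X 0 * X 2 := by simp [q4]
theorem q4_0001 : q4 0 0 0 1 = TT := by simp [q4]

/-- the prolongation in the `gl(2)` case -/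
theorem GS.gl (H : GS h) (hx : X 0 ^ 2 ∈ h 0) (hz : X 2 ^ 2 ∈ h 0) (hn : h 1 ≠ ⊥) :
    h 1 = Submodule.span ℝ {X 0 * TT, X 2 * TT} ∧ h 2 = Submodule.span ℝ {TT ^ 2} ∧ h 3 = ⊥ := by
  obtain ⟨f, hf, hne⟩ := Submodule.exists_mem_ne_zero_of_ne_bot hn
  obtain ⟨e, k, rfl⟩ := H.h1_sl hx hz hf
  have hA : ∀ e k : ℝ, e • (X 0 * TT) + k • (X 2 * TT) ∈ h 1 →
      k • (X 0 * TT) ∈ h 1 ∧ e • (X 2 * TT) ∈ h 1 := by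
    intro e k hf
    have e1 := H.br 0 1 1 (by norm_num) (by norm_num) rfl _ hx _ hf
    have e2 := H.br 0 1 1 (by norm_num) (by norm_num) rfl _ hz _ hf
    have i1 := xx_c6 0 0 0 0 e k
    have i2 := zz_c6 0 0 0 0 e k
    rw [show c6 0 0 0 0 e k = e • (X 0 * TT) + k • (X 2 * TT) by simp [c6]] at i1 i2
    rw [i1] at e1
    rw [i2] at e2
    constructor
    · convert Submodule.smul_mem _ (2:ℝ)⁻¹ e1 using 1
      simp [c6, smul_smul]
    · convert Submodule.smul_mem _ (-2:ℝ)⁻¹ e2 using 1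
      simp [c6, smul_smul]
  have hxz : (X 0 * TT : PL) ∈ h 1 ∧ (X 2 * TT : PL) ∈ h 1 := by
    have hs : ∀ {r : ℝ} {u : PL}, r ≠ 0 → r • u ∈ h 1 → u ∈ h 1 := by
      intro r u hr hu
      have := Submodule.smul_mem _ r⁻¹ hu
      rwa [smul_smul, inv_mul_cancel₀ hr, one_smul] at this
    by_cases hk : k = 0
    · have he : e ≠ 0 := by
        rintro rfl; apply hne; simp [hk]
      have h1 := hs he (hA _ _ hf).2
      have h2 := (hA 0 1 (by simpa using h1)).1
      exact ⟨by simpa using h2, h1⟩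
    · have h1 := hs hk (hA _ _ hf).1
      have h2 := (hA 1 0 (by simpa using h1)).2
      exact ⟨h1, by simpa using h2⟩
  have h1 : h 1 = Submodule.span ℝ {X 0 * TT, X 2 * TT} := by
    apply le_antisymm
    · intro u hu
      obtain ⟨a, b, rfl⟩ := H.h1_sl hx hz hu
      exact Submodule.mem_span_pair.mpr ⟨a, b, rfl⟩
    · rw [Submodule.span_le]
      rintro u (rfl | rfl)
      exacts [hxz.1, hxz.2]
  have h2 : h 2 = Submodule.span ℝ {TT ^ 2} := by
    apply le_antisymm
    · intro u hu
      obtain ⟨a, b, e2⟩ := H.h1_sl hx hz (H.d2 (by norm_num) (r := 1) rfl hu)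
      obtain ⟨c, d, e0⟩ := H.h1_sl hx hz (H.d0 (by norm_num) (r := 1) rfl hu)
      rw [L_2_gl (H.le _ hu) e2 e0]
      exact Submodule.smul_mem _ _ (Submodule.mem_span_singleton_self _)
    · rw [Submodule.span_le, Set.singleton_subset_iff]
      have := H.br 1 1 2 (by norm_num) (by norm_num) rfl _ hxz.1 _ hxz.2
      rwa [br_xT_zT] at this
  refine ⟨h1, h2, ?_⟩
  rw [eq_bot_iff]
  intro u hu
  have e2 := (H.d2 (by norm_num) (r := 2) rfl hu)
  have e0 := (H.d0 (by norm_num) (r := 2) rfl hu)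
  rw [h2, Submodule.mem_span_singleton] at e2 e0
  obtain ⟨a, ha⟩ := e2
  obtain ⟨b, hb⟩ := e0
  exact L_3_gl (H.le _ hu) ha.symm hb.symm

theorem NN_q4 (a d : ℝ) : q4 a 0 a d = a • NN + d • TT := by
  simp [q4]

theorem c6_lin (r s a b c d e k a' b' c' d' e' k' : ℝ) :
    r • c6 a b c d e k + s • c6 a' b' c' d' e' k' =
    c6 (r * a + s * a') (r * b + s * b') (r * c + s * c') (r * d + s * d') (r * e + s * e')
      (r * k + s * k') := by
  simp [c6, smul_eq_C_mul]; ring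

theorem PA_c6 : PA = c6 1 0 1 0 0 (-2) := by simp [PA, c6, smul_eq_C_mul, C_two]; ring
theorem PB_c6 : PB = c6 0 1 0 1 2 0 := by simp [PB, c6, smul_eq_C_mul, C_two]; ring

theorem NN_PAB (r s : ℝ) : lagr NN (r • PA + s • PB) = (2 * s) • PA + (-2 * r) • PB := by
  rw [PA_c6, PB_c6, c6_lin, lagr_add_left, xx_c6, zz_c6]
  rw [c6_lin]
  have := c6_lin 1 1
  simp only [one_smul] at this
  rw [this]; congr 1 <;> ring

/-- the prolongation in the `co(2)` case -/
theorem GS.co (H : GS h) (h0 : h 0 = Submodule.span ℝ {NN, TT}) (hn : h 1 ≠ ⊥) :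
    h 1 = Submodule.span ℝ {PA, PB} ∧ h 2 = Submodule.span ℝ {PQ} ∧ h 3 = ⊥ := by
  have hform : ∀ u ∈ h 1, ∃ r s : ℝ, u = r • PA + s • PB := by
    intro u hu
    have e2 := (H.d2 (by norm_num) (r := 0) rfl hu)
    have e0 := (H.d0 (by norm_num) (r := 0) rfl hu)
    rw [h0, Submodule.mem_span_pair] at e2 e0
    obtain ⟨a, b, e2⟩ := e2
    obtain ⟨c, d, e0⟩ := e0
    rw [← NN_q4] at e2 e0
    exact ⟨_, _, L_1_co (H.le _ hu) e2.symm e0.symm⟩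
  obtain ⟨f, hf, hne⟩ := Submodule.exists_mem_ne_zero_of_ne_bot hn
  obtain ⟨r, s, rfl⟩ := hform f hf
  have hNN : NN ∈ h 0 := h0 ▸ Submodule.subset_span (by simp)
  have e1 := H.br 0 1 1 (by norm_num) (by norm_num) rfl _ hNN _ hf
  rw [NN_PAB] at e1
  have hrs : r ^ 2 + s ^ 2 ≠ 0 := by
    intro h'
    have hr : r = 0 := by nlinarith [sq_nonneg r, sq_nonneg s]
    have hs : s = 0 := by nlinarith [sq_nonneg r, sq_nonneg s]
    apply hne; rw [hr, hs, zero_smul, zero_smul, add_zero]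
  have hPA : PA ∈ h 1 := by
    have := Submodule.smul_mem _ (r ^ 2 + s ^ 2)⁻¹ (Submodule.add_mem _
      (Submodule.smul_mem _ r hf) (Submodule.smul_mem _ (s / 2) e1))
    have e : r • (r • PA + s • PB) + (s / 2) • ((2 * s) • PA + (-2 * r) • PB) =
      (r ^ 2 + s ^ 2) • PA := by module
    rwa [e, smul_smul, inv_mul_cancel₀ hrs, one_smul] at this
  have hPB : PB ∈ h 1 := by
    have := Submodule.smul_mem _ (r ^ 2 + s ^ 2)⁻¹ (Submodule.add_mem _
      (Submodule.smul_mem _ s hf) (Submodule.smul_mem _ (-r / 2) e1))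
    have e : s • (r • PA + s • PB) + (-r / 2) • ((2 * s) • PA + (-2 * r) • PB) =
      (r ^ 2 + s ^ 2) • PB := by module
    rwa [e, smul_smul, inv_mul_cancel₀ hrs, one_smul] at this
  have h1 : h 1 = Submodule.span ℝ {PA, PB} := by
    apply le_antisymm
    · intro u hu
      obtain ⟨a, b, rfl⟩ := hform u hu
      exact Submodule.mem_span_pair.mpr ⟨a, b, rfl⟩
    · rw [Submodule.span_le]
      rintro u (rfl | rfl)
      exacts [hPA, hPB]
  have h2 : h 2 = Submodule.span ℝ {PQ} := by
    apply le_antisymm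
    · intro u hu
      obtain ⟨a, b, e2⟩ := hform _ (H.d2 (by norm_num) (r := 1) rfl hu)
      obtain ⟨c, d, e0⟩ := hform _ (H.d0 (by norm_num) (r := 1) rfl hu)
      rw [L_2_co (H.le _ hu) e2 e0]
      exact Submodule.smul_mem _ _ (Submodule.mem_span_singleton_self _)
    · rw [Submodule.span_le, Set.singleton_subset_iff]
      have := H.br 1 1 2 (by norm_num) (by norm_num) rfl _ hPA _ hPB
      rwa [br_PA_PB] at this
  refine ⟨h1, h2, ?_⟩
  rw [eq_bot_iff]
  intro u hu
  have e2 := (H.d2 (by norm_num) (r := 2) rfl hu)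
  have e0 := (H.d0 (by norm_num) (r := 2) rfl hu)
  rw [h2, Submodule.mem_span_singleton] at e2 e0
  obtain ⟨a, ha⟩ := e2
  obtain ⟨b, hb⟩ := e0
  exact L_3_co (H.le _ hu) ha.symm hb.symm

theorem q4_smul (r a b c d : ℝ) : r • q4 a b c d = q4 (r * a) (r * b) (r * c) (r * d) := by
  have := q4_lin r 0 a b c d 0 0 0 0
  simpa using this

/-- no first prolongation in the one-dimensional case -/
theorem GS.one (H : GS h) {α : ℝ} (h0 : ∀ f ∈ h 0, ∃ r : ℝ, f = r • q4 1 0 1 α) : h 1 = ⊥ := by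
  rw [eq_bot_iff]
  intro u hu
  obtain ⟨r, e2⟩ := h0 _ (H.d2 (by norm_num) (r := 0) rfl hu)
  obtain ⟨s, e0⟩ := h0 _ (H.d0 (by norm_num) (r := 0) rfl hu)
  rw [q4_smul] at e2 e0
  obtain ⟨i1, i2, -⟩ := L_1' (H.le _ hu) e2 e0
  have hs : s = - 3 * r * α / 2 := by linarith
  have hr : r * (9 * α ^ 2 + 4) = 0 := by rw [hs] at i2; linarith
  have hr : r = 0 := by
    rcases mul_eq_zero.mp hr with h | h
    · exact h
    · nlinarith [sq_nonneg α]
  subst hr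
  have hs : s = 0 := by rw [hs]; ring
  subst hs
  exact L_trans (by norm_num) (H.le _ hu) (by rw [e0]; simp [q4]) (by rw [e2]; simp [q4])

end

section

variable {h : ℤ → Submodule ℝ PL}

theorem three_det {V : Submodule ℝ PL} {a b c a' b' c' a'' b'' c'' : ℝ}
    (h1 : q4 a b c 0 ∈ V) (h2 : q4 a' b' c' 0 ∈ V) (h3 : q4 a'' b'' c'' 0 ∈ V)
    {D : ℝ} (hD : D = a * (b' * c'' - c' * b'') - b * (a' * c'' - c' * a'') + c * (a' * b'' - b' * a''))
    (hne : D ≠ 0) : X 0 ^ 2 ∈ V ∧ X 0 * X 2 ∈ V ∧ X 2 ^ 2 ∈ V := by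
  have key : ∀ r s t x y z : ℝ, r * a + s * a' + t * a'' = D * x → r * b + s * b' + t * b'' = D * y →
      r * c + s * c' + t * c'' = D * z → q4 x y z 0 ∈ V := by
    intro r s t x y z e1 e2 e3
    have := Submodule.smul_mem _ D⁻¹ (Submodule.add_mem _ (Submodule.add_mem _
      (Submodule.smul_mem _ r h1) (Submodule.smul_mem _ s h2)) (Submodule.smul_mem _ t h3))
    rw [q4_lin, ← one_smul ℝ (q4 _ _ _ _), q4_lin, q4_smul] at this
    convert this using 2
    · rw [one_mul, e1]; field_simp
    · rw [one_mul, e2]; field_simp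
    · rw [one_mul, e3]; field_simp
    · ring
  rw [← q4_1000, ← q4_0100, ← q4_0010]
  refine ⟨key (b' * c'' - c' * b'') (c * b'' - b * c'') (b * c' - c * b') _ _ _ ?_ ?_ ?_,
    key (c' * a'' - a' * c'') (a * c'' - c * a'') (c * a' - a * c') _ _ _ ?_ ?_ ?_,
    key (a' * b'' - b' * a'') (b * a'' - a * b'') (a * b' - b * a') _ _ _ ?_ ?_ ?_⟩ <;>
  · rw [hD]; ring

/-- Classification of irreducible degree zero parts -/
theorem GS.irr0 (H : GS h)
    (irr : ∀ p q : ℝ, (p ≠ 0 ∨ q ≠ 0) → ∃ a b c d : ℝ, q4 a b c d ∈ h 0 ∧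
      a * q ^ 2 - b * p * q + c * p ^ 2 ≠ 0) :
    (X 0 ^ 2 ∈ h 0 ∧ X 0 * X 2 ∈ h 0 ∧ X 2 ^ 2 ∈ h 0) ∨
    (∃ a b c d : ℝ, q4 a b c d ∈ h 0 ∧ b ^ 2 - 4 * a * c < 0 ∧
      ∀ f ∈ h 0, ∃ r e : ℝ, f = q4 (r * a) (r * b) (r * c) e) := by
  have hbr : ∀ {a b c d a' b' c' d' : ℝ}, q4 a b c d ∈ h 0 → q4 a' b' c' d' ∈ h 0 →
      q4 (2 * (a * b' - b * a')) (4 * (a * c' - c * a')) (2 * (b * c' - c * b')) 0 ∈ h 0 := by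
    intro a b c d a' b' c' d' h1 h2
    rw [← br_q4 a b c d a' b' c' d']
    exact H.br 0 0 0 (by norm_num) (by norm_num) rfl _ h1 _ h2
  by_cases hS : ∃ a b c d a' b' c' d' : ℝ, q4 a b c d ∈ h 0 ∧ q4 a' b' c' d' ∈ h 0 ∧
      (4 * (a * c' - c * a')) ^ 2 - 4 * (2 * (a * b' - b * a')) * (2 * (b * c' - c * b')) ≠ 0
  · left
    obtain ⟨a, b, c, d, a', b', c', d', h1, h2, hne⟩ := hS
    have h3 := hbr h1 h2
    have h4 := hbr h1 h3
    have h5 := hbr h2 h3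
    refine three_det h3 h4 h5 rfl ?_
    intro h0
    apply hne
    rw [← sq_eq_zero_iff]
    linear_combination (1 / (1)) * h0
  right
  push Not at hS
  obtain ⟨a, b, c, d, h1, hne⟩ := irr 1 0 (by simp)
  have hc : c ≠ 0 := by simpa using hne
  have nonull : ∀ a b c d : ℝ, q4 a b c d ∈ h 0 → b ^ 2 = 4 * a * c → a = 0 ∧ b = 0 ∧ c = 0 := by
    intro a b c d hn hK
    by_contra hnz
    obtain ⟨p, q, hpq, hroot⟩ : ∃ p q : ℝ, (p ≠ 0 ∨ q ≠ 0) ∧ ∀ a' b' c' : ℝ,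
        2 * c * a' - b * b' + 2 * a * c' = 0 → a' * q ^ 2 - b' * p * q + c' * p ^ 2 = 0 := by
      by_cases ha : a = 0
      · subst ha
        have hb : b = 0 := by rw [← sq_eq_zero_iff, hK]; ring
        have hc : c ≠ 0 := fun h => hnz ⟨rfl, hb, h⟩
        refine ⟨0, 1, by simp, fun a' b' c' e => ?_⟩
        have : c * a' = 0 := by rw [hb] at e; linarith
        have := (mul_eq_zero.mp this).resolve_left hc
        rw [this]; ring
      · refine ⟨2 * a, b, by simp [ha], fun a' b' c' e => ?_⟩
        linear_combination a' * hK + 2 * a * e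
    obtain ⟨a', b', c', d', h2, hne⟩ := irr p q hpq
    apply hne
    apply hroot
    have := hS _ _ _ _ _ _ _ _ hn h2
    rw [← sq_eq_zero_iff]
    linear_combination (1/4) * this - (4 * a' * c' - b' ^ 2) * hK
  refine ⟨a, b, c, d, h1, ?_, ?_⟩
  · by_contra hK
    push Not at hK
    set s := Real.sqrt (b ^ 2 - 4 * a * c) with hs
    have hs2 : s ^ 2 = b ^ 2 - 4 * a * c := Real.sq_sqrt hK
    -- a common root
    have hall : ∀ a' b' c' d' : ℝ, q4 a' b' c' d' ∈ h 0 → a' * c = c' * a ∧ b' * c = c' * b := by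
      intro a' b' c' d' h2
      obtain ⟨i1, i2, i3⟩ := nonull _ _ _ _ (hbr h1 h2) (by linarith [hS _ _ _ _ _ _ _ _ h1 h2])
      constructor <;> linarith
    obtain ⟨a', b', c', d', h2, hne⟩ := irr ((b + s) / (2 * c)) 1 (by simp)
    apply hne
    obtain ⟨i1, i2⟩ := hall _ _ _ _ h2
    have ea : a' = c' * a / c := by field_simp; exact i1
    have eb : b' = c' * b / c := by field_simp; exact i2
    rw [ea, eb]
    field_simp
    linear_combination c' * hs2
  · intro f hf
    obtain ⟨a', b', c', d', rfl⟩ := L_0 (H.le _ hf)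
    obtain ⟨i1, i2, i3⟩ := nonull _ _ _ _ (hbr h1 hf) (by linarith [hS _ _ _ _ _ _ _ _ h1 hf])
    refine ⟨c' / c, d', ?_⟩
    congr 1
    · field_simp; linarith
    · field_simp; linarith
    · field_simp

end

section

set_option linter.unusedSimpArgs false

variable {g : Type} [LieRing g] [LieAlgebra ℝ g] {F : ℤ → Submodule ℝ g} {wx wz : g}
  {lam : g →ₗ[ℝ] ℝ}

theorem Frame.gs (H : CLA F) (f : Frame F wx wz lam) : GS (hh F wx wz lam) where
  le := fun p => hh_le p
  br := fun p q r hp hq hr a ha b hb => f.hh_lie H hp hq ha hb hr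
  x := by rw [f.hh_m1 H]; exact Submodule.subset_span (by simp)
  z := by rw [f.hh_m1 H]; exact Submodule.subset_span (by simp)
  bot := by
    obtain ⟨n, hn⟩ := H.bot
    exact ⟨n, fun p hp => Frame.hh_bot H hn hp⟩

theorem Frame.indep (H : CLA F) (f : Frame F wx wz lam) {a b : ℝ}
    (h : a • wx + b • wz ∈ F 0) : a = 0 ∧ b = 0 := by
  have h1 := f.sg_kill H (p := -1) (u := a • wx + b • wz) (by simpa using h)
  rw [map_add, map_smul, map_smul, f.sg_wx H, f.sg_wz H] at h1
  exact X02_indep h1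

theorem Frame.act1 (H : CLA F) (f : Frame F wx wz lam) {e : g} (he : e ∈ F 0) {a b c d : ℝ}
    (h : sg wx wz lam 0 e = q4 a b c d) :
    ⁅e, wx⁆ + (b + d) • wx + (2 * c) • wz ∈ F 0 ∧ ⁅e, wz⁆ - (2 * a) • wx - (b - d) • wz ∈ F 0 := by
  have h1 := f.sg_lie H (p := 0) (q := -1) (by norm_num) (by norm_num) he f.mx
  have h2 := f.sg_lie H (p := 0) (q := -1) (by norm_num) (by norm_num) he f.mz
  rw [h, f.sg_wx H, lagr_skew, q4_X0] at h1
  rw [h, f.sg_wz H, lagr_skew, q4_X2] at h2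
  simp only [zero_add] at h1 h2
  have m1 : ⁅e, wx⁆ ∈ F (-1) := H.br' he f.mx (by norm_num)
  have m2 : ⁅e, wz⁆ ∈ F (-1) := H.br' he f.mz (by norm_num)
  constructor
  · have := f.sg_ker H (p := -1) (u := ⁅e, wx⁆ + (b + d) • wx + (2 * c) • wz) (by norm_num)
      (Submodule.add_mem _ (Submodule.add_mem _ m1 (Submodule.smul_mem _ _ f.mx))
        (Submodule.smul_mem _ _ f.mz)) (by
        rw [map_add, map_add, map_smul, map_smul, h1, f.sg_wx H, f.sg_wz H]
        simp [smul_eq_C_mul])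
    simpa using this
  · have := f.sg_ker H (p := -1) (u := ⁅e, wz⁆ - (2 * a) • wx - (b - d) • wz) (by norm_num)
      (Submodule.sub_mem _ (Submodule.sub_mem _ m2 (Submodule.smul_mem _ _ f.mx))
        (Submodule.smul_mem _ _ f.mz)) (by
        rw [map_sub, map_sub, map_smul, map_smul, h2, f.sg_wx H, f.sg_wz H]
        simp [smul_eq_C_mul]; ring)
    simpa using this

theorem Frame.act2 (H : CLA F) (f : Frame F wx wz lam) {e : g} (he : e ∈ F 0) {a b c d : ℝ}
    (h1 : ⁅e, wx⁆ + (b + d) • wx + (2 * c) • wz ∈ F 0)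
    (h2 : ⁅e, wz⁆ - (2 * a) • wx - (b - d) • wz ∈ F 0) :
    sg wx wz lam 0 e = q4 a b c d := by
  obtain ⟨a', b', c', d', h⟩ := L_0 (sg_mem wx wz lam 0 e)
  obtain ⟨i1, i2⟩ := f.act1 H he h
  have j1 := Submodule.sub_mem _ h1 i1
  have j2 := Submodule.sub_mem _ h2 i2
  rw [show ⁅e, wx⁆ + (b + d) • wx + (2 * c) • wz - (⁅e, wx⁆ + (b' + d') • wx + (2 * c') • wz) =
    ((b + d) - (b' + d')) • wx + (2 * c - 2 * c') • wz by module] at j1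
  rw [show ⁅e, wz⁆ - (2 * a) • wx - (b - d) • wz - (⁅e, wz⁆ - (2 * a') • wx - (b' - d') • wz) =
    (2 * a' - 2 * a) • wx + ((b' - d') - (b - d)) • wz by module] at j2
  obtain ⟨k1, k2⟩ := f.indep H j1
  obtain ⟨k3, k4⟩ := f.indep H j2
  rw [h]; congr 1 <;> linarith

/-- irreducibility in terms of the degree zero symbols -/
theorem Frame.irr (H : CLA F) (f : Frame F wx wz lam)
    (hirr : ∀ W : Submodule ℝ g, F 0 ≤ W → W ≤ F (-1) →
      (∀ u ∈ F 0, ∀ w ∈ W, ⁅u, w⁆ ∈ W) → W = F 0 ∨ W = F (-1)) (p q : ℝ) (hpq : p ≠ 0 ∨ q ≠ 0) :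
    ∃ a b c d : ℝ, q4 a b c d ∈ hh F wx wz lam 0 ∧ a * q ^ 2 - b * p * q + c * p ^ 2 ≠ 0 := by
  by_contra hcon
  push Not at hcon
  have hd : p ^ 2 + q ^ 2 ≠ 0 := by
    intro h'
    have hr : p = 0 := by nlinarith [sq_nonneg p, sq_nonneg q]
    have hs : q = 0 := by nlinarith [sq_nonneg p, sq_nonneg q]
    rcases hpq with h | h <;> contradiction
  have hvm : p • wx + q • wz ∈ F (-1) :=
    Submodule.add_mem _ (Submodule.smul_mem _ _ f.mx) (Submodule.smul_mem _ _ f.mz)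
  have h0 : F 0 ≤ F (-1) := H.anti (by norm_num)
  have hmem : ∀ y, y ∈ F 0 ⊔ Submodule.span ℝ {p • wx + q • wz} ↔
      ∃ r : ℝ, y - r • (p • wx + q • wz) ∈ F 0 := by
    intro y
    rw [Submodule.mem_sup]
    constructor
    · rintro ⟨y0, hy0, z, hz, rfl⟩
      obtain ⟨r, rfl⟩ := Submodule.mem_span_singleton.mp hz
      exact ⟨r, by simpa using hy0⟩
    · rintro ⟨r, hr⟩
      exact ⟨_, hr, _, Submodule.smul_mem _ r (Submodule.mem_span_singleton_self _), by abel⟩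
  have hinv : ∀ u ∈ F 0, ∀ w ∈ F 0 ⊔ Submodule.span ℝ {p • wx + q • wz}, ⁅u, w⁆ ∈ F 0 ⊔ Submodule.span ℝ {p • wx + q • wz} := by
    intro u hu w hw
    rw [hmem] at hw ⊢
    obtain ⟨r, hr⟩ := hw
    obtain ⟨a, b, c, d, hq⟩ := L_0 (sg_mem wx wz lam 0 u)
    obtain ⟨j1, j2⟩ := f.act1 H hu hq
    have hz := hcon a b c d (hq ▸ ⟨u, hu, rfl⟩)
    have j0 : ⁅u, w - r • (p • wx + q • wz)⁆ ∈ F 0 := H.br' hu hr (by norm_num)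
    refine ⟨r * (((-(b + d) * p + 2 * a * q) * p + (-2 * c * p + (b - d) * q) * q) / (p ^ 2 + q ^ 2)), ?_⟩
    have j3 := Submodule.add_mem _ j0 (Submodule.smul_mem _ r (Submodule.add_mem _
      (Submodule.smul_mem _ p j1) (Submodule.smul_mem _ q j2)))
    convert j3 using 1
    rw [lie_sub, lie_smul, lie_add, lie_smul, lie_smul]
    have e1 : ((-(b + d) * p + 2 * a * q) * p + (-2 * c * p + (b - d) * q) * q) / (p ^ 2 + q ^ 2) * p =
        (-(b + d) * p + 2 * a * q) := by
      field_simp; linear_combination (-2 * q) * hz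
    have e2 : ((-(b + d) * p + 2 * a * q) * p + (-2 * c * p + (b - d) * q) * q) / (p ^ 2 + q ^ 2) * q =
        (-2 * c * p + (b - d) * q) := by
      field_simp; linear_combination (2 * p) * hz
    generalize ((-(b + d) * p + 2 * a * q) * p + (-2 * c * p + (b - d) * q) * q) / (p ^ 2 + q ^ 2) = t at e1 e2
    rw [show (r * t) • (p • wx + q • wz) = r • ((t * p) • wx + (t * q) • wz) by module, e1, e2]
    module
  rcases hirr (F 0 ⊔ Submodule.span ℝ {p • wx + q • wz}) le_sup_left
    (sup_le h0 (by rw [Submodule.span_le, Set.singleton_subset_iff]; exact hvm)) hinv with hW | hW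
  · have : p • wx + q • wz ∈ F 0 := by
      rw [← hW, hmem]; exact ⟨1, by simp⟩
    obtain ⟨i, j⟩ := f.indep H this
    rcases hpq with h | h <;> contradiction
  · have h1 := f.mx
    have h2 := f.mz
    rw [← hW, hmem] at h1 h2
    obtain ⟨r, hr⟩ := h1
    obtain ⟨s, hs⟩ := h2
    rw [show wx - r • (p • wx + q • wz) = (1 - r * p) • wx + (- r * q) • wz by module] at hr
    rw [show wz - s • (p • wx + q • wz) = (- s * p) • wx + (1 - s * q) • wz by module] at hs
    obtain ⟨i1, i2⟩ := f.indep H hr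
    obtain ⟨i3, i4⟩ := f.indep H hs
    have : (1:ℝ) = 0 := by linear_combination i1 + r * p * i4 - s * p * i2
    norm_num at this

theorem frame_ex (H : CLA F) (h1 : Module.finrank ℝ (g ⧸ F (-1)) = 1)
    (h3 : Module.finrank ℝ (g ⧸ F 0) = 3) {u w : g} (hu : u ∈ F (-1)) (hw : w ∈ F (-1))
    (huw : ⁅u, w⁆ ∉ F (-1)) : ∃ lam, Frame F u w lam := by
  have : FiniteDimensional ℝ (g ⧸ F (-1)) := Module.finite_of_finrank_eq_succ h1
  have : FiniteDimensional ℝ (g ⧸ F 0) := Module.finite_of_finrank_eq_succ h3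
  let e : (g ⧸ F (-1)) ≃ₗ[ℝ] ℝ := LinearEquiv.ofFinrankEq _ _ (by rw [h1, Module.finrank_self])
  let l0 : g →ₗ[ℝ] ℝ := e.toLinearMap ∘ₗ (F (-1)).mkQ
  have hl0 : ∀ u, l0 u = 0 ↔ u ∈ F (-1) := by
    intro u
    simp [l0]
  have hne : l0 ⁅u, w⁆ ≠ 0 := fun h => huw ((hl0 _).mp h)
  let lam := (l0 ⁅u, w⁆)⁻¹ • l0
  have hker : ∀ u, lam u = 0 ↔ u ∈ F (-1) := by
    intro u
    simp [lam, hne, hl0]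
  have hnrm : lam ⁅u, w⁆ = 1 := by simp [lam, hne]
  refine ⟨lam, hu, hw, hker, hnrm, ?_⟩
  have h0 : F 0 ≤ F (-1) := H.anti (by norm_num)
  have hli : LinearIndependent ℝ ![(F 0).mkQ u, (F 0).mkQ w, (F 0).mkQ ⁅u, w⁆] := by
    rw [Fintype.linearIndependent_iff]
    intro c hc
    simp only [Fin.sum_univ_three, Matrix.cons_val] at hc
    have hm : c 0 • u + c 1 • w + c 2 • ⁅u, w⁆ ∈ F 0 := by
      rw [← Submodule.Quotient.mk_eq_zero, ← Submodule.mkQ_apply]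
      simpa only [map_add, map_smul] using hc
    have hc2 : c 2 = 0 := by
      have := (hker _).mpr (h0 hm)
      simp only [map_add, map_smul, (hker _).mpr hu, (hker _).mpr hw, hnrm] at this
      simpa using this
    have k1 := (hker _).mpr (H.br' (r := -1) hm hw (by norm_num))
    have k2 := (hker _).mpr (H.br' (r := -1) hu hm (by norm_num))
    rw [hc2] at k1 k2
    simp only [zero_smul, add_zero, add_lie, lie_add, smul_lie, lie_smul, lie_self, smul_zero, map_add, map_smul, hnrm, zero_add, map_zero, smul_eq_mul, mul_one] at k1 k2
    intro i
    fin_cases i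
    exacts [k1, k2, hc2]
  have hsp := hli.span_eq_top_of_card_eq_finrank' (by simp [h3])
  intro y hy
  have hy' : (F 0).mkQ y ∈ Submodule.span ℝ (Set.range ![(F 0).mkQ u, (F 0).mkQ w, (F 0).mkQ ⁅u, w⁆]) := by
    rw [hsp]; trivial
  rw [Submodule.mem_span_range_iff_exists_fun] at hy'
  obtain ⟨c, hc⟩ := hy'
  simp only [Fin.sum_univ_three, Matrix.cons_val] at hc
  have hm : y - c 0 • u - c 1 • w - c 2 • ⁅u, w⁆ ∈ F 0 := by
    rw [← Submodule.Quotient.mk_eq_zero, ← Submodule.mkQ_apply]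
    simp only [map_sub, map_smul]
    rw [← hc]; abel
  have hc2 : c 2 = 0 := by
    have := (hker _).mpr (h0 hm)
    simp only [map_sub, map_smul, (hker _).mpr hu, (hker _).mpr hw, (hker _).mpr hy, hnrm] at this
    simpa using this
  refine ⟨c 0, c 1, ?_⟩
  simpa [hc2] using hm

theorem cla_mk [FiniteDimensional ℝ g]
    (hneg : ∀ p : ℤ, p ≤ -2 → F p = ⊤)
    (hdec : ∀ p : ℤ, F (p + 1) ≤ F p)
    (hbr : ∀ p q : ℤ, ∀ x ∈ F p, ∀ y ∈ F q, ⁅x, y⁆ ∈ F (p + q))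
    (hstep : ∀ p : ℤ, 0 ≤ p → ∀ x : g,
      (x ∈ F (p + 1) ↔ x ∈ F p ∧ ∀ y ∈ F (-1), ⁅x, y⁆ ∈ F p))
    (hint : (⨅ p : ℤ, F p) = ⊥) : CLA F := by
  refine ⟨hneg, hdec, hbr, hstep, ?_⟩
  have anti : ∀ {p q : ℤ}, p ≤ q → F q ≤ F p := by
    intro p q h
    induction q, h using Int.leInduction with
    | base => exact le_rfl
    | succ n _ ih => exact (hdec n).trans ih
  let s : ℕ →o (Submodule ℝ g)ᵒᵈ := ⟨fun n => OrderDual.toDual (F n), fun a b hab => by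
    exact anti (by exact_mod_cast hab)⟩
  obtain ⟨n, hn⟩ := IsArtinian.monotone_stabilizes s
  refine ⟨n, ?_⟩
  rw [eq_bot_iff, ← hint]
  refine le_iInf fun p => ?_
  have h1 : F n = F ((max n p.toNat : ℕ) : ℤ) := hn (max n p.toNat) (le_max_left _ _)
  rw [h1]
  apply anti
  have := Int.self_le_toNat p
  have h2 : p.toNat ≤ max n p.toNat := le_max_right _ _
  omega

theorem frame_init (h1 : Module.finrank ℝ (g ⧸ F (-1)) = 1)
    (hgen : bracketSpan (F (-1)) (F (-1)) ⊔ F (-1) = ⊤) :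
    ∃ u ∈ F (-1), ∃ w ∈ F (-1), ⁅u, w⁆ ∉ F (-1) := by
  by_contra hcon
  push Not at hcon
  have hle : bracketSpan (F (-1)) (F (-1)) ≤ F (-1) := by
    unfold bracketSpan
    rw [Submodule.span_le]
    rintro z ⟨u, hu, w, hw, rfl⟩
    exact hcon u hu w hw
  rw [sup_eq_right.mpr hle] at hgen
  rw [hgen] at h1
  have : Module.finrank ℝ (g ⧸ (⊤ : Submodule ℝ g)) = 0 := Module.finrank_zero_of_subsingleton
  omega

end

section

set_option linter.unusedSimpArgs false

variable {g : Type} [LieRing g] [LieAlgebra ℝ g] {F : ℤ → Submodule ℝ g} {wx wz : g}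
  {lam : g →ₗ[ℝ] ℝ} {G : ℤ → Submodule ℝ g}

/-- a splitting of the filtration -/
structure Gr (F G : ℤ → Submodule ℝ g) (wx wz : g) : Prop where
  le : ∀ p, G p ≤ F p
  cov : ∀ p, -2 ≤ p → F p ≤ G p ⊔ F (p + 1)
  br : ∀ p q : ℤ, ∀ u ∈ G p, ∀ v ∈ G q, ⁅u, v⁆ ∈ G (p + q)
  neg : ∀ p, p < -2 → G p = ⊥
  mx : wx ∈ G (-1)
  mz : wz ∈ G (-1)

/-- polynomials with prescribed weights -/
def LS (S : ℤ → Prop) : Submodule ℝ PL where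
  carrier := {f | ∀ m, coeff m f ≠ 0 → S (wt m - 2)}
  add_mem' := fun {f f'} hf hf' m hm => by
    by_cases h : coeff m f = 0
    · apply hf' m; rw [coeff_add, h, zero_add] at hm; exact hm
    · exact hf m h
  zero_mem' := fun m hm => by simp at hm
  smul_mem' := fun c f hf m hm => hf m (by
    rw [coeff_smul] at hm; intro h; rw [h] at hm; simp at hm)

theorem Lg_sup {S : ℤ → Prop} {h : ℤ → Submodule ℝ PL} (hle : ∀ p, h p ≤ Lgrade p) :
    (⨆ q : ℤ, ⨆ _ : S q, h q) ≤ LS S := by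
  refine iSup_le fun q => iSup_le fun hq => ?_
  intro f hf m hm
  have := mem_Lgrade.mp (hle _ hf) m hm
  rw [this]; simpa using hq

theorem Lg_sep {S : ℤ → Prop} {h : ℤ → Submodule ℝ PL} (hle : ∀ p, h p ≤ Lgrade p) {p : ℤ}
    (hp : ¬ S p) {f : PL} (hf : f ∈ Lgrade p) (hf' : f ∈ ⨆ q : ℤ, ⨆ _ : S q, h q) : f = 0 := by
  ext m
  rw [coeff_zero]
  by_contra hm
  have h1 := mem_Lgrade.mp hf m hm
  have h2 := Lg_sup hle hf' m hm
  rw [h1] at h2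
  apply hp; simpa using h2

theorem Lg_proj {h : ℤ → Submodule ℝ PL} (hle : ∀ p, h p ≤ Lgrade p) (p : ℤ) :
    (⨆ q, h q) ⊓ Lgrade p = h p := by
  apply le_antisymm
  · rintro f ⟨h1, h2⟩
    have hsup : (⨆ q, h q) ≤ h p ⊔ ⨆ q : ℤ, ⨆ _ : q ≠ p, h q := by
      refine iSup_le fun q => ?_
      by_cases hq : q = p
      · rw [hq]; exact le_sup_left
      · exact le_sup_of_le_right (le_iSup₂_of_le q hq le_rfl)
    obtain ⟨a, ha, b, hb, rfl⟩ := Submodule.mem_sup.mp (hsup h1)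
    have hb' : b ∈ Lgrade p := by
      have := Submodule.sub_mem _ h2 (hle p ha)
      simpa using this
    rw [Lg_sep (S := fun q => q ≠ p) hle (by simp) hb' hb, add_zero]
    exact ha
  · exact le_inf (le_iSup h p) (hle p)

theorem Gr.degE (K : Gr F G wx wz) (m : Fin 3 →₀ ℕ) : Deg G (- wt m) (expo wx wz m) := by
  have hA : Deg G (-1) (opA wx) := fun p u hu => by
    have := K.br _ _ _ K.mx _ hu
    rw [add_comm] at this; exact this
  have hB : Deg G (-1) (opB wz) := fun p u hu => by
    have := Submodule.neg_mem _ (K.br _ _ _ K.mz _ hu)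
    rw [add_comm] at this; exact this
  have hT : Deg G (-2) (opT wx wz) := fun p u hu => by
    have h1 := K.br _ _ _ K.mx _ K.mz
    have := K.br _ _ _ h1 _ hu
    rw [add_comm] at this; exact this
  exact (((hA.pow (m 2)).mul (hT.pow (m 1))).mul (hB.pow (m 0))).cast (by simp only [wt]; ring)

theorem Gr.sg_other (H : CLA F) (f : Frame F wx wz lam) (K : Gr F G wx wz) {p q : ℤ} (hpq : p ≠ q)
    {u : g} (hu : u ∈ G p) : sg wx wz lam q u = 0 := by
  ext m
  rw [coeff_sg, coeff_zero]
  split_ifs with hm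
  · have h1 := K.degE m p u hu
    rcases lt_or_ge (p + - wt m) (-2) with h | h
    · rw [K.neg _ h, Submodule.mem_bot] at h1
      rw [h1]; simp
    · have h2 := H.anti (p := -1) (by omega) (K.le _ h1)
      rw [(f.ker _).mpr h2, mul_zero]
  · rfl

/-- sum of symbols -/
def phi (wx wz : g) (lam : g →ₗ[ℝ] ℝ) (n : ℤ) : g →ₗ[ℝ] PL :=
  ∑ q ∈ Finset.Icc (-2) n, sg wx wz lam q

theorem Gr.phi_eq (H : CLA F) (f : Frame F wx wz lam) (K : Gr F G wx wz) {n : ℤ} (hn : F n = ⊥)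
    {p : ℤ} {u : g} (hu : u ∈ G p) : phi wx wz lam n u = sg wx wz lam p u := by
  rw [phi, LinearMap.sum_apply]
  by_cases hp : p ∈ Finset.Icc (-2) n
  · rw [Finset.sum_eq_single p]
    · intro q _ hq; exact K.sg_other H f (Ne.symm hq) hu
    · intro h; exact absurd hp h
  · have h0 : u = 0 := by
      rw [Finset.mem_Icc, not_and_or] at hp
      rcases hp with hp | hp
      · rw [K.neg p (by omega), Submodule.mem_bot] at hu; exact hu
      · have := H.anti (p := n) (by omega) (K.le _ hu)
        rwa [hn, Submodule.mem_bot] at this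
    simp [h0]

theorem Gr.F_eq (H : CLA F) (K : Gr F G wx wz) (p : ℤ) : F p = ⨆ q : ℤ, ⨆ _ : p ≤ q, G q := by
  obtain ⟨n, hn⟩ := H.bot
  have key : ∀ k : ℕ, ∀ p : ℤ, -2 ≤ p → n ≤ p + k → F p ≤ ⨆ q : ℤ, ⨆ _ : p ≤ q, G q := by
    intro k
    induction k with
    | zero =>
      intro p _ hp
      have : F p ≤ F n := H.anti (by simpa using hp)
      rw [hn] at this
      exact this.trans bot_le
    | succ k ih =>
      intro p hp hk
      refine (K.cov p hp).trans (sup_le (le_iSup₂_of_le p le_rfl le_rfl) ?_)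
      refine (ih (p + 1) (by omega) (by push_cast at hk; omega)).trans ?_
      exact iSup₂_le fun q hq => le_iSup₂_of_le q (by omega) le_rfl
  apply le_antisymm
  · rcases lt_or_ge p (-2) with hp | hp
    · rw [H.neg p hp.le, ← H.neg (-2) le_rfl]
      refine (key (n + 2).toNat (-2) le_rfl (by have := Int.self_le_toNat (n + 2); omega)).trans ?_
      exact iSup₂_le fun q hq => le_iSup₂_of_le q (by omega) le_rfl
    · exact key (n - p).toNat p hp (by have := Int.self_le_toNat (n - p); omega)
  · exact iSup₂_le fun q hq => (K.le q).trans (H.anti hq)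

theorem Gr.map_G (H : CLA F) (f : Frame F wx wz lam) (K : Gr F G wx wz) {n : ℤ} (hn : F n = ⊥)
    (p : ℤ) : Submodule.map (phi wx wz lam n) (G p) = hh F wx wz lam p := by
  apply le_antisymm
  · rintro _ ⟨u, hu, rfl⟩
    rw [K.phi_eq H f hn hu]
    exact ⟨u, K.le _ hu, rfl⟩
  · rcases lt_or_ge p (-2) with hp | hp
    · rw [hh_neg hp]; exact bot_le
    rintro _ ⟨u, hu, rfl⟩
    obtain ⟨a, ha, b, hb, rfl⟩ := Submodule.mem_sup.mp (K.cov p hp hu)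
    refine ⟨a, ha, ?_⟩
    rw [K.phi_eq H f hn ha, map_add, f.sg_kill H hb, add_zero]

theorem Gr.map_F (H : CLA F) (f : Frame F wx wz lam) (K : Gr F G wx wz) {n : ℤ} (hn : F n = ⊥)
    (p : ℤ) : Submodule.map (phi wx wz lam n) (F p) = ⨆ q : ℤ, ⨆ _ : p ≤ q, hh F wx wz lam q := by
  rw [K.F_eq H p, Submodule.map_iSup]
  simp_rw [Submodule.map_iSup, K.map_G H f hn]

theorem Gr.phi_inj (H : CLA F) (f : Frame F wx wz lam) (K : Gr F G wx wz) {n : ℤ} (hn : F n = ⊥) :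
    Function.Injective (phi wx wz lam n) := by
  rw [← LinearMap.ker_eq_bot, eq_bot_iff]
  intro u hu
  rw [LinearMap.mem_ker] at hu
  have key : ∀ p : ℤ, -2 ≤ p → u ∈ F p := by
    intro p hp
    induction p, hp using Int.leInduction with
    | base => exact H.top_mem le_rfl u
    | succ p hp ih =>
      obtain ⟨a, ha, b, hb, rfl⟩ := Submodule.mem_sup.mp (K.cov p hp ih)
      rw [map_add, K.phi_eq H f hn ha] at hu
      have hb' : phi wx wz lam n b ∈ ⨆ q : ℤ, ⨆ _ : p + 1 ≤ q, hh F wx wz lam q := by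
        rw [← K.map_F H f hn]; exact ⟨b, hb, rfl⟩
      have ha' : sg wx wz lam p a ∈ ⨆ q : ℤ, ⨆ _ : p + 1 ≤ q, hh F wx wz lam q := by
        rw [eq_neg_of_add_eq_zero_left hu]; exact Submodule.neg_mem _ hb'
      have h0 := Lg_sep (S := fun q => p + 1 ≤ q) (hh_le (F := F)) (by simp) (sg_mem _ _ _ _ _) ha'
      exact Submodule.add_mem _ (f.sg_ker H hp (K.le _ ha) h0) hb
  have := H.anti (le_max_left n (-2)) (key (max n (-2)) (le_max_right _ _))
  rwa [hn] at this

theorem Gr.phi_lie (H : CLA F) (f : Frame F wx wz lam) (K : Gr F G wx wz) {n : ℤ} (hn : F n = ⊥)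
    (u v : g) : phi wx wz lam n ⁅u, v⁆ = lagr (phi wx wz lam n u) (phi wx wz lam n v) := by
  have htop : ∀ u : g, u ∈ ⨆ q : ℤ, G q := by
    intro u
    have h1 : u ∈ F (-2) := H.top_mem le_rfl u
    rw [K.F_eq H] at h1
    exact (iSup₂_le fun q _ => le_iSup G q : (⨆ q : ℤ, ⨆ _ : -2 ≤ q, G q) ≤ ⨆ q : ℤ, G q) h1
  refine Submodule.iSup_induction (p := G)
    (motive := fun u => phi wx wz lam n ⁅u, v⁆ = lagr (phi wx wz lam n u) (phi wx wz lam n v))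
    (htop u) ?_ ?_ ?_
  · intro p u hu
    refine Submodule.iSup_induction (p := G)
      (motive := fun v => phi wx wz lam n ⁅u, v⁆ = lagr (phi wx wz lam n u) (phi wx wz lam n v))
      (htop v) ?_ ?_ ?_
    · intro q v hv
      rw [K.phi_eq H f hn hu, K.phi_eq H f hn hv, K.phi_eq H f hn (K.br _ _ _ hu _ hv)]
      rcases lt_or_ge p (-2) with hp | hp
      · rw [K.neg p hp, Submodule.mem_bot] at hu
        rw [hu, zero_lie, map_zero, map_zero, lagr_zero_left]
      rcases lt_or_ge q (-2) with hq | hq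
      · rw [K.neg q hq, Submodule.mem_bot] at hv
        rw [hv, lie_zero, map_zero, map_zero, lagr_zero_right]
      exact f.sg_lie H hp hq (K.le _ hu) (K.le _ hv)
    · rw [lie_zero, map_zero, lagr_zero_right]
    · intro a b ha hb
      rw [lie_add, map_add, ha, hb, map_add, lagr_add_right]
  · rw [zero_lie, map_zero, lagr_zero_left]
  · intro a b ha hb
    rw [add_lie, map_add, ha, hb, map_add, lagr_add_left]

theorem grading_iso (H : CLA F) (f : Frame F wx wz lam) (K : Gr F G wx wz) (i : Fin 5 ⊕ ℝ)
    (hT : Tgt i = ⨆ q, hh F wx wz lam q) : Iso16 g F (Sum.inl i) := by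
  obtain ⟨n, hn⟩ := H.bot
  refine ⟨phi wx wz lam n, K.phi_inj H f hn, ?_, K.phi_lie H f hn, ?_⟩
  · rw [LinearMap.range_eq_map, ← H.neg (-2) le_rfl, K.map_F H f hn, hT]
    apply le_antisymm
    · exact iSup₂_le fun q _ => le_iSup (hh F wx wz lam) q
    · refine iSup_le fun q => ?_
      rcases lt_or_ge q (-2) with hq | hq
      · rw [hh_neg hq]; exact bot_le
      · exact le_iSup₂_of_le q hq le_rfl
  · intro p
    rw [K.map_F H f hn, hT]
    simp_rw [Lg_proj (hh_le (F := F) (wx := wx) (wz := wz) (lam := lam))]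

end

section

set_option linter.unusedSimpArgs false

variable {g : Type} [LieRing g] [LieAlgebra ℝ g] {F : ℤ → Submodule ℝ g} {wx wz : g}
  {lam : g →ₗ[ℝ] ℝ} {G : ℤ → Submodule ℝ g}

/-! ### Changing the frame by elements of `F 0` -/

theorem Frame.shift (H : CLA F) (f : Frame F wx wz lam) {vx vz : g} (hx : vx - wx ∈ F 0)
    (hz : vz - wz ∈ F 0) : Frame F vx vz lam := by
  have h0 : F 0 ≤ F (-1) := H.anti (by norm_num)
  have mx : vx ∈ F (-1) := by
    have := Submodule.add_mem _ (h0 hx) f.mx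
    simpa using this
  have mz : vz ∈ F (-1) := by
    have := Submodule.add_mem _ (h0 hz) f.mz
    simpa using this
  refine ⟨mx, mz, f.ker, ?_, ?_⟩
  · have h1 : ⁅vx - wx, vz⁆ ∈ F (-1) := H.br' hx mz (by norm_num)
    have h2 : ⁅wx, vz - wz⁆ ∈ F (-1) := H.br' f.mx hz (by norm_num)
    rw [← f.ker] at h1 h2
    rw [sub_lie, map_sub] at h1
    rw [lie_sub, map_sub, f.nrm] at h2
    linarith
  · intro y hy
    obtain ⟨a, b, hab⟩ := f.spn y hy
    refine ⟨a, b, ?_⟩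
    have := Submodule.sub_mem _ (Submodule.sub_mem _ hab (Submodule.smul_mem _ a hx))
      (Submodule.smul_mem _ b hz)
    convert this using 1
    module

theorem Frame.shift_sg (H : CLA F) (f : Frame F wx wz lam) {vx vz : g} (hx : vx - wx ∈ F 0)
    (hz : vz - wz ∈ F 0) {e : g} (he : e ∈ F 0) : sg vx vz lam 0 e = sg wx wz lam 0 e := by
  obtain ⟨a, b, c, d, h⟩ := L_0 (sg_mem wx wz lam 0 e)
  obtain ⟨i1, i2⟩ := f.act1 H he h
  have j1 : ⁅e, vx - wx⁆ ∈ F 0 := H.br' he hx (by norm_num)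
  have j2 : ⁅e, vz - wz⁆ ∈ F 0 := H.br' he hz (by norm_num)
  rw [lie_sub] at j1 j2
  rw [h]
  apply (f.shift H hx hz).act2 H he
  · have := Submodule.add_mem _ (Submodule.add_mem _ (Submodule.add_mem _ i1 j1)
      (Submodule.smul_mem _ (b + d) hx)) (Submodule.smul_mem _ (2 * c) hz)
    convert this using 1
    module
  · have := Submodule.sub_mem _ (Submodule.sub_mem _ (Submodule.add_mem _ i2 j2)
      (Submodule.smul_mem _ (2 * a) hx)) (Submodule.smul_mem _ (b - d) hz)
    convert this using 1
    module

theorem Frame.shift_hh (H : CLA F) (f : Frame F wx wz lam) {vx vz : g} (hx : vx - wx ∈ F 0)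
    (hz : vz - wz ∈ F 0) : hh F vx vz lam 0 = hh F wx wz lam 0 := by
  ext y
  constructor
  · rintro ⟨u, hu, rfl⟩; exact ⟨u, hu, (f.shift_sg H hx hz hu).symm⟩
  · rintro ⟨u, hu, rfl⟩; exact ⟨u, hu, (f.shift_sg H hx hz hu)⟩

/-! ### Grading by a grading element -/

theorem Frame.E_act (H : CLA F) (f : Frame F wx wz lam) {E : g} (hE : E ∈ F 0)
    (hs : sg wx wz lam 0 E = TT) {p : ℤ} (hp : -2 ≤ p) {u : g} (hu : u ∈ F p) :
    ⁅E, u⁆ - (p : ℝ) • u ∈ F (p + 1) := by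
  apply f.sg_ker H hp (Submodule.sub_mem _ (H.br' hE hu (by simp)) (Submodule.smul_mem _ _ hu))
  have := f.sg_lie H (p := 0) (by norm_num) hp hE hu
  rw [zero_add, hs, TT_act (sg_mem _ _ _ _ _)] at this
  rw [map_sub, this, map_smul, sub_self]

theorem Frame.E_eig (H : CLA F) (f : Frame F wx wz lam) {E : g} (hE : E ∈ F 0)
    (hs : sg wx wz lam 0 E = TT) {p q : ℤ} (hq : -2 ≤ q) (hpq : p ≠ q) {u : g} (hu : u ∈ F q)
    (he : ⁅E, u⁆ = (p : ℝ) • u) : u ∈ F (q + 1) := by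
  have h1 := f.E_act H hE hs hq hu
  rw [he, ← sub_smul] at h1
  have hne : (p : ℝ) - q ≠ 0 := by rw [sub_ne_zero]; exact_mod_cast hpq
  have := Submodule.smul_mem _ ((p : ℝ) - q)⁻¹ h1
  rwa [smul_smul, inv_mul_cancel₀ hne, one_smul] at this

/-- the eigenspaces of the grading element -/
def GE (F : ℤ → Submodule ℝ g) (E : g) (p : ℤ) : Submodule ℝ g where
  carrier := {u | u ∈ F p ∧ ⁅E, u⁆ = (p : ℝ) • u}
  add_mem' := fun {a b} ha hb => ⟨Submodule.add_mem _ ha.1 hb.1, by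
    rw [lie_add, ha.2, hb.2, smul_add]⟩
  zero_mem' := ⟨Submodule.zero_mem _, by simp⟩
  smul_mem' := fun c a ha => ⟨Submodule.smul_mem _ _ ha.1, by
    rw [lie_smul, ha.2, smul_comm]⟩

theorem Frame.GE_cov (H : CLA F) (f : Frame F wx wz lam) {E : g} (hE : E ∈ F 0)
    (hs : sg wx wz lam 0 E = TT) {p : ℤ} (hp : -2 ≤ p) : F p ≤ GE F E p ⊔ F (p + 1) := by
  intro u hu
  have key : ∀ q : ℤ, p + 1 ≤ q → ∃ a ∈ F p, u - a ∈ F (p + 1) ∧ ⁅E, a⁆ - (p : ℝ) • a ∈ F q := by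
    intro q hq
    induction q, hq using Int.leInduction with
    | base => exact ⟨u, hu, by simp, f.E_act H hE hs hp hu⟩
    | succ q hq ih =>
      obtain ⟨a, ha, hua, hr⟩ := ih
      have hne : (q : ℝ) - p ≠ 0 := by rw [sub_ne_zero]; exact_mod_cast (by omega)
      have h1 := f.E_act H hE hs (by omega : -2 ≤ q) hr
      generalize hr' : ⁅E, a⁆ - (p : ℝ) • a = r at hr h1
      refine ⟨a - ((q : ℝ) - p)⁻¹ • r, ?_, ?_, ?_⟩
      · exact Submodule.sub_mem _ ha (Submodule.smul_mem _ _ (H.anti (by omega) hr))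
      · have := Submodule.add_mem _ hua (Submodule.smul_mem _ ((q : ℝ) - p)⁻¹ (H.anti hq hr))
        convert this using 1; abel
      · have := Submodule.smul_mem _ (-((q : ℝ) - p)⁻¹) h1
        convert this using 1
        rw [lie_sub, lie_smul]
        have e1 : ⁅E, a⁆ = r + (p : ℝ) • a := by rw [← hr']; abel
        rw [e1]
        have e2 : r = (((q : ℝ) - p)⁻¹ * ((q : ℝ) - p)) • r := by
          rw [inv_mul_cancel₀ hne, one_smul]
        conv_lhs => rw [e2]
        rw [← e2]
        have e3 : r = (((q : ℝ) - p)⁻¹ * (q - p)) • r := e2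
        calc _ = r - ((q : ℝ) - p)⁻¹ • (⁅E, r⁆ - (p : ℝ) • r) := by module
          _ = (((q : ℝ) - p)⁻¹ * (q - p)) • r - ((q : ℝ) - p)⁻¹ • (⁅E, r⁆ - (p : ℝ) • r) := by rw [← e3]
          _ = _ := by module
  obtain ⟨n, hn⟩ := H.bot
  obtain ⟨a, ha, hua, hr⟩ := key (max n (p + 1)) (le_max_right _ _)
  have hr0 := H.anti (le_max_left n (p + 1)) hr
  rw [hn, Submodule.mem_bot, sub_eq_zero] at hr0
  exact Submodule.mem_sup.mpr ⟨a, ⟨ha, hr0⟩, u - a, hua, by abel⟩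

theorem Frame.gradE (H : CLA F) (f : Frame F wx wz lam) (hT : TT ∈ hh F wx wz lam 0) :
    ∃ vx vz G, Frame F vx vz lam ∧ Gr F G vx vz ∧ hh F vx vz lam 0 = hh F wx wz lam 0 := by
  obtain ⟨E, hE, hs⟩ := hT
  have hcx := f.GE_cov H hE hs (p := -1) (by norm_num) f.mx
  have hcz := f.GE_cov H hE hs (p := -1) (by norm_num) f.mz
  obtain ⟨vx, hvx, rx, hrx, ex⟩ := Submodule.mem_sup.mp hcx
  obtain ⟨vz, hvz, rz, hrz, ez⟩ := Submodule.mem_sup.mp hcz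
  have hx : vx - wx ∈ F 0 := by
    rw [← ex]; simpa using hrx
  have hz : vz - wz ∈ F 0 := by
    rw [← ez]; simpa using hrz
  refine ⟨vx, vz, GE F E, f.shift H hx hz, ?_, f.shift_hh H hx hz⟩
  have hbrE : ∀ p q : ℤ, ∀ u ∈ GE F E p, ∀ v ∈ GE F E q, ⁅u, v⁆ ∈ GE F E (p + q) := by
    intro p q u hu v hv
    refine ⟨H.br _ _ _ hu.1 _ hv.1, ?_⟩
    rw [leibniz_lie, hu.2, hv.2, smul_lie, lie_smul, ← add_smul]
    push_cast; rfl
  refine ⟨fun p u hu => hu.1, fun p hp => f.GE_cov H hE hs hp, hbrE, ?_, hvx, hvz⟩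
  intro p hp
  rw [eq_bot_iff]
  intro u hu
  have key : ∀ q : ℤ, -2 ≤ q → u ∈ F q := by
    intro q hq
    induction q, hq using Int.leInduction with
    | base => exact H.top_mem le_rfl u
    | succ q hq ih => exact f.E_eig H hE hs hq (by omega) ih hu.2
  obtain ⟨n, hn⟩ := H.bot
  have := H.anti (le_max_left n (-2)) (key (max n (-2)) (le_max_right _ _))
  rwa [hn] at this

/-! ### Gradings of depth two without positive part -/

/-- the explicit grading -/
def G3 (F : ℤ → Submodule ℝ g) (v1 v2 : g) (p : ℤ) : Submodule ℝ g :=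
  if p = -2 then Submodule.span ℝ {⁅v1, v2⁆} else if p = -1 then Submodule.span ℝ {v1, v2} else
    if p = 0 then F 0 else ⊥

theorem gr3 (H : CLA F) {v1 v2 : g} (f : Frame F v1 v2 lam) (h1 : F 1 = ⊥)
    (ha : ∀ u ∈ F 0, ⁅u, v1⁆ ∈ Submodule.span ℝ {v1, v2})
    (hb : ∀ u ∈ F 0, ⁅u, v2⁆ ∈ Submodule.span ℝ {v1, v2})
    (ht1 : ⁅⁅v1, v2⁆, v1⁆ = 0) (ht2 : ⁅⁅v1, v2⁆, v2⁆ = 0) : Gr F (G3 F v1 v2) v1 v2 := by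
  have g2 : G3 F v1 v2 (-2) = Submodule.span ℝ {⁅v1, v2⁆} := by simp [G3]
  have g1 : G3 F v1 v2 (-1) = Submodule.span ℝ {v1, v2} := by simp [G3]
  have g0 : G3 F v1 v2 0 = F 0 := by simp [G3]
  have gn : ∀ p : ℤ, p ≠ -2 → p ≠ -1 → p ≠ 0 → G3 F v1 v2 p = ⊥ := by
    intro p h h' h''; simp [G3, h, h', h'']
  have hpos : ∀ p : ℤ, 1 ≤ p → F p = ⊥ := fun p hp => by
    rw [eq_bot_iff, ← h1]; exact H.anti hp
  -- brackets
  have b01 : ∀ u ∈ F 0, ∀ v ∈ Submodule.span ℝ {v1, v2}, ⁅u, v⁆ ∈ Submodule.span ℝ {v1, v2} := by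
    intro u hu v hv
    obtain ⟨a, b, rfl⟩ := Submodule.mem_span_pair.mp hv
    rw [lie_add, lie_smul, lie_smul]
    exact Submodule.add_mem _ (Submodule.smul_mem _ _ (ha u hu)) (Submodule.smul_mem _ _ (hb u hu))
  have b11 : ∀ u ∈ Submodule.span ℝ {v1, v2}, ∀ v ∈ Submodule.span ℝ {v1, v2},
      ⁅u, v⁆ ∈ Submodule.span ℝ {⁅v1, v2⁆} := by
    intro u hu v hv
    obtain ⟨a, b, rfl⟩ := Submodule.mem_span_pair.mp hv
    obtain ⟨c, d, rfl⟩ := Submodule.mem_span_pair.mp hu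
    rw [Submodule.mem_span_singleton]
    refine ⟨c * b - d * a, ?_⟩
    simp only [lie_add, add_lie, lie_smul, smul_lie, lie_self]
    rw [← lie_skew v1 v2]; module
  have b02 : ∀ u ∈ F 0, ∀ v ∈ Submodule.span ℝ {⁅v1, v2⁆}, ⁅u, v⁆ ∈ Submodule.span ℝ {⁅v1, v2⁆} := by
    intro u hu v hv
    obtain ⟨a, rfl⟩ := Submodule.mem_span_singleton.mp hv
    rw [lie_smul, leibniz_lie]
    refine Submodule.smul_mem _ _ (Submodule.add_mem _ ?_ ?_)
    · exact b11 _ (ha u hu) _ (Submodule.subset_span (by simp))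
    · exact b11 _ (Submodule.subset_span (by simp)) _ (hb u hu)
  have b21 : ∀ u ∈ Submodule.span ℝ {⁅v1, v2⁆}, ∀ v ∈ Submodule.span ℝ {v1, v2}, ⁅u, v⁆ = 0 := by
    intro u hu v hv
    obtain ⟨a, b, rfl⟩ := Submodule.mem_span_pair.mp hv
    obtain ⟨c, rfl⟩ := Submodule.mem_span_singleton.mp hu
    simp only [lie_add, lie_smul, smul_lie, ht1, ht2, smul_zero, add_zero]
  have b22 : ∀ u ∈ Submodule.span ℝ {⁅v1, v2⁆}, ∀ v ∈ Submodule.span ℝ {⁅v1, v2⁆}, ⁅u, v⁆ = 0 := by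
    intro u hu v hv
    obtain ⟨a, rfl⟩ := Submodule.mem_span_singleton.mp hv
    obtain ⟨c, rfl⟩ := Submodule.mem_span_singleton.mp hu
    simp only [lie_smul, smul_lie, lie_self, smul_zero]
  have sw : ∀ {V : Submodule ℝ g} {u v : g}, ⁅v, u⁆ ∈ V → ⁅u, v⁆ ∈ V := by
    intro V u v h
    rw [← lie_skew]; exact Submodule.neg_mem _ h
  refine ⟨?_, ?_, ?_, ?_, ?_, ?_⟩
  · intro p
    by_cases h2 : p = -2
    · subst h2; rw [H.neg (-2) le_rfl]; exact le_top
    by_cases h1 : p = -1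
    · subst h1; rw [g1, Submodule.span_le]
      rintro u (rfl | rfl)
      exacts [f.mx, f.mz]
    by_cases h0 : p = 0
    · subst h0; rw [g0]
    rw [gn p h2 h1 h0]; exact bot_le
  · intro p hp
    by_cases h2 : p = -2
    · subst h2; rw [g2]
      intro u _
      refine Submodule.mem_sup.mpr ⟨lam u • ⁅v1, v2⁆, Submodule.smul_mem _ _
        (Submodule.mem_span_singleton_self _), u - lam u • ⁅v1, v2⁆, ?_, by abel⟩
      have : u - lam u • ⁅v1, v2⁆ ∈ F (-1) := by
        rw [← f.ker, map_sub, map_smul, f.nrm]; simp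
      simpa using this
    by_cases h1 : p = -1
    · subst h1; rw [g1]
      intro u hu
      obtain ⟨a, b, hab⟩ := f.spn u hu
      exact Submodule.mem_sup.mpr ⟨a • v1 + b • v2, Submodule.mem_span_pair.mpr ⟨a, b, rfl⟩,
        u - a • v1 - b • v2, by simpa using hab, by abel⟩
    by_cases h0 : p = 0
    · subst h0; rw [g0]; exact le_sup_left
    rw [hpos p (by omega)]; exact bot_le
  · intro p q u hu v hv
    by_cases hp2 : p = -2
    · subst hp2
      rw [g2] at hu
      by_cases hq2 : q = -2
      · subst hq2; rw [g2] at hv; rw [b22 u hu v hv]; exact Submodule.zero_mem _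
      by_cases hq1 : q = -1
      · subst hq1; rw [g1] at hv; rw [b21 u hu v hv]; exact Submodule.zero_mem _
      by_cases hq0 : q = 0
      · subst hq0; rw [g0] at hv; rw [add_zero, g2]; exact sw (b02 v hv u hu)
      rw [gn q hq2 hq1 hq0, Submodule.mem_bot] at hv
      rw [hv, lie_zero]; exact Submodule.zero_mem _
    by_cases hp1 : p = -1
    · subst hp1
      rw [g1] at hu
      by_cases hq2 : q = -2
      · subst hq2; rw [g2] at hv; apply sw; rw [b21 v hv u hu]; exact Submodule.zero_mem _
      by_cases hq1 : q = -1
      · subst hq1; rw [g1] at hv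
        rw [show (-1 : ℤ) + -1 = -2 by norm_num, g2]; exact b11 u hu v hv
      by_cases hq0 : q = 0
      · subst hq0; rw [g0] at hv; rw [add_zero, g1]; exact sw (b01 v hv u hu)
      rw [gn q hq2 hq1 hq0, Submodule.mem_bot] at hv
      rw [hv, lie_zero]; exact Submodule.zero_mem _
    by_cases hp0 : p = 0
    · subst hp0
      rw [g0] at hu
      rw [zero_add]
      by_cases hq2 : q = -2
      · subst hq2; rw [g2] at hv ⊢; exact b02 u hu v hv
      by_cases hq1 : q = -1
      · subst hq1; rw [g1] at hv ⊢; exact b01 u hu v hv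
      by_cases hq0 : q = 0
      · subst hq0; rw [g0] at hv ⊢; exact H.br' hu hv (by norm_num)
      rw [gn q hq2 hq1 hq0, Submodule.mem_bot] at hv
      rw [hv, lie_zero]; exact Submodule.zero_mem _
    rw [gn p hp2 hp1 hp0, Submodule.mem_bot] at hu
    rw [hu, zero_lie]; exact Submodule.zero_mem _
  · intro p hp; exact gn p (by omega) (by omega) (by omega)
  · rw [g1]; exact Submodule.subset_span (by simp)
  · rw [g1]; exact Submodule.subset_span (by simp)

end

section

set_option linter.unusedSimpArgs false

variable {g : Type} [LieRing g] [LieAlgebra ℝ g] {F : ℤ → Submodule ℝ g} {wx wz : g}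
  {lam : g →ₗ[ℝ] ℝ}

theorem Frame.sg0_inj (H : CLA F) (f : Frame F wx wz lam) (h1 : F 1 = ⊥) {u v : g}
    (hu : u ∈ F 0) (hv : v ∈ F 0) (h : sg wx wz lam 0 u = sg wx wz lam 0 v) : u = v := by
  have := f.sg_ker H (p := 0) (by norm_num) (Submodule.sub_mem _ hu hv) (by
    rw [map_sub, h, sub_self])
  rw [zero_add, h1, Submodule.mem_bot] at this
  exact sub_eq_zero.mp this

theorem Frame.sup5 (H : CLA F) (f : Frame F wx wz lam) (h3 : hh F wx wz lam 3 = ⊥) :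
    ⨆ q, hh F wx wz lam q = Submodule.span ℝ {1, X 0, X 2} ⊔ hh F wx wz lam 0 ⊔
      hh F wx wz lam 1 ⊔ hh F wx wz lam 2 := by
  apply le_antisymm
  · apply iSup_le
    intro q
    by_cases h : q < -2
    · rw [hh_neg h]; exact bot_le
    by_cases h' : 3 ≤ q
    · rw [f.hh_prop H (by norm_num) h3 h']; exact bot_le
    have : q = -2 ∨ q = -1 ∨ q = 0 ∨ q = 1 ∨ q = 2 := by omega
    rcases this with rfl | rfl | rfl | rfl | rfl
    · rw [f.hh_m2 H]
      refine le_trans (Submodule.span_mono (by simp)) (le_sup_left.trans (le_sup_left.trans le_sup_left))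
    · rw [f.hh_m1 H]
      refine le_trans (Submodule.span_mono (by simp)) (le_sup_left.trans (le_sup_left.trans le_sup_left))
    · exact le_sup_right.trans (le_sup_left.trans le_sup_left)
    · exact le_sup_right.trans le_sup_left
    · exact le_sup_right
  · refine sup_le (sup_le (sup_le ?_ (le_iSup _ _)) (le_iSup _ _)) (le_iSup _ _)
    rw [Submodule.span_le]
    rintro u (rfl | rfl | rfl)
    · refine le_iSup (hh F wx wz lam) (-2) ?_
      rw [f.hh_m2 H]; exact Submodule.subset_span (by simp)
    · refine le_iSup (hh F wx wz lam) (-1) ?_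
      rw [f.hh_m1 H]; exact Submodule.subset_span (by simp)
    · refine le_iSup (hh F wx wz lam) (-1) ?_
      rw [f.hh_m1 H]; exact Submodule.subset_span (by simp)

theorem Frame.expand (H : CLA F) (f : Frame F wx wz lam) (u : g) :
    ∃ T A B : ℝ, u - T • ⁅wx, wz⁆ - A • wx - B • wz ∈ F 0 := by
  have : u - lam u • ⁅wx, wz⁆ ∈ F (-1) := by
    rw [← f.ker, map_sub, map_smul, f.nrm]; simp
  obtain ⟨a, b, h⟩ := f.spn _ this
  exact ⟨lam u, a, b, h⟩

theorem Frame.indep3 (H : CLA F) (f : Frame F wx wz lam) {T A B : ℝ}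
    (h : T • ⁅wx, wz⁆ + A • wx + B • wz ∈ F 0) : T = 0 ∧ A = 0 ∧ B = 0 := by
  have h' := H.anti (show (-1 : ℤ) ≤ 0 by norm_num) h
  rw [← f.ker, map_add, map_add, map_smul, map_smul, map_smul, f.nrm, (f.ker _).mpr f.mx,
    (f.ker _).mpr f.mz] at h'
  have hT : T = 0 := by simpa using h'
  subst hT
  rw [zero_smul, zero_add] at h
  exact ⟨rfl, f.indep H h⟩

/-- the case `hh 0 = sl(2)` -/
theorem caseB (H : CLA F) (f : Frame F wx wz lam)
    (h0 : hh F wx wz lam 0 = Submodule.span ℝ {X 0 ^ 2, X 0 * X 2, X 2 ^ 2})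
    (h1 : hh F wx wz lam 1 = ⊥) : Iso16 g F (Sum.inl (Sum.inl 2)) := by
  have F1 : F 1 = ⊥ := f.F_bot H (by norm_num) h1
  have me : X 0 ^ 2 ∈ hh F wx wz lam 0 := by rw [h0]; exact Submodule.subset_span (by simp)
  have mk : X 0 * X 2 ∈ hh F wx wz lam 0 := by rw [h0]; exact Submodule.subset_span (by simp)
  have mf : X 2 ^ 2 ∈ hh F wx wz lam 0 := by rw [h0]; exact Submodule.subset_span (by simp)
  obtain ⟨e, he, se⟩ := me
  obtain ⟨k, hk, sk⟩ := mk
  obtain ⟨φ, hf, sf⟩ := mf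
  rw [← q4_1000] at se
  rw [← q4_0100] at sk
  rw [← q4_0010] at sf
  have exp0 : ∀ u ∈ F 0, ∃ E K P : ℝ, u = E • e + K • k + P • φ := by
    intro u hu
    have : sg wx wz lam 0 u ∈ hh F wx wz lam 0 := ⟨u, hu, rfl⟩
    rw [h0, Submodule.mem_span_triple] at this
    obtain ⟨E, K, P, h⟩ := this
    refine ⟨E, K, P, f.sg0_inj H F1 hu ?_ ?_⟩
    · exact Submodule.add_mem _ (Submodule.add_mem _ (Submodule.smul_mem _ _ he)
        (Submodule.smul_mem _ _ hk)) (Submodule.smul_mem _ _ hf)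
    · rw [← h, map_add, map_add, map_smul, map_smul, map_smul, se, sk, sf, q4_1000, q4_0010, q4_0100]
  have ind0 : ∀ E K P : ℝ, E • e + K • k + P • φ = 0 → E = 0 ∧ K = 0 ∧ P = 0 := by
    intro E K P h
    have := congrArg (sg wx wz lam 0) h
    rw [map_add, map_add, map_smul, map_smul, map_smul, se, sk, sf, map_zero] at this
    have h' : q4 E K P 0 = q4 0 0 0 0 := by
      rw [show q4 0 0 0 0 = 0 by simp [q4], ← this]; simp [q4]
    obtain ⟨a, b, c, -⟩ := q4_inj h'
    exact ⟨a, b, c⟩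
  have bke : ⁅k, e⁆ = (-2 : ℝ) • e := by
    refine f.sg0_inj H F1 (H.br' hk he (by norm_num)) (Submodule.smul_mem _ _ he) ?_
    have := f.sg_lie H (p := 0) (q := 0) (by norm_num) (by norm_num) hk he
    rw [add_zero] at this
    rw [this, map_smul, sk, se, br_q4]; simp [q4]
  have bkf : ⁅k, φ⁆ = (2 : ℝ) • φ := by
    refine f.sg0_inj H F1 (H.br' hk hf (by norm_num)) (Submodule.smul_mem _ _ hf) ?_
    have := f.sg_lie H (p := 0) (q := 0) (by norm_num) (by norm_num) hk hf
    rw [add_zero] at this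
    rw [this, map_smul, sk, sf, br_q4]; simp [q4]
  -- correct the frame
  obtain ⟨kx, kz⟩ := f.act1 H hk sk
  obtain ⟨α, β, γ, hkx⟩ := exp0 _ kx
  obtain ⟨α', β', γ', hkz⟩ := exp0 _ kz
  have hkx' : ⁅k, wx⁆ = - wx + α • e + β • k + γ • φ := by
    have : ⁅k, wx⁆ = (⁅k, wx⁆ + ((1:ℝ) + 0) • wx + ((2:ℝ) * 0) • wz) - wx := by module
    rw [this, hkx]; module
  have hkz' : ⁅k, wz⁆ = wz + α' • e + β' • k + γ' • φ := by
    have : ⁅k, wz⁆ = (⁅k, wz⁆ - ((2:ℝ) * 0) • wx - ((1:ℝ) - 0) • wz) + wz := by module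
    rw [this, hkz]; module
  obtain ⟨vx, hvx⟩ : ∃ vx, vx = wx + α • e + (-β) • k + (-γ / 3) • φ := ⟨_, rfl⟩
  obtain ⟨vz, hvz⟩ : ∃ vz, vz = wz + (α' / 3) • e + (β') • k + (-γ') • φ := ⟨_, rfl⟩
  have hx : vx - wx ∈ F 0 := by
    rw [hvx, show wx + α • e + (-β) • k + (-γ / 3) • φ - wx = α • e + (-β) • k + (-γ / 3) • φ by module]
    exact Submodule.add_mem _ (Submodule.add_mem _ (Submodule.smul_mem _ _ he)
        (Submodule.smul_mem _ _ hk)) (Submodule.smul_mem _ _ hf)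
  have hz : vz - wz ∈ F 0 := by
    rw [hvz, show wz + (α' / 3) • e + (β') • k + (-γ') • φ - wz =
      (α' / 3) • e + (β') • k + (-γ') • φ by module]
    exact Submodule.add_mem _ (Submodule.add_mem _ (Submodule.smul_mem _ _ he)
        (Submodule.smul_mem _ _ hk)) (Submodule.smul_mem _ _ hf)
  have bkx : ⁅k, vx⁆ = (-1 : ℝ) • vx := by
    rw [hvx]; simp only [lie_add, lie_smul, lie_self, hkx', bke, bkf]; module
  have bkz : ⁅k, vz⁆ = (1 : ℝ) • vz := by
    rw [hvz]; simp only [lie_add, lie_smul, lie_self, hkz', bke, bkf]; module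
  have f' := f.shift H hx hz
  have h0' := f.shift_hh H hx hz
  have bkt : ⁅k, ⁅vx, vz⁆⁆ = (0 : ℝ) • ⁅vx, vz⁆ := by
    rw [leibniz_lie, bkx, bkz, smul_lie, lie_smul]; module
  have eig : ∀ (u : g) (μ : ℝ), ⁅k, u⁆ = μ • u → ∃ T A B E K P : ℝ,
      u = T • ⁅vx, vz⁆ + A • vx + B • vz + E • e + K • k + P • φ ∧ μ * T = 0 ∧ (μ + 1) * A = 0 ∧
      (μ - 1) * B = 0 ∧ (μ + 2) * E = 0 ∧ μ * K = 0 ∧ (μ - 2) * P = 0 := by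
    intro u μ hu
    obtain ⟨T, A, B, h⟩ := f'.expand H u
    obtain ⟨E, K, P, h'⟩ := exp0 _ h
    have hu' : u = T • ⁅vx, vz⁆ + A • vx + B • vz + E • e + K • k + P • φ := by
      have : u = (u - T • ⁅vx, vz⁆ - A • vx - B • vz) + (T • ⁅vx, vz⁆ + A • vx + B • vz) := by abel
      rw [this, h']; module
    refine ⟨T, A, B, E, K, P, hu', ?_⟩
    have h2 := hu
    rw [hu'] at h2
    simp only [lie_add, lie_smul, lie_self, bkt, bkx, bkz, bke, bkf] at h2
    have h3 : (μ * T) • ⁅vx, vz⁆ + ((μ + 1) * A) • vx + ((μ - 1) * B) • vz =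
        - (((μ + 2) * E) • e + (μ * K) • k + ((μ - 2) * P) • φ) := by
      rw [← sub_eq_zero] at h2 ⊢
      rw [← neg_eq_zero, ← h2]; module
    have m0 : ∀ a b c : ℝ, a • e + b • k + c • φ ∈ F 0 := fun a b c =>
      Submodule.add_mem _ (Submodule.add_mem _ (Submodule.smul_mem _ _ he)
        (Submodule.smul_mem _ _ hk)) (Submodule.smul_mem _ _ hf)
    have h4 := f'.indep3 H (by rw [h3]; exact Submodule.neg_mem _ (m0 _ _ _))
    obtain ⟨i1, i2, i3⟩ := h4
    rw [i1, i2, i3] at h3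
    have h5 := ind0 _ _ _ (neg_eq_zero.mp (by rw [← h3]; simp))
    exact ⟨i1, i2, i3, h5⟩
  have eigb : ∀ (u v : g) (a b : ℝ), ⁅k, u⁆ = a • u → ⁅k, v⁆ = b • v → ⁅k, ⁅u, v⁆⁆ = (a + b) • ⁅u, v⁆ := by
    intro u v a b hu hv
    rw [leibniz_lie, hu, hv, smul_lie, lie_smul]; module
  have ex : ⁅e, vx⁆ = 0 := by
    obtain ⟨T, A, B, E, K, P, hu, h1, h2, h3, h4, h5, h6⟩ := eig _ _ (eigb e vx _ _ bke bkx)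
    norm_num at h1 h2 h3 h4 h5 h6
    rw [hu, h1, h2, h3, h4, h5, h6]; simp
  have fz : ⁅φ, vz⁆ = 0 := by
    obtain ⟨T, A, B, E, K, P, hu, h1, h2, h3, h4, h5, h6⟩ := eig _ _ (eigb φ vz _ _ bkf bkz)
    norm_num at h1 h2 h3 h4 h5 h6
    rw [hu, h1, h2, h3, h4, h5, h6]; simp
  have ez : ∃ A : ℝ, ⁅e, vz⁆ = A • vx := by
    obtain ⟨T, A, B, E, K, P, hu, h1, h2, h3, h4, h5, h6⟩ := eig _ _ (eigb e vz _ _ bke bkz)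
    norm_num at h1 h2 h3 h4 h5 h6
    exact ⟨A, by rw [hu, h1, h3, h4, h5, h6]; simp⟩
  have fx : ∃ B : ℝ, ⁅φ, vx⁆ = B • vz := by
    obtain ⟨T, A, B, E, K, P, hu, h1, h2, h3, h4, h5, h6⟩ := eig _ _ (eigb φ vx _ _ bkf bkx)
    norm_num at h1 h2 h3 h4 h5 h6
    exact ⟨B, by rw [hu, h1, h2, h4, h5, h6]; simp⟩
  have tx : ∃ c : ℝ, ⁅⁅vx, vz⁆, vx⁆ = c • vx := by
    obtain ⟨T, A, B, E, K, P, hu, h1, h2, h3, h4, h5, h6⟩ := eig _ _ (eigb _ vx _ _ bkt bkx)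
    norm_num at h1 h2 h3 h4 h5 h6
    exact ⟨A, by rw [hu, h1, h3, h4, h5, h6]; simp⟩
  have tz : ∃ c : ℝ, ⁅⁅vx, vz⁆, vz⁆ = c • vz := by
    obtain ⟨T, A, B, E, K, P, hu, h1, h2, h3, h4, h5, h6⟩ := eig _ _ (eigb _ vz _ _ bkt bkz)
    norm_num at h1 h2 h3 h4 h5 h6
    exact ⟨B, by rw [hu, h1, h2, h4, h5, h6]; simp⟩
  obtain ⟨A, ez⟩ := ez
  obtain ⟨B, fx⟩ := fx
  obtain ⟨c, tx⟩ := tx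
  obtain ⟨c', tz⟩ := tz
  have sf' : sg vx vz lam 0 φ = q4 0 0 1 0 := by rw [f.shift_sg H hx hz hf, sf]
  have hB : B = -2 := by
    have := (f'.act1 H hf sf').1
    rw [fx, show B • vz + ((0:ℝ) + 0) • vx + ((2:ℝ) * 1) • vz = (0:ℝ) • vx + (B + 2) • vz by module] at this
    linarith [(f'.indep H this).2]
  have ft : ⁅φ, ⁅vx, vz⁆⁆ = 0 := by
    rw [leibniz_lie, fx, fz, smul_lie, lie_self]; simp
  have hcc : c = c' := by
    have h2 : ⁅φ, ⁅⁅vx, vz⁆, vx⁆⁆ = ⁅⁅vx, vz⁆, ⁅φ, vx⁆⁆ := by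
      rw [leibniz_lie, ft, zero_lie, zero_add]
    rw [tx, lie_smul, fx, lie_smul, tz, hB] at h2
    have h3 : (0:ℝ) • vx + (c - c') • vz = 0 := by
      have h4 : (2:ℝ)⁻¹ • (c' • ((-2:ℝ)) • vz - c • ((-2:ℝ)) • vz) = 0 := by
        rw [h2, smul_comm c']; simp
      rw [← h4]; module
    have := (f'.indep H (by rw [h3]; exact Submodule.zero_mem _)).2
    linarith
  have hc0 : c = 0 := by
    have h2 : ⁅⁅vx, vz⁆, ⁅vx, vz⁆⁆ = 0 := lie_self _
    rw [leibniz_lie ⁅vx, vz⁆ vx vz, tx, tz, smul_lie, lie_smul, ← hcc] at h2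
    have := congrArg lam h2
    rw [map_add, map_smul, f'.nrm, map_zero] at this
    simp at this; linarith
  have hc0' : c' = 0 := by rw [← hcc]; exact hc0
  rw [hc0, zero_smul] at tx
  rw [hc0', zero_smul] at tz
  have ga : ∀ u ∈ F 0, ⁅u, vx⁆ ∈ Submodule.span ℝ {vx, vz} := by
    intro u hu
    obtain ⟨E, K, P, rfl⟩ := exp0 u hu
    rw [Submodule.mem_span_pair]
    refine ⟨-K, P * B, ?_⟩
    simp only [add_lie, smul_lie, ex, bkx, fx]; module
  have gb : ∀ u ∈ F 0, ⁅u, vz⁆ ∈ Submodule.span ℝ {vx, vz} := by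
    intro u hu
    obtain ⟨E, K, P, rfl⟩ := exp0 u hu
    rw [Submodule.mem_span_pair]
    refine ⟨E * A, K, ?_⟩
    simp only [add_lie, smul_lie, ez, bkz, fz]; module
  refine grading_iso H f' (gr3 H f' F1 ga gb tx tz) _ ?_
  have i1 : hh F vx vz lam 1 = ⊥ := Frame.hh_bot H F1 le_rfl
  rw [f'.sup5 H (Frame.hh_bot H F1 (by norm_num)), i1, Frame.hh_bot H F1 (show (1:ℤ) ≤ 2 by norm_num),
    h0', h0, sup_bot_eq, sup_bot_eq, ← Submodule.span_union]
  simp only [Tgt]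
  show Submodule.span ℝ _ = _
  congr 1
  ext; simp; tauto

end

section

set_option linter.unusedSimpArgs false

variable {g : Type} [LieRing g] [LieAlgebra ℝ g] {F : ℤ → Submodule ℝ g} {wx wz : g}
  {lam : g →ₗ[ℝ] ℝ}

theorem X1_eq : (X 1 : PL) = (2:ℝ)⁻¹ • TT + (2:ℝ)⁻¹ • (X 0 * X 2) := by
  have : (C (2:ℝ)⁻¹ : PL) * 2 = 1 := by rw [← C_two, ← C_mul]; simp
  simp only [TT, smul_eq_C_mul]
  linear_combination (- X 1 : PL) * this

theorem TT_eq : TT = (2:ℝ) • X 1 - X 0 * X 2 := by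
  simp [TT, smul_eq_C_mul, C_two]

theorem q4_span {V : Submodule ℝ PL} (h1 : X 0 ^ 2 ∈ V) (h2 : X 0 * X 2 ∈ V) (h3 : X 2 ^ 2 ∈ V)
    (h4 : TT ∈ V) (a b c d : ℝ) : q4 a b c d ∈ V :=
  Submodule.add_mem _ (Submodule.add_mem _ (Submodule.add_mem _ (Submodule.smul_mem _ _ h1)
    (Submodule.smul_mem _ _ h2)) (Submodule.smul_mem _ _ h3)) (Submodule.smul_mem _ _ h4)

/-- the case `hh 0 = gl(2)` -/
theorem caseA (H : CLA F) (f : Frame F wx wz lam) (hx : X 0 ^ 2 ∈ hh F wx wz lam 0)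
    (hxz : X 0 * X 2 ∈ hh F wx wz lam 0) (hz : X 2 ^ 2 ∈ hh F wx wz lam 0)
    (hT : TT ∈ hh F wx wz lam 0) :
    Iso16 g F (Sum.inl (Sum.inl 0)) ∨ Iso16 g F (Sum.inl (Sum.inl 1)) := by
  obtain ⟨vx, vz, G, f', K, h0⟩ := f.gradE H hT
  rw [← h0] at hx hxz hz hT
  have e0 : hh F vx vz lam 0 = Submodule.span ℝ {X 0 ^ 2, X 0 * X 2, X 2 ^ 2, TT} := by
    apply le_antisymm
    · intro u hu
      obtain ⟨a, b, c, d, rfl⟩ := L_0 (hh_le 0 hu)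
      apply q4_span <;> exact Submodule.subset_span (by simp)
    · rw [Submodule.span_le]
      rintro u (rfl | rfl | rfl | rfl) <;> assumption
  by_cases h1 : hh F vx vz lam 1 = ⊥
  · right
    refine grading_iso H f' K _ ?_
    rw [f'.sup5 H (f'.hh_prop H (by norm_num) h1 (by norm_num)), h1,
      f'.hh_prop H (by norm_num) h1 (show (1:ℤ) ≤ 2 by norm_num),
      e0, sup_bot_eq, sup_bot_eq, ← Submodule.span_union]
    simp only [Tgt]
    show Submodule.span ℝ _ = _
    apply le_antisymm
    · rw [Submodule.span_le]
      rintro u (rfl | rfl | rfl | rfl | rfl | rfl | rfl)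
      all_goals first
        | (refine Submodule.subset_span ?_; simp; done)
        | (rw [X1_eq]; exact Submodule.add_mem _ (Submodule.smul_mem _ _ (Submodule.subset_span (by simp)))
            (Submodule.smul_mem _ _ (Submodule.subset_span (by simp))))
    · rw [Submodule.span_le]
      rintro u ((rfl | rfl | rfl) | (rfl | rfl | rfl | rfl))
      all_goals first
        | (refine Submodule.subset_span ?_; simp; done)
        | (rw [TT_eq]; exact Submodule.sub_mem _ (Submodule.smul_mem _ _ (Submodule.subset_span (by simp)))
            (Submodule.subset_span (by simp)))
  · left
    obtain ⟨e1, e2, e3⟩ := (f'.gs H).gl hx hz h1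
    refine grading_iso H f' K _ ?_
    rw [f'.sup5 H e3, e0, e1, e2, ← Submodule.span_union, ← Submodule.span_union,
      ← Submodule.span_union]
    simp only [Tgt]
    show Submodule.span ℝ _ = _
    apply le_antisymm
    · rw [Submodule.span_le]
      rintro u (rfl | rfl | rfl | rfl | rfl | rfl | rfl | rfl | rfl | rfl)
      all_goals first
        | (refine Submodule.subset_span ?_; simp; done)
        | (rw [X1_eq]; exact Submodule.add_mem _ (Submodule.smul_mem _ _ (Submodule.subset_span (by simp)))
            (Submodule.smul_mem _ _ (Submodule.subset_span (by simp))))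
    · rw [Submodule.span_le]
      rintro u ((((rfl | rfl | rfl) | (rfl | rfl | rfl | rfl)) | (rfl | rfl)) | rfl)
      all_goals first
        | (refine Submodule.subset_span ?_; simp; done)
        | (rw [TT_eq]; exact Submodule.sub_mem _ (Submodule.smul_mem _ _ (Submodule.subset_span (by simp)))
            (Submodule.subset_span (by simp)))

theorem caseAB (H : CLA F) (f : Frame F wx wz lam) (hx : X 0 ^ 2 ∈ hh F wx wz lam 0)
    (hxz : X 0 * X 2 ∈ hh F wx wz lam 0) (hz : X 2 ^ 2 ∈ hh F wx wz lam 0) :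
    ∃ i : Fin 5, Iso16 g F (Sum.inl (Sum.inl i)) := by
  by_cases hT : TT ∈ hh F wx wz lam 0
  · rcases caseA H f hx hxz hz hT with h | h
    exacts [⟨_, h⟩, ⟨_, h⟩]
  · have hd : ∀ a b c d, q4 a b c d ∈ hh F wx wz lam 0 → d = 0 := by
      intro a b c d h
      by_contra hd
      apply hT
      have := Submodule.sub_mem _ h (Submodule.add_mem _ (Submodule.add_mem _ (Submodule.smul_mem _ a hx)
        (Submodule.smul_mem _ b hxz)) (Submodule.smul_mem _ c hz))
      have h2 : d • TT ∈ hh F wx wz lam 0 := by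
        convert this using 1; simp [q4]
      have := Submodule.smul_mem _ d⁻¹ h2
      rwa [smul_smul, inv_mul_cancel₀ hd, one_smul] at this
    refine ⟨2, caseB H f ?_ ((f.gs H).sl_bot hx hz hd)⟩
    apply le_antisymm
    · intro u hu
      obtain ⟨a, b, c, d, rfl⟩ := L_0 (hh_le 0 hu)
      rw [hd a b c d hu, Submodule.mem_span_triple]
      exact ⟨a, b, c, by simp [q4]⟩
    · rw [Submodule.span_le]
      rintro u (rfl | rfl | rfl) <;> assumption

/-- normalisation of the frame when `hh 0` contains a definite quadratic form -/
theorem Frame.normal (H : CLA F) (f : Frame F wx wz lam) {a b c d : ℝ}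
    (hm : q4 a b c d ∈ hh F wx wz lam 0) (hD : b ^ 2 - 4 * a * c < 0)
    (hall : ∀ p ∈ hh F wx wz lam 0, ∃ r e, p = q4 (r * a) (r * b) (r * c) e) :
    ∃ vx vz lam', Frame F vx vz lam' ∧ ∃ d, 0 ≤ d ∧ q4 1 0 1 d ∈ hh F vx vz lam' 0 ∧
      ∀ p ∈ hh F vx vz lam' 0, ∃ r e, p = q4 r 0 r e := by
  obtain ⟨s, hs0, hs, hsd⟩ : ∃ s : ℝ, s ≠ 0 ∧ s ^ 2 * (4 * a * c - b ^ 2) = 4 ∧ 0 ≤ s * d := by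
    have hp : 0 < 4 * a * c - b ^ 2 := by linarith
    obtain ⟨t, ht, ht'⟩ : ∃ t : ℝ, 0 < t ∧ t ^ 2 = 4 * a * c - b ^ 2 :=
      ⟨√(4 * a * c - b ^ 2), Real.sqrt_pos.mpr hp, Real.sq_sqrt hp.le⟩
    rw [← ht']
    rcases le_total 0 d with h | h
    · exact ⟨2 / t, by positivity, by field_simp; norm_num, by positivity⟩
    · refine ⟨- (2 / t), neg_ne_zero.mpr (by positivity), by field_simp; norm_num, ?_⟩
      have : 0 < 2 / t := by positivity
      nlinarith
  obtain ⟨A, hA⟩ : ∃ A, A = s * a := ⟨_, rfl⟩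
  obtain ⟨B, hB⟩ : ∃ B, B = s * b := ⟨_, rfl⟩
  obtain ⟨Γ, hC⟩ : ∃ Γ, Γ = s * c := ⟨_, rfl⟩
  have hdet : 4 * A * Γ - B ^ 2 = 4 := by rw [hA, hB, hC]; linear_combination hs
  have hm' : q4 A B Γ (s * d) ∈ hh F wx wz lam 0 := by
    have := Submodule.smul_mem _ s hm
    rwa [q4_smul, ← hA, ← hB, ← hC] at this
  have hall' : ∀ p ∈ hh F wx wz lam 0, ∃ r e, p = q4 (r * A) (r * B) (r * Γ) e := by
    intro p hp
    obtain ⟨r, e, h⟩ := hall p hp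
    refine ⟨r / s, e, ?_⟩
    rw [h, hA, hB, hC]
    congr 1 <;> field_simp
  have hG : Γ ≠ 0 := by rintro rfl; nlinarith [sq_nonneg B]
  obtain ⟨vz, hvz⟩ : ∃ vz, vz = Γ • wz + (B / 2) • wx := ⟨_, rfl⟩
  have hwz : wz = Γ⁻¹ • vz - (Γ⁻¹ * (B / 2)) • wx := by
    rw [hvz, smul_add, smul_smul, inv_mul_cancel₀ hG]; module
  have f' : Frame F wx vz (Γ⁻¹ • lam) := by
    refine ⟨f.mx, ?_, ?_, ?_, ?_⟩
    · rw [hvz]; exact Submodule.add_mem _ (Submodule.smul_mem _ _ f.mz) (Submodule.smul_mem _ _ f.mx)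
    · intro u
      rw [← f.ker u, LinearMap.smul_apply, smul_eq_mul]
      simp [hG]
    · rw [hvz, LinearMap.smul_apply, lie_add, lie_smul, lie_smul, lie_self, map_add, map_smul, f.nrm]
      simp [hG]
    · intro y hy
      obtain ⟨p, q, h⟩ := f.spn y hy
      refine ⟨p - q * Γ⁻¹ * (B / 2), q * Γ⁻¹, ?_⟩
      convert h using 1
      conv_rhs => rw [hwz]
      module
  have key : ∀ e ∈ F 0, ∀ r d : ℝ, sg wx wz lam 0 e = q4 (r * A) (r * B) (r * Γ) d →
      sg wx vz (Γ⁻¹ • lam) 0 e = q4 r 0 r d := by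
    intro e he r d h
    obtain ⟨i1, i2⟩ := f.act1 H he h
    apply f'.act2 H he
    · convert i1 using 1
      rw [hvz]; module
    · have := Submodule.add_mem _ (Submodule.smul_mem _ Γ i2) (Submodule.smul_mem _ (B / 2) i1)
      convert this using 1
      rw [hvz, lie_add, lie_smul, lie_smul]
      have hr : 2 * r = 2 * r * A * Γ - r * B ^ 2 / 2 := by linear_combination (- r / 2) * hdet
      rw [hr]
      module
  refine ⟨wx, vz, Γ⁻¹ • lam, f', s * d, hsd, ?_, ?_⟩
  · obtain ⟨e, he, h⟩ := hm'
    exact ⟨e, he, key e he 1 _ (by rw [h]; simp)⟩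
  · rintro _ ⟨e, he, rfl⟩
    obtain ⟨r, d', h⟩ := hall' _ ⟨e, he, rfl⟩
    exact ⟨r, d', key e he r d' h⟩

theorem caseC (H : CLA F) (f : Frame F wx wz lam) {d : ℝ} (hm : q4 1 0 1 d ∈ hh F wx wz lam 0)
    (hall : ∀ p ∈ hh F wx wz lam 0, ∃ r e, p = q4 r 0 r e) (hT : TT ∈ hh F wx wz lam 0) :
    ∃ i : Fin 5, Iso16 g F (Sum.inl (Sum.inl i)) := by
  have e0 : hh F wx wz lam 0 = Submodule.span ℝ {NN, TT} := by
    apply le_antisymm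
    · intro u hu
      obtain ⟨a, d, rfl⟩ := hall u hu
      rw [Submodule.mem_span_pair]
      exact ⟨a, d, (NN_q4 a d).symm⟩
    · rw [Submodule.span_le]
      rintro u (rfl | rfl)
      · have := Submodule.sub_mem _ hm (Submodule.smul_mem _ d hT)
        rw [NN_q4] at this
        simpa using this
      · exact hT
  obtain ⟨vx, vz, G, f', K, h0⟩ := f.gradE H hT
  rw [e0] at h0
  by_cases h1 : hh F vx vz lam 1 = ⊥
  · refine ⟨4, grading_iso H f' K _ ?_⟩
    rw [f'.sup5 H (f'.hh_prop H (by norm_num) h1 (by norm_num)), h1,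
      f'.hh_prop H (by norm_num) h1 (show (1:ℤ) ≤ 2 by norm_num),
      h0, sup_bot_eq, sup_bot_eq, ← Submodule.span_union]
    simp only [Tgt]
    simp only [Set.insert_union, Set.singleton_union]
    rfl
  · obtain ⟨e1, e2, e3⟩ := (f'.gs H).co h0 h1
    refine ⟨3, grading_iso H f' K _ ?_⟩
    rw [f'.sup5 H e3, h0, e1, e2, ← Submodule.span_union, ← Submodule.span_union,
      ← Submodule.span_union]
    simp only [Tgt]
    simp only [Set.insert_union, Set.singleton_union]
    rfl

/-- reduction of the existence part to the four dimensional case -/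
theorem reduce (H : CLA F) (f : Frame F wx wz lam)
    (hirr : ∀ W : Submodule ℝ g, F 0 ≤ W → W ≤ F (-1) →
      (∀ u ∈ F 0, ∀ w ∈ W, ⁅u, w⁆ ∈ W) → W = F 0 ∨ W = F (-1)) :
    (∃ i : Fin 5, Iso16 g F (Sum.inl (Sum.inl i))) ∨
    ∃ vx vz lam' d, 0 ≤ d ∧ Frame F vx vz lam' ∧
      hh F vx vz lam' 0 = Submodule.span ℝ {q4 1 0 1 d} ∧ F 1 = ⊥ := by
  rcases (f.gs H).irr0 (f.irr H hirr) with ⟨h1, h2, h3⟩ | ⟨a, b, c, d, hm, hD, hall⟩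
  · exact Or.inl (caseAB H f h1 h2 h3)
  · obtain ⟨vx, vz, lam', f', d, hd, hm, hall⟩ := f.normal H hm hD hall
    by_cases hT : TT ∈ hh F vx vz lam' 0
    · exact Or.inl (caseC H f' hm hall hT)
    · right
      have hall' : ∀ p ∈ hh F vx vz lam' 0, ∃ r : ℝ, p = r • q4 1 0 1 d := by
        intro p hp
        obtain ⟨r, e, rfl⟩ := hall p hp
        refine ⟨r, ?_⟩
        have h1 := Submodule.sub_mem _ hp (Submodule.smul_mem _ r hm)
        have h2 : (e - r * d) • TT ∈ hh F vx vz lam' 0 := by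
          convert h1 using 1
          rw [NN_q4, NN_q4]; module
        have h3 : e - r * d = 0 := by
          by_contra hne
          apply hT
          have := Submodule.smul_mem _ (e - r * d)⁻¹ h2
          rwa [smul_smul, inv_mul_cancel₀ hne, one_smul] at this
        rw [q4_smul, show e = r * d by linarith]; simp
      refine ⟨vx, vz, lam', d, hd, f', ?_, ?_⟩
      · apply le_antisymm
        · intro p hp
          obtain ⟨r, rfl⟩ := hall' p hp
          exact Submodule.smul_mem _ _ (Submodule.mem_span_singleton_self _)
        · rw [Submodule.span_le]
          rintro u rfl; exact hm
      · exact f'.F_bot H (by norm_num) ((f'.gs H).one hall')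

end

section

set_option linter.unusedSimpArgs false

/-- normal form of the four dimensional contact Lie algebras -/
structure NF {g : Type} [LieRing g] [LieAlgebra ℝ g] (F : ℤ → Submodule ℝ g) (α κ : ℝ)
    (e v1 v2 : g) : Prop where
  neg : ∀ p : ℤ, p ≤ -2 → F p = ⊤
  pos : ∀ p : ℤ, 1 ≤ p → F p = ⊥
  zero : F 0 = Submodule.span ℝ {e}
  one : F (-1) = Submodule.span ℝ {e, v1, v2}
  spn : ∀ u : g, ∃ T A B E : ℝ, u = T • ⁅v1, v2⁆ + A • v1 + B • v2 + E • e
  ind : ∀ T A B E : ℝ, T • ⁅v1, v2⁆ + A • v1 + B • v2 + E • e = 0 → T = 0 ∧ A = 0 ∧ B = 0 ∧ E = 0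
  e1 : ⁅e, v1⁆ = (-α) • v1 + (-2 : ℝ) • v2
  e2 : ⁅e, v2⁆ = (2 : ℝ) • v1 + (-α) • v2
  t1 : ⁅⁅v1, v2⁆, v1⁆ = (-κ) • v2
  t2 : ⁅⁅v1, v2⁆, v2⁆ = κ • v1
  ak : α * κ = 0

variable {g : Type} [LieRing g] [LieAlgebra ℝ g] {F : ℤ → Submodule ℝ g} {wx wz : g}
  {lam : g →ₗ[ℝ] ℝ}

theorem NF.et {α κ : ℝ} {e v1 v2 : g} (N : NF F α κ e v1 v2) :
    ⁅e, ⁅v1, v2⁆⁆ = (-(2 * α)) • ⁅v1, v2⁆ := by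
  rw [leibniz_lie, N.e1, N.e2]
  simp only [add_lie, lie_add, smul_lie, lie_smul, lie_self]; module

theorem lin_zero2 {x y a : ℝ} (h1 : a * x = -2 * y) (h2 : a * y = 2 * x) : x = 0 ∧ y = 0 := by
  have hy : (a ^ 2 + 4) * y = 0 := by linear_combination a * h2 + 2 * h1
  have : a ^ 2 + 4 ≠ 0 := by positivity
  have hy0 : y = 0 := (mul_eq_zero.mp hy).resolve_left this
  subst hy0
  exact ⟨by linarith, rfl⟩

/-- the four dimensional case: normal form, and the graded one among them -/
theorem caseD (H : CLA F) (f : Frame F wx wz lam) {α : ℝ}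
    (h0 : hh F wx wz lam 0 = Submodule.span ℝ {q4 1 0 1 α}) (F1 : F 1 = ⊥) :
    ∃ κ e v1 v2, NF F α κ e v1 v2 ∧ (κ = 0 → Iso16 g F (Sum.inl (Sum.inr α))) := by
  obtain ⟨e, he, se⟩ : q4 1 0 1 α ∈ hh F wx wz lam 0 := by
    rw [h0]; exact Submodule.mem_span_singleton_self _
  have exp0 : ∀ u ∈ F 0, ∃ E : ℝ, u = E • e := by
    intro u hu
    have : sg wx wz lam 0 u ∈ hh F wx wz lam 0 := ⟨u, hu, rfl⟩
    rw [h0, Submodule.mem_span_singleton] at this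
    obtain ⟨E, h⟩ := this
    exact ⟨E, f.sg0_inj H F1 hu (Submodule.smul_mem _ _ he) (by rw [map_smul, se, h])⟩
  have e_ne : e ≠ 0 := by
    rintro rfl
    rw [map_zero] at se
    have := q4_inj (show q4 0 0 0 0 = q4 1 0 1 α by rw [← se]; simp [q4])
    linarith [this.1]
  obtain ⟨ax, az⟩ := f.act1 H he se
  obtain ⟨ρ, hρ⟩ := exp0 _ ax
  obtain ⟨σ, hσ⟩ := exp0 _ az
  have bx : ⁅e, wx⁆ = (-α) • wx + (-2:ℝ) • wz + ρ • e := by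
    rw [← hρ]; module
  have bz : ⁅e, wz⁆ = (2:ℝ) • wx + (-α) • wz + σ • e := by
    rw [← hσ]; module
  have hpos : α ^ 2 + 4 ≠ 0 := by positivity
  obtain ⟨r, hr⟩ : ∃ r, r = (-α * ρ + 2 * σ) / (α ^ 2 + 4) := ⟨_, rfl⟩
  obtain ⟨s, hs⟩ : ∃ s, s = (-2 * ρ - α * σ) / (α ^ 2 + 4) := ⟨_, rfl⟩
  have k1 : ρ = -α * r - 2 * s := by rw [hr, hs]; field_simp; ring
  have k2 : σ = 2 * r - α * s := by rw [hr, hs]; field_simp; ring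
  obtain ⟨v1, hv1⟩ : ∃ v1, v1 = wx + r • e := ⟨_, rfl⟩
  obtain ⟨v2, hv2⟩ : ∃ v2, v2 = wz + s • e := ⟨_, rfl⟩
  have hx : v1 - wx ∈ F 0 := by rw [hv1]; simpa using Submodule.smul_mem _ r he
  have hz : v2 - wz ∈ F 0 := by rw [hv2]; simpa using Submodule.smul_mem _ s he
  have f' := f.shift H hx hz
  have h0' := f.shift_hh H hx hz
  have e1 : ⁅e, v1⁆ = (-α) • v1 + (-2 : ℝ) • v2 := by
    rw [hv1, hv2, lie_add, lie_smul, lie_self, bx, k1]; module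
  have e2 : ⁅e, v2⁆ = (2 : ℝ) • v1 + (-α) • v2 := by
    rw [hv1, hv2, lie_add, lie_smul, lie_self, bz, k2]; module
  have spn : ∀ u : g, ∃ T A B E : ℝ, u = T • ⁅v1, v2⁆ + A • v1 + B • v2 + E • e := by
    intro u
    obtain ⟨T, A, B, h⟩ := f'.expand H u
    obtain ⟨E, h⟩ := exp0 _ h
    exact ⟨T, A, B, E, by rw [← h]; abel⟩
  have ind : ∀ T A B E : ℝ, T • ⁅v1, v2⁆ + A • v1 + B • v2 + E • e = 0 →
      T = 0 ∧ A = 0 ∧ B = 0 ∧ E = 0 := by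
    intro T A B E h
    obtain ⟨rfl, rfl, rfl⟩ := f'.indep3 H (T := T) (A := A) (B := B) (by
      rw [eq_neg_of_add_eq_zero_left h]
      exact Submodule.neg_mem _ (Submodule.smul_mem _ _ he))
    refine ⟨rfl, rfl, rfl, ?_⟩
    simpa [e_ne] using h
  have et : ⁅e, ⁅v1, v2⁆⁆ = (-(2 * α)) • ⁅v1, v2⁆ := by
    rw [leibniz_lie, e1, e2]
    simp only [add_lie, lie_add, smul_lie, lie_smul, lie_self]; module
  obtain ⟨T1, A1, B1, E1, q1⟩ := spn ⁅⁅v1, v2⁆, v1⁆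
  obtain ⟨T2, A2, B2, E2, q2⟩ := spn ⁅⁅v1, v2⁆, v2⁆
  have z1 : ⁅e, ⁅⁅v1, v2⁆, v1⁆⁆ = (-(3 * α)) • ⁅⁅v1, v2⁆, v1⁆ + (-2 : ℝ) • ⁅⁅v1, v2⁆, v2⁆ := by
    rw [leibniz_lie, et, e1, smul_lie, lie_add, lie_smul, lie_smul]; module
  have z2 : ⁅e, ⁅⁅v1, v2⁆, v2⁆⁆ = (-(3 * α)) • ⁅⁅v1, v2⁆, v2⁆ + (2 : ℝ) • ⁅⁅v1, v2⁆, v1⁆ := by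
    rw [leibniz_lie, et, e2, smul_lie, lie_add, lie_smul, lie_smul]; module
  rw [q1, q2] at z1 z2
  simp only [lie_add, lie_smul, lie_self, et, e1, e2] at z1 z2
  rw [← sub_eq_zero] at z1 z2
  obtain ⟨c1, c2, c3, c4⟩ := ind (α * T1 + 2 * T2) (2 * α * A1 + 2 * B1 + 2 * A2)
    (2 * α * B1 - 2 * A1 + 2 * B2) (3 * α * E1 + 2 * E2) (by rw [← z1]; module)
  obtain ⟨d1, d2, d3, d4⟩ := ind (α * T2 - 2 * T1) (2 * α * A2 + 2 * B2 - 2 * A1)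
    (2 * α * B2 - 2 * A2 - 2 * B1) (3 * α * E2 - 2 * E1) (by rw [← z2]; module)
  obtain ⟨rfl, rfl⟩ := lin_zero2 (x := T1) (y := T2) (a := α) (by linarith) (by linarith)
  obtain ⟨rfl, rfl⟩ := lin_zero2 (x := E1) (y := E2) (a := 3 * α) (by linarith) (by linarith)
  obtain ⟨i1, i2⟩ := lin_zero2 (x := B1 + A2) (y := B2 - A1) (a := α) (by linarith) (by linarith)
  have hA : A1 + B2 = 0 := by
    have h2 : ⁅⁅v1, v2⁆, ⁅v1, v2⁆⁆ = 0 := lie_self _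
    rw [leibniz_lie ⁅v1, v2⁆ v1 v2, q1, q2] at h2
    simp only [add_lie, smul_lie, lie_add, lie_smul, lie_self, zero_smul, zero_lie, lie_zero] at h2
    have := ind (A1 + B2) 0 0 0 (by rw [← h2]; module)
    exact this.1
  have hA1 : A1 = 0 := by linarith
  have hB2 : B2 = 0 := by linarith
  have hA2 : A2 = - B1 := by linarith
  subst hA1 hB2 hA2
  have t1 : ⁅⁅v1, v2⁆, v1⁆ = (-(-B1)) • v2 := by rw [q1]; module
  have t2 : ⁅⁅v1, v2⁆, v2⁆ = (-B1) • v1 := by rw [q2]; module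
  refine ⟨-B1, e, v1, v2, ⟨H.neg, ?_, ?_, ?_, spn, ind, e1, e2, t1, t2, by linarith⟩, ?_⟩
  · intro p hp; rw [eq_bot_iff, ← F1]; exact H.anti hp
  · apply le_antisymm
    · intro u hu
      obtain ⟨E, rfl⟩ := exp0 u hu
      exact Submodule.smul_mem _ _ (Submodule.mem_span_singleton_self _)
    · rw [Submodule.span_le]; rintro u rfl; exact he
  · apply le_antisymm
    · intro u hu
      obtain ⟨a, b, h⟩ := f'.spn u hu
      obtain ⟨E, h⟩ := exp0 _ h
      rw [Submodule.mem_span_triple]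
      exact ⟨E, a, b, by rw [← h]; abel⟩
    · rw [Submodule.span_le]
      rintro u (rfl | rfl | rfl)
      exacts [H.anti (by norm_num) he, f'.mx, f'.mz]
  · intro hB
    have hB : B1 = 0 := by linarith
    subst hB
    have ga : ∀ u ∈ F 0, ⁅u, v1⁆ ∈ Submodule.span ℝ {v1, v2} := by
      intro u hu
      obtain ⟨E, rfl⟩ := exp0 u hu
      rw [Submodule.mem_span_pair]
      exact ⟨-(E * α), -2 * E, by rw [smul_lie, e1]; module⟩
    have gb : ∀ u ∈ F 0, ⁅u, v2⁆ ∈ Submodule.span ℝ {v1, v2} := by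
      intro u hu
      obtain ⟨E, rfl⟩ := exp0 u hu
      rw [Submodule.mem_span_pair]
      exact ⟨2 * E, -(E * α), by rw [smul_lie, e2]; module⟩
    refine grading_iso H f' (gr3 H f' F1 ga gb (by rw [t1]; simp) (by rw [t2]; simp)) _ ?_
    have i1 : hh F v1 v2 lam 1 = ⊥ := Frame.hh_bot H F1 le_rfl
    rw [f'.sup5 H (Frame.hh_bot H F1 (by norm_num)), i1,
      Frame.hh_bot H F1 (show (1:ℤ) ≤ 2 by norm_num),
      h0', h0, sup_bot_eq, sup_bot_eq, ← Submodule.span_union]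
    simp only [Tgt, Set.insert_union, Set.singleton_union]
    rw [NN_q4, one_smul, smul_eq_C_mul]

/-- rescaling -/
theorem NF.scale {α κ : ℝ} {e v1 v2 : g} (N : NF F α κ e v1 v2) {s : ℝ} (hs : s ≠ 0) :
    NF F α (s ^ 2 * κ) e (s • v1) (s • v2) := by
  have ht : ⁅s • v1, s • v2⁆ = (s ^ 2) • ⁅v1, v2⁆ := by
    rw [smul_lie, lie_smul, smul_smul, sq]
  refine ⟨N.neg, N.pos, N.zero, ?_, ?_, ?_, ?_, ?_, ?_, ?_, ?_⟩
  · rw [N.one]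
    apply le_antisymm
    · intro u hu
      rw [Submodule.mem_span_triple] at hu ⊢
      obtain ⟨a, b, c, rfl⟩ := hu
      refine ⟨a, b / s, c / s, ?_⟩
      rw [smul_smul, smul_smul, div_mul_cancel₀ _ hs, div_mul_cancel₀ _ hs]
    · intro u hu
      rw [Submodule.mem_span_triple] at hu ⊢
      obtain ⟨a, b, c, rfl⟩ := hu
      exact ⟨a, b * s, c * s, by module⟩
  · intro u
    obtain ⟨T, A, B, E, rfl⟩ := N.spn u
    refine ⟨T / s ^ 2, A / s, B / s, E, ?_⟩
    rw [ht, smul_smul, smul_smul, smul_smul, div_mul_cancel₀ _ hs, div_mul_cancel₀ _ hs,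
      div_mul_cancel₀ _ (pow_ne_zero 2 hs)]
  · intro T A B E h
    rw [ht, smul_smul, smul_smul, smul_smul] at h
    obtain ⟨i1, i2, i3, i4⟩ := N.ind _ _ _ _ h
    simp [hs] at i1 i2 i3
    exact ⟨i1, i2, i3, i4⟩
  · rw [lie_smul, N.e1]; module
  · rw [lie_smul, N.e2]; module
  · rw [ht, smul_lie, lie_smul, N.t1]; module
  · rw [ht, smul_lie, lie_smul, N.t2]; module
  · linear_combination s ^ 2 * N.ak

theorem NF.norm {α κ : ℝ} {e v1 v2 : g} (N : NF F α κ e v1 v2) (hκ : κ ≠ 0) :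
    (∃ v1 v2, NF F 0 4 e v1 v2) ∨ ∃ v1 v2, NF F 0 (-4) e v1 v2 := by
  have hα : α = 0 := (mul_eq_zero.mp N.ak).resolve_right hκ
  subst hα
  have hs : √(4 / |κ|) ≠ 0 := by
    have : 0 < |κ| := abs_pos.mpr hκ
    exact (Real.sqrt_pos.mpr (by positivity)).ne'
  have N' := N.scale hs
  rw [Real.sq_sqrt (by positivity)] at N'
  rcases lt_or_gt_of_ne hκ with h | h
  · right
    rw [abs_of_neg h, show 4 / (-κ) * κ = -4 by field_simp] at N'
    exact ⟨_, _, N'⟩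
  · left
    rw [abs_of_pos h, show 4 / (κ) * κ = 4 by field_simp] at N'
    exact ⟨_, _, N'⟩

/-- the parameters are determined -/
theorem NF.uniq {α κ α' κ' : ℝ} {e v1 v2 e' v1' v2' : g} (N : NF F α κ e v1 v2)
    (N' : NF F α' κ' e' v1' v2') (hα : 0 ≤ α) (hα' : 0 ≤ α') :
    α = α' ∧ ∃ c : ℝ, 0 < c ∧ κ' = c * κ := by
  have me : e' ∈ F 0 := by rw [N'.zero]; exact Submodule.mem_span_singleton_self _
  have m1 : v1' ∈ F (-1) := by rw [N'.one]; exact Submodule.subset_span (by simp)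
  have m2 : v2' ∈ F (-1) := by rw [N'.one]; exact Submodule.subset_span (by simp)
  rw [N.zero, Submodule.mem_span_singleton] at me
  rw [N.one, Submodule.mem_span_triple] at m1 m2
  obtain ⟨l, hl⟩ := me
  obtain ⟨r, p, q, hv1⟩ := m1
  obtain ⟨r2, p2, q2, hv2⟩ := m2
  have w1 := N'.e1
  have w2 := N'.e2
  rw [← hl, ← hv1, ← hv2] at w1 w2
  simp only [smul_lie, lie_add, lie_smul, lie_self, N.e1, N.e2] at w1 w2
  rw [← sub_eq_zero] at w1 w2
  obtain ⟨-, a1, a2, a3⟩ := N.ind 0 (l * (-α * p + 2 * q) + α' * p + 2 * p2)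
    (l * (-2 * p - α * q) + α' * q + 2 * q2) (α' * r + 2 * r2) (by rw [← w1]; module)
  obtain ⟨-, b1, b2, b3⟩ := N.ind 0 (l * (-α * p2 + 2 * q2) - 2 * p + α' * p2)
    (l * (-2 * p2 - α * q2) - 2 * q + α' * q2) (-2 * r + α' * r2) (by rw [← w2]; module)
  obtain ⟨rfl, rfl⟩ := lin_zero2 (x := r) (y := r2) (a := α') (by linarith) (by linarith)
  obtain ⟨δ, hδ⟩ : ∃ δ, δ = l * α - α' := ⟨_, rfl⟩
  have c1 : 2 * p2 = δ * p - 2 * l * q := by rw [hδ]; linarith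
  have c2 : 2 * q2 = 2 * l * p + δ * q := by rw [hδ]; linarith
  have c3 : (4 * l ^ 2 - δ ^ 2 - 4) * p + 4 * l * δ * q = 0 := by
    have : - δ * p2 + 2 * l * q2 = 2 * p := by rw [hδ]; linarith
    linear_combination 2 * this + δ * c1 - 2 * l * c2
  have c4 : -4 * l * δ * p + (4 * l ^ 2 - δ ^ 2 - 4) * q = 0 := by
    have : - 2 * l * p2 - δ * q2 = 2 * q := by rw [hδ]; linarith
    linear_combination 2 * this + 2 * l * c1 + δ * c2
  have hpq : 0 < p ^ 2 + q ^ 2 := by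
    rcases (show 0 ≤ p ^ 2 + q ^ 2 by positivity).lt_or_eq with h | h
    · exact h
    · exfalso
      have hp : p = 0 := by nlinarith [sq_nonneg p, sq_nonneg q]
      have hq : q = 0 := by nlinarith [sq_nonneg p, sq_nonneg q]
      have : v1' = 0 := by rw [← hv1, hp, hq]; simp
      have := N'.ind 0 1 0 0 (by rw [this]; simp)
      linarith [this.2.1]
  have c5 : (4 * l ^ 2 - δ ^ 2 - 4) ^ 2 + (4 * l * δ) ^ 2 = 0 := by
    have : ((4 * l ^ 2 - δ ^ 2 - 4) ^ 2 + (4 * l * δ) ^ 2) * (p ^ 2 + q ^ 2) = 0 := by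
      linear_combination ((4 * l ^ 2 - δ ^ 2 - 4) * p + 4 * l * δ * q) * c3 +
        (-4 * l * δ * p + (4 * l ^ 2 - δ ^ 2 - 4) * q) * c4
    exact (mul_eq_zero.mp this).resolve_right hpq.ne'
  have c6 : 4 * l ^ 2 - δ ^ 2 - 4 = 0 := by
    nlinarith [sq_nonneg (4 * l ^ 2 - δ ^ 2 - 4), sq_nonneg (4 * l * δ)]
  have c7 : l * δ = 0 := by
    nlinarith [sq_nonneg (4 * l ^ 2 - δ ^ 2 - 4), sq_nonneg (4 * l * δ)]
  have hl0 : l ≠ 0 := by rintro rfl; nlinarith [sq_nonneg δ]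
  have hδ0 : δ = 0 := (mul_eq_zero.mp c7).resolve_left hl0
  rw [hδ0] at c1 c2 c6 hδ
  have hl2 : (l - 1) * (l + 1) = 0 := by linarith
  have hp2 : p2 = - l * q := by linarith
  have hq2 : q2 = l * p := by linarith
  constructor
  · rcases mul_eq_zero.mp hl2 with h | h
    · have : l = 1 := by linarith
      rw [this] at hδ; linarith
    · have : l = -1 := by linarith
      rw [this] at hδ; linarith
  · refine ⟨p ^ 2 + q ^ 2, hpq, ?_⟩
    have w3 := N'.t1
    rw [← hv1, ← hv2, hp2, hq2] at w3
    simp only [smul_lie, add_lie, lie_add, lie_smul, lie_self, zero_smul, zero_add, smul_zero, add_zero] at w3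
    have sk : ⁅⁅v2, v1⁆, v1⁆ = κ • v2 := by rw [← lie_skew v2 v1, neg_lie, N.t1]; module
    have sk2 : ⁅⁅v2, v1⁆, v2⁆ = (-κ) • v1 := by rw [← lie_skew v2 v1, neg_lie, N.t2]; module
    simp only [sk, sk2, N.t1, N.t2] at w3
    rw [← sub_eq_zero] at w3
    obtain ⟨-, x1, x2, -⟩ := N.ind 0 (l * q * ((p ^ 2 + q ^ 2) * κ - κ')) (-(l * p * ((p ^ 2 + q ^ 2) * κ - κ'))) 0
      (by rw [← w3]; module)
    by_contra hne
    have hne : (p ^ 2 + q ^ 2) * κ - κ' ≠ 0 := fun h => hne (by linarith)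
    have hq : q = 0 := by simpa [hl0, hne] using x1
    have hp : p = 0 := by simpa [hl0, hne] using x2
    rw [hp, hq] at hpq; norm_num at hpq

end

section

set_option linter.unusedSimpArgs false

variable {g : Type} [LieRing g] [LieAlgebra ℝ g] {F : ℤ → Submodule ℝ g} {α κ : ℝ} {e v1 v2 : g}

theorem NF.li (N : NF F α κ e v1 v2) : LinearIndependent ℝ ![⁅v1, v2⁆, v1, v2, e] := by
  rw [Fintype.linearIndependent_iff]
  intro c hc
  simp only [Fin.sum_univ_four, Matrix.cons_val] at hc
  obtain ⟨h0, h1, h2, h3⟩ := N.ind _ _ _ _ hc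
  intro i; fin_cases i <;> assumption

theorem NF.top (N : NF F α κ e v1 v2) : ⊤ ≤ Submodule.span ℝ (Set.range ![⁅v1, v2⁆, v1, v2, e]) := by
  intro u _
  obtain ⟨T, A, B, E, rfl⟩ := N.spn u
  have : ∀ i, ![⁅v1, v2⁆, v1, v2, e] i ∈ Submodule.span ℝ (Set.range ![⁅v1, v2⁆, v1, v2, e]) :=
    fun i => Submodule.subset_span ⟨i, rfl⟩
  exact Submodule.add_mem _ (Submodule.add_mem _ (Submodule.add_mem _ (Submodule.smul_mem _ _ (this 0))
    (Submodule.smul_mem _ _ (this 1))) (Submodule.smul_mem _ _ (this 2))) (Submodule.smul_mem _ _ (this 3))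

theorem NF.finrank (N : NF F α κ e v1 v2) : Module.finrank ℝ g = 4 := by
  have := Module.finrank_eq_card_basis (Module.Basis.mk N.li N.top)
  simpa using this

theorem NF.lin (N : NF F α κ e v1 v2) {M : Type} [AddCommGroup M] [Module ℝ M] (mt m1 m2 me : M) :
    ∃ φ : g →ₗ[ℝ] M, φ ⁅v1, v2⁆ = mt ∧ φ v1 = m1 ∧ φ v2 = m2 ∧ φ e = me := by
  let b := Module.Basis.mk N.li N.top
  have h : ∀ i, (b.constr ℝ ![mt, m1, m2, me]) (![⁅v1, v2⁆, v1, v2, e] i) = ![mt, m1, m2, me] i := by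
    intro i
    rw [← b.constr_basis ℝ ![mt, m1, m2, me] i]
    simp [b, Module.Basis.mk_apply]
  exact ⟨b.constr ℝ ![mt, m1, m2, me], h 0, h 1, h 2, h 3⟩

theorem NF.homB (N : NF F α κ e v1 v2) {M : Type} [AddCommGroup M] [Module ℝ M] (φ : g →ₗ[ℝ] M)
    (Br : M →ₗ[ℝ] M →ₗ[ℝ] M) (hs : ∀ a b, Br a b = - Br b a) (h0 : ∀ a, Br a a = 0)
    (h12 : Br (φ v1) (φ v2) = φ ⁅v1, v2⁆)
    (h1 : Br (φ e) (φ v1) = (-α) • φ v1 + (-2:ℝ) • φ v2)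
    (h2 : Br (φ e) (φ v2) = (2:ℝ) • φ v1 + (-α) • φ v2)
    (ht1 : Br (φ ⁅v1, v2⁆) (φ v1) = (-κ) • φ v2)
    (ht2 : Br (φ ⁅v1, v2⁆) (φ v2) = κ • φ v1)
    (het : Br (φ e) (φ ⁅v1, v2⁆) = (-(2 * α)) • φ ⁅v1, v2⁆) (u v : g) :
    φ ⁅u, v⁆ = Br (φ u) (φ v) := by
  obtain ⟨T, A, B, E, rfl⟩ := N.spn u
  obtain ⟨T', A', B', E', rfl⟩ := N.spn v
  have s1 : ⁅v1, e⁆ = -((-α) • v1 + (-2:ℝ) • v2) := by rw [← N.e1, lie_skew]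
  have s2 : ⁅v2, e⁆ = -((2:ℝ) • v1 + (-α) • v2) := by rw [← N.e2, lie_skew]
  have s3 : ⁅v1, ⁅v1, v2⁆⁆ = -((-κ) • v2) := by rw [← N.t1, lie_skew]
  have s4 : ⁅v2, ⁅v1, v2⁆⁆ = -(κ • v1) := by rw [← N.t2, lie_skew]
  have s5 : ⁅⁅v1, v2⁆, e⁆ = -((-(2 * α)) • ⁅v1, v2⁆) := by rw [← N.et, lie_skew]
  have s6 : ⁅v2, v1⁆ = -⁅v1, v2⁆ := by rw [lie_skew]
  have r1 : Br (φ v1) (φ e) = -((-α) • φ v1 + (-2:ℝ) • φ v2) := by rw [← h1, hs]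
  have r2 : Br (φ v2) (φ e) = -((2:ℝ) • φ v1 + (-α) • φ v2) := by rw [← h2, hs]
  have r3 : Br (φ v1) (φ ⁅v1, v2⁆) = -((-κ) • φ v2) := by rw [← ht1, hs]
  have r4 : Br (φ v2) (φ ⁅v1, v2⁆) = -(κ • φ v1) := by rw [← ht2, hs]
  have r5 : Br (φ ⁅v1, v2⁆) (φ e) = -((-(2 * α)) • φ ⁅v1, v2⁆) := by rw [← het, hs]
  have r6 : Br (φ v2) (φ v1) = -φ ⁅v1, v2⁆ := by rw [← h12, hs]
  have et := N.et
  simp only [add_lie, lie_add, smul_lie, lie_smul, lie_self, map_add, map_smul, map_neg, map_zero,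
    LinearMap.add_apply, LinearMap.smul_apply,
    N.e1, N.e2, N.t1, N.t2, et, h12, h1, h2, ht1, ht2, het, s1, s2, s3, s4, s5, s6, r1, r2, r3, r4,
    r5, r6, h0]

theorem NF.hom (N : NF F α κ e v1 v2) {M : Type} [Ring M] [Algebra ℝ M] (φ : g →ₗ[ℝ] M)
    (h12 : φ v1 * φ v2 - φ v2 * φ v1 = φ ⁅v1, v2⁆)
    (h1 : φ e * φ v1 - φ v1 * φ e = (-α) • φ v1 + (-2:ℝ) • φ v2)
    (h2 : φ e * φ v2 - φ v2 * φ e = (2:ℝ) • φ v1 + (-α) • φ v2)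
    (ht1 : φ ⁅v1, v2⁆ * φ v1 - φ v1 * φ ⁅v1, v2⁆ = (-κ) • φ v2)
    (ht2 : φ ⁅v1, v2⁆ * φ v2 - φ v2 * φ ⁅v1, v2⁆ = κ • φ v1) (u v : g) :
    φ ⁅u, v⁆ = φ u * φ v - φ v * φ u := by
  have het : φ e * φ ⁅v1, v2⁆ - φ ⁅v1, v2⁆ * φ e = (-(2 * α)) • φ ⁅v1, v2⁆ := by
    have : φ e * φ ⁅v1, v2⁆ - φ ⁅v1, v2⁆ * φ e =
        (φ e * φ v1 - φ v1 * φ e) * φ v2 - φ v2 * (φ e * φ v1 - φ v1 * φ e) +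
        (φ v1 * (φ e * φ v2 - φ v2 * φ e) - (φ e * φ v2 - φ v2 * φ e) * φ v1) := by
      rw [← h12]; noncomm_ring
    rw [this, h1, h2, ← h12]
    simp only [mul_add, add_mul, smul_mul_assoc, mul_smul_comm]; module
  exact N.homB φ (LinearMap.mul ℝ M - (LinearMap.mul ℝ M).flip) (by intro a b; simp) (by intro a; simp)
    h12 h1 h2 ht1 ht2 het u v

theorem NF.inj (N : NF F α κ e v1 v2) {M : Type} [AddCommGroup M] [Module ℝ M] (φ : g →ₗ[ℝ] M)
    (h : ∀ T A B E : ℝ, T • φ ⁅v1, v2⁆ + A • φ v1 + B • φ v2 + E • φ e = 0 →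
      T = 0 ∧ A = 0 ∧ B = 0 ∧ E = 0) : Function.Injective φ := by
  rw [← LinearMap.ker_eq_bot, LinearMap.ker_eq_bot']
  intro u hu
  obtain ⟨T, A, B, E, rfl⟩ := N.spn u
  simp only [map_add, map_smul] at hu
  obtain ⟨rfl, rfl, rfl, rfl⟩ := h _ _ _ _ hu
  simp

theorem NF.map0 (N : NF F α κ e v1 v2) {M : Type} [AddCommGroup M] [Module ℝ M] (φ : g →ₗ[ℝ] M) :
    Submodule.map φ (F 0) = Submodule.span ℝ {φ e} := by
  rw [N.zero, Submodule.map_span, Set.image_singleton]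

theorem NF.map1 (N : NF F α κ e v1 v2) {M : Type} [AddCommGroup M] [Module ℝ M] (φ : g →ₗ[ℝ] M) :
    Submodule.map φ (F (-1)) = Submodule.span ℝ {φ e, φ v1, φ v2} := by
  rw [N.one, Submodule.map_span, Set.image_insert_eq, Set.image_insert_eq, Set.image_singleton]

theorem NF.map2 (N : NF F α κ e v1 v2) {M : Type} [AddCommGroup M] [Module ℝ M] (φ : g →ₗ[ℝ] M) :
    Submodule.map φ ⊤ = Submodule.span ℝ {φ e, φ v1, φ v2} ⊔ Submodule.span ℝ {φ ⁅v1, v2⁆} := by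
  rw [← N.map1 φ, ← Set.image_singleton, ← Submodule.map_span, ← Submodule.map_sup]
  congr 1
  rw [eq_comm, eq_top_iff, N.one]
  intro u _
  obtain ⟨T, A, B, E, rfl⟩ := N.spn u
  refine Submodule.mem_sup.mpr ⟨E • e + A • v1 + B • v2, Submodule.mem_span_triple.mpr ⟨E, A, B, rfl⟩,
    T • ⁅v1, v2⁆, Submodule.smul_mem _ _ (Submodule.mem_span_singleton_self _), by abel⟩

/-- converse: normal forms from models -/
theorem NF.of_map {M : Type} [AddCommGroup M] [Module ℝ M] (φ : g →ₗ[ℝ] M)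
    (hφ : Function.Injective φ) (Br : M → M → M) (hB : ∀ u v, φ ⁅u, v⁆ = Br (φ u) (φ v))
    (mt m1 m2 me : M)
    (ind : ∀ T A B E : ℝ, T • mt + A • m1 + B • m2 + E • me = 0 → T = 0 ∧ A = 0 ∧ B = 0 ∧ E = 0)
    (hneg : ∀ p : ℤ, p ≤ -2 → F p = ⊤)
    (hpos : ∀ p : ℤ, 1 ≤ p → Submodule.map φ (F p) = ⊥)
    (h0 : Submodule.map φ (F 0) = Submodule.span ℝ {me})
    (h1 : Submodule.map φ (F (-1)) = Submodule.span ℝ {me, m1, m2})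
    (h2 : Submodule.map φ (F (-2)) = Submodule.span ℝ {me, m1, m2} ⊔ Submodule.span ℝ {mt})
    (b12 : Br m1 m2 = mt) (be1 : Br me m1 = (-α) • m1 + (-2:ℝ) • m2)
    (be2 : Br me m2 = (2:ℝ) • m1 + (-α) • m2) (bt1 : Br mt m1 = (-κ) • m2)
    (bt2 : Br mt m2 = κ • m1) (ak : α * κ = 0) : ∃ e v1 v2, NF F α κ e v1 v2 := by
  have hr : ∀ m ∈ Submodule.span ℝ {me, m1, m2} ⊔ Submodule.span ℝ {mt}, ∃ u, φ u = m := by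
    intro m hm
    rw [← h2] at hm
    obtain ⟨u, -, h⟩ := hm
    exact ⟨u, h⟩
  obtain ⟨e, rfl⟩ := hr me (Submodule.mem_sup_left (Submodule.subset_span (by simp)))
  obtain ⟨v1, rfl⟩ := hr m1 (Submodule.mem_sup_left (Submodule.subset_span (by simp)))
  obtain ⟨v2, rfl⟩ := hr m2 (Submodule.mem_sup_left (Submodule.subset_span (by simp)))
  have ht : φ ⁅v1, v2⁆ = mt := by rw [hB, b12]
  subst ht
  have inj := Submodule.map_injective_of_injective hφ
  refine ⟨e, v1, v2, hneg, ?_, ?_, ?_, ?_, ?_, ?_, ?_, ?_, ?_, ak⟩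
  · intro p hp; apply inj; rw [hpos p hp, Submodule.map_bot]
  · apply inj; rw [h0, Submodule.map_span, Set.image_singleton]
  · apply inj
    rw [h1, Submodule.map_span, Set.image_insert_eq, Set.image_insert_eq, Set.image_singleton]
  · intro u
    have hu : φ u ∈ Submodule.map φ (F (-2)) := ⟨u, by rw [hneg _ le_rfl]; trivial, rfl⟩
    rw [h2] at hu
    obtain ⟨a, ha, b, hb, hab⟩ := Submodule.mem_sup.mp hu
    obtain ⟨E, A, B, rfl⟩ := Submodule.mem_span_triple.mp ha
    obtain ⟨T, rfl⟩ := Submodule.mem_span_singleton.mp hb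
    refine ⟨T, A, B, E, hφ ?_⟩
    rw [← hab]; simp only [map_add, map_smul]; abel
  · intro T A B E h
    apply ind
    rw [← map_zero φ, ← h]; simp only [map_add, map_smul]
  · apply hφ; rw [hB, be1]; simp only [map_add, map_smul]
  · apply hφ; rw [hB, be2]; simp only [map_add, map_smul]
  · apply hφ; rw [hB, bt1]; simp only [map_add, map_smul]
  · apply hφ; rw [hB, bt2]; simp only [map_add, map_smul]

theorem indR (T A B E : ℝ) (h : T • (!![0, 2; -2, 0] : M2R) + A • !![1, 0; 0, -1] + B • !![0, 1; 1, 0]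
    + E • !![1, 1; -1, 1] = 0) : T = 0 ∧ A = 0 ∧ B = 0 ∧ E = 0 := by
  have h00 := congrFun (congrFun h 0) 0
  have h01 := congrFun (congrFun h 0) 1
  have h10 := congrFun (congrFun h 1) 0
  have h11 := congrFun (congrFun h 1) 1
  simp at h00 h01 h10 h11
  refine ⟨?_, ?_, ?_, ?_⟩ <;> linarith

theorem spanR : (⊤ : Submodule ℝ M2R) = Submodule.span ℝ {!![1, 1; -1, 1], !![1, 0; 0, -1], !![0, 1; 1, 0]} ⊔
    Submodule.span ℝ {!![0, 2; -2, 0]} := by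
  rw [eq_comm, eq_top_iff]
  intro m _
  refine Submodule.mem_sup.mpr ⟨((m 0 0 + m 1 1) / 2) • !![1, 1; -1, 1] + ((m 0 0 - m 1 1) / 2) • !![1, 0; 0, -1] +
    ((m 0 1 + m 1 0) / 2) • !![0, 1; 1, 0], Submodule.mem_span_triple.mpr ⟨_, _, _, rfl⟩,
    (((m 0 1 - m 1 0) / 2 - (m 0 0 + m 1 1) / 2) / 2) • !![0, 2; -2, 0],
    Submodule.smul_mem _ _ (Submodule.mem_span_singleton_self _), ?_⟩
  ext i j; fin_cases i <;> fin_cases j <;> simp <;> ring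

theorem filtR (p : ℤ) : (1 ≤ p → FiltII1 p = ⊥) ∧ (p ≤ -2 → FiltII1 p = ⊤) := by
  constructor
  · intro h; simp [FiltII1, h]
  · intro h
    rw [FiltII1, if_neg (by omega), if_neg (by omega), if_neg (by omega)]

theorem filtR0 : FiltII1 0 = G0R := by simp [FiltII1]
theorem filtR1 : FiltII1 (-1) = Gm1R := by simp [FiltII1]

theorem comR : (!![1, 0; 0, -1] : M2R) * !![0, 1; 1, 0] - !![0, 1; 1, 0] * !![1, 0; 0, -1] = !![0, 2; -2, 0] ∧
    (!![1, 1; -1, 1] : M2R) * !![1, 0; 0, -1] - !![1, 0; 0, -1] * !![1, 1; -1, 1] =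
      (-0:ℝ) • !![1, 0; 0, -1] + (-2:ℝ) • !![0, 1; 1, 0] ∧
    (!![1, 1; -1, 1] : M2R) * !![0, 1; 1, 0] - !![0, 1; 1, 0] * !![1, 1; -1, 1] =
      (2:ℝ) • !![1, 0; 0, -1] + (-0:ℝ) • !![0, 1; 1, 0] ∧
    (!![0, 2; -2, 0] : M2R) * !![1, 0; 0, -1] - !![1, 0; 0, -1] * !![0, 2; -2, 0] = (-4:ℝ) • !![0, 1; 1, 0] ∧
    (!![0, 2; -2, 0] : M2R) * !![0, 1; 1, 0] - !![0, 1; 1, 0] * !![0, 2; -2, 0] = (4:ℝ) • !![1, 0; 0, -1] := by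
  refine ⟨?_, ?_, ?_, ?_, ?_⟩ <;>
  · ext i j; fin_cases i <;> fin_cases j <;> simp [Matrix.mul_apply, Fin.sum_univ_two] <;> norm_num

theorem NF.iso1 (N : NF F 0 4 e v1 v2) : Iso16 g F (Sum.inr 0) := by
  obtain ⟨φ, pt, p1, p2, pe⟩ := N.lin (!![0, 2; -2, 0] : M2R) !![1, 0; 0, -1] !![0, 1; 1, 0] !![1, 1; -1, 1]
  obtain ⟨c1, c2, c3, c4, c5⟩ := comR
  have hr : Submodule.map φ ⊤ = ⊤ := by rw [N.map2, pt, p1, p2, pe, ← spanR]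
  simp only [Iso16, if_true]
  refine ⟨φ, ⟨N.inj φ ?_, ?_⟩, N.hom φ ?_ ?_ ?_ ?_ ?_, ?_⟩
  · rw [pt, p1, p2, pe]; exact indR
  · rw [← LinearMap.range_eq_top, ← Submodule.map_top]; exact hr
  · rw [pt, p1, p2]; exact c1
  · rw [pe, p1, p2]; exact c2
  · rw [pe, p1, p2]; exact c3
  · rw [pt, p1, p2]; exact c4
  · rw [pt, p1, p2]; exact c5
  · intro p
    by_cases h1 : 1 ≤ p
    · rw [(filtR p).1 h1, N.pos p h1, Submodule.map_bot]
    by_cases h2 : p ≤ -2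
    · rw [(filtR p).2 h2, N.neg p h2, hr]
    obtain rfl | rfl : p = 0 ∨ p = -1 := by omega
    · rw [filtR0, N.map0, pe, G0R]
    · rw [filtR1, N.map1, pe, p1, p2, Gm1R]

theorem nf_of_iso1 (hneg : ∀ p : ℤ, p ≤ -2 → F p = ⊤) (h : Iso16 g F (Sum.inr 0)) :
    ∃ e v1 v2, NF F 0 4 e v1 v2 := by
  simp only [Iso16, if_true] at h
  obtain ⟨φ, hb, hh, hF⟩ := h
  obtain ⟨c1, c2, c3, c4, c5⟩ := comR
  refine NF.of_map φ hb.1 (fun a b => a * b - b * a) (fun u v => hh u v) _ _ _ _ indR hneg ?_ ?_ ?_ ?_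
    c1 c2 c3 c4 c5 (by norm_num)
  · intro p hp; rw [hF, (filtR p).1 hp]
  · rw [hF, filtR0]; rfl
  · rw [hF, filtR1]; rfl
  · rw [hF, (filtR _).2 le_rfl, spanR]

end

section

set_option linter.unusedSimpArgs false

variable {g : Type} [LieRing g] [LieAlgebra ℝ g] {F : ℤ → Submodule ℝ g} {α κ : ℝ} {e v1 v2 : g}

theorem indC (T A B E : ℝ) (h : T • (!![0, -2; 2, 0] : M2C) + A • !![Complex.I, 0; 0, -Complex.I]
    + B • !![0, Complex.I; Complex.I, 0] + E • !![1, 1; -1, 1] = 0) :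
    T = 0 ∧ A = 0 ∧ B = 0 ∧ E = 0 := by
  have h00 := congrFun (congrFun h 0) 0
  have h01 := congrFun (congrFun h 0) 1
  simp at h00 h01
  have a1 := congrArg Complex.re h00
  have a2 := congrArg Complex.im h00
  have a3 := congrArg Complex.re h01
  have a4 := congrArg Complex.im h01
  simp at a1 a2 a3 a4
  refine ⟨?_, ?_, ?_, ?_⟩ <;> linarith

theorem indC2 (T A B E : ℝ) (h : T • (!![0, -2; 2, 0] : M2C) + A • !![Complex.I, 0; 0, -Complex.I]
    + B • !![0, Complex.I; Complex.I, 0] + E • !![Complex.I, 1; -1, Complex.I] = 0) :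
    T = 0 ∧ A = 0 ∧ B = 0 ∧ E = 0 := by
  have h00 := congrFun (congrFun h 0) 0
  have h01 := congrFun (congrFun h 0) 1
  have h11 := congrFun (congrFun h 1) 1
  simp at h00 h01 h11
  have a1 := congrArg Complex.im h11
  have a2 := congrArg Complex.im h00
  have a3 := congrArg Complex.re h01
  have a4 := congrArg Complex.im h01
  simp at a1 a2 a3 a4
  refine ⟨?_, ?_, ?_, ?_⟩ <;> linarith

theorem spanC : TopC = Submodule.span ℝ {!![1, 1; -1, 1], !![Complex.I, 0; 0, -Complex.I],
    !![0, Complex.I; Complex.I, 0]} ⊔ Submodule.span ℝ {!![0, -2; 2, 0]} := by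
  have h : (!![0, -2; 2, 0] : M2C) = (2:ℝ) • !![0, -1; 1, 0] := by
    ext i j; fin_cases i <;> fin_cases j <;> simp
  rw [TopC, Gm1C, h, Submodule.span_singleton_smul_eq (by norm_num)]

theorem filtC (p : ℤ) : (1 ≤ p → FiltII2 p = ⊥) ∧ (p ≤ -2 → FiltII2 p = TopC) := by
  constructor
  · intro h; simp [FiltII2, h]
  · intro h
    rw [FiltII2, if_neg (by omega), if_neg (by omega), if_neg (by omega)]

theorem filtC0 : FiltII2 0 = G0C := by simp [FiltII2]
theorem filtC1 : FiltII2 (-1) = Gm1C := by simp [FiltII2]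

theorem comC (c : ℂ) : (!![Complex.I, 0; 0, -Complex.I] : M2C) * !![0, Complex.I; Complex.I, 0] -
      !![0, Complex.I; Complex.I, 0] * !![Complex.I, 0; 0, -Complex.I] = !![0, -2; 2, 0] ∧
    (!![c, 1; -1, c] : M2C) * !![Complex.I, 0; 0, -Complex.I] -
      !![Complex.I, 0; 0, -Complex.I] * !![c, 1; -1, c] =
      (-0:ℝ) • !![Complex.I, 0; 0, -Complex.I] + (-2:ℝ) • !![0, Complex.I; Complex.I, 0] ∧
    (!![c, 1; -1, c] : M2C) * !![0, Complex.I; Complex.I, 0] -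
      !![0, Complex.I; Complex.I, 0] * !![c, 1; -1, c] =
      (2:ℝ) • !![Complex.I, 0; 0, -Complex.I] + (-0:ℝ) • !![0, Complex.I; Complex.I, 0] ∧
    (!![0, -2; 2, 0] : M2C) * !![Complex.I, 0; 0, -Complex.I] -
      !![Complex.I, 0; 0, -Complex.I] * !![0, -2; 2, 0] =
      (-(-4):ℝ) • !![0, Complex.I; Complex.I, 0] ∧
    (!![0, -2; 2, 0] : M2C) * !![0, Complex.I; Complex.I, 0] -
      !![0, Complex.I; Complex.I, 0] * !![0, -2; 2, 0] =
      (-4:ℝ) • !![Complex.I, 0; 0, -Complex.I] := by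
  refine ⟨?_, ?_, ?_, ?_, ?_⟩ <;>
  · ext i j; fin_cases i <;> fin_cases j <;> simp [Matrix.mul_apply, Fin.sum_univ_two] <;>
    first | done | ring | (norm_num; done) | (norm_num; ring)

theorem NF.iso2 (N : NF F 0 (-4) e v1 v2) : Iso16 g F (Sum.inr 1) := by
  simp only [Iso16, one_ne_zero, if_false]
  constructor
  · obtain ⟨φ, pt, p1, p2, pe⟩ := N.lin (!![0, -2; 2, 0] : M2C) !![Complex.I, 0; 0, -Complex.I]
      !![0, Complex.I; Complex.I, 0] !![1, 1; -1, 1]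
    obtain ⟨c1, c2, c3, c4, c5⟩ := comC 1
    refine ⟨φ, N.inj φ ?_, N.hom φ ?_ ?_ ?_ ?_ ?_, ?_⟩
    · rw [pt, p1, p2, pe]; exact indC
    · rw [pt, p1, p2]; exact c1
    · rw [pe, p1, p2]; exact c2
    · rw [pe, p1, p2]; exact c3
    · rw [pt, p1, p2]; exact c4
    · rw [pt, p1, p2]; exact c5
    · intro p
      by_cases h1 : 1 ≤ p
      · rw [(filtC p).1 h1, N.pos p h1, Submodule.map_bot]
      by_cases h2 : p ≤ -2
      · rw [(filtC p).2 h2, N.neg p h2, N.map2, pt, p1, p2, pe, spanC]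
      obtain rfl | rfl : p = 0 ∨ p = -1 := by omega
      · rw [filtC0, N.map0, pe, G0C]
      · rw [filtC1, N.map1, pe, p1, p2, Gm1C]
  · obtain ⟨φ, pt, p1, p2, pe⟩ := N.lin (!![0, -2; 2, 0] : M2C) !![Complex.I, 0; 0, -Complex.I]
      !![0, Complex.I; Complex.I, 0] !![Complex.I, 1; -1, Complex.I]
    obtain ⟨c1, c2, c3, c4, c5⟩ := comC Complex.I
    refine ⟨φ, N.inj φ ?_, N.hom φ ?_ ?_ ?_ ?_ ?_, ?_, ?_⟩
    · rw [pt, p1, p2, pe]; exact indC2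
    · rw [pt, p1, p2]; exact c1
    · rw [pe, p1, p2]; exact c2
    · rw [pe, p1, p2]; exact c3
    · rw [pt, p1, p2]; exact c4
    · rw [pt, p1, p2]; exact c5
    · intro v
      obtain ⟨T, A, B, E, rfl⟩ := N.spn v
      simp only [map_add, map_smul, pt, p1, p2, pe]
      ext i j
      fin_cases i <;> fin_cases j <;> simp [Matrix.conjTranspose_apply] <;> ring
    · intro m hm
      have h00 := congrFun (congrFun hm 0) 0
      have h01 := congrFun (congrFun hm 0) 1
      have h11 := congrFun (congrFun hm 1) 1
      simp only [Matrix.conjTranspose_apply, Matrix.neg_apply] at h00 h01 h11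
      have a0 := congrArg Complex.re h00
      have a1 := congrArg Complex.re h01
      have a2 := congrArg Complex.im h01
      have a3 := congrArg Complex.re h11
      simp at a0 a1 a2 a3
      refine ⟨(((m 0 0).im + (m 1 1).im) / 2 / 2 - (m 0 1).re / 2) • ⁅v1, v2⁆ +
        (((m 0 0).im - (m 1 1).im) / 2) • v1 + (m 0 1).im • v2 +
        (((m 0 0).im + (m 1 1).im) / 2) • e, ?_⟩
      simp only [map_add, map_smul, pt, p1, p2, pe]
      ext i j
      fin_cases i <;> fin_cases j <;> apply Complex.ext <;> simp <;> linarith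

theorem nf_of_iso2 (hneg : ∀ p : ℤ, p ≤ -2 → F p = ⊤) (h : Iso16 g F (Sum.inr 1)) :
    ∃ e v1 v2, NF F 0 (-4) e v1 v2 := by
  simp only [Iso16, one_ne_zero, if_false] at h
  obtain ⟨⟨φ, hb, hh, hF⟩, -⟩ := h
  obtain ⟨c1, c2, c3, c4, c5⟩ := comC 1
  refine NF.of_map φ hb (fun a b => a * b - b * a) (fun u v => hh u v) _ _ _ _ indC hneg ?_ ?_ ?_ ?_
    c1 c2 c3 c4 c5 (by norm_num)
  · intro p hp; rw [hF, (filtC p).1 hp]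
  · rw [hF, filtC0]; rfl
  · rw [hF, filtC1]; rfl
  · rw [hF, (filtC _).2 le_rfl, spanC]

end

section

set_option linter.unusedSimpArgs false

variable {g : Type} [LieRing g] [LieAlgebra ℝ g] {F : ℤ → Submodule ℝ g} {α κ : ℝ} {e v1 v2 : g}

/-- graded pieces of the one parameter family -/
def hA (α : ℝ) (q : ℤ) : Submodule ℝ PL :=
  if q = -2 then Submodule.span ℝ {1} else if q = -1 then Submodule.span ℝ {X 0, X 2} else
    if q = 0 then Submodule.span ℝ {q4 1 0 1 α} else ⊥

theorem hA_m2 (α : ℝ) : hA α (-2) = Submodule.span ℝ {1} := by simp [hA]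
theorem hA_m1 (α : ℝ) : hA α (-1) = Submodule.span ℝ {X 0, X 2} := by simp [hA]
theorem hA_0 (α : ℝ) : hA α 0 = Submodule.span ℝ {q4 1 0 1 α} := by simp [hA]
theorem hA_else (α : ℝ) {q : ℤ} (h2 : q ≠ -2) (h1 : q ≠ -1) (h0 : q ≠ 0) : hA α q = ⊥ := by
  simp [hA, h2, h1, h0]

theorem hA_le (α : ℝ) (q : ℤ) : hA α q ≤ Lgrade q := by
  by_cases h2 : q = -2
  · subst h2; rw [hA_m2, Submodule.span_le, Set.singleton_subset_iff]; exact one_mem_L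
  by_cases h1 : q = -1
  · subst h1; rw [hA_m1, Submodule.span_le]
    rintro _ (rfl | rfl)
    exacts [X0_mem, X2_mem]
  by_cases h0 : q = 0
  · subst h0; rw [hA_0, Submodule.span_le, Set.singleton_subset_iff]; exact q4_mem _ _ _ _
  rw [hA_else α h2 h1 h0]; exact bot_le

theorem meA (α : ℝ) : X 0 ^ 2 + X 2 ^ 2 + C α * (2 * X 1 - X 0 * X 2) = q4 1 0 1 α := by
  simp [q4, TT, smul_eq_C_mul]

theorem Tgt_A (α : ℝ) : Tgt (Sum.inr α) = ⨆ q, hA α q := by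
  apply le_antisymm
  · show Submodule.span ℝ _ ≤ _
    rw [meA, Submodule.span_le]
    rintro _ (rfl | rfl | rfl | rfl)
    · exact (le_iSup (hA α) (-2)) (by rw [hA_m2]; exact Submodule.subset_span (by simp))
    · exact (le_iSup (hA α) (-1)) (by rw [hA_m1]; exact Submodule.subset_span (by simp))
    · exact (le_iSup (hA α) (-1)) (by rw [hA_m1]; exact Submodule.subset_span (by simp))
    · exact (le_iSup (hA α) 0) (by rw [hA_0]; exact Submodule.subset_span (by simp))
  · show _ ≤ Submodule.span ℝ _
    rw [meA]
    refine iSup_le fun q => ?_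
    by_cases h2 : q = -2
    · subst h2; rw [hA_m2]; apply Submodule.span_mono; intro f hf; simp at hf; simp [hf]
    by_cases h1 : q = -1
    · subst h1; rw [hA_m1]; apply Submodule.span_mono; intro f hf; simp at hf; rcases hf with h | h <;> simp [h]
    by_cases h0 : q = 0
    · subst h0; rw [hA_0]; apply Submodule.span_mono; intro f hf; simp at hf; simp [hf]
    rw [hA_else α h2 h1 h0]; exact bot_le

theorem filA (α : ℝ) (p : ℤ) : (⨆ q : ℤ, ⨆ _ : p ≤ q, Tgt (Sum.inr α) ⊓ Lgrade q) =
    ⨆ q : ℤ, ⨆ _ : p ≤ q, hA α q := by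
  simp only [Tgt_A, Lg_proj (hA_le α)]

theorem filA_pos (α : ℝ) {p : ℤ} (hp : 1 ≤ p) : (⨆ q : ℤ, ⨆ _ : p ≤ q, hA α q) = ⊥ := by
  rw [eq_bot_iff]
  exact iSup₂_le fun q hq => by rw [hA_else α (by omega) (by omega) (by omega)]

theorem filA_step (α : ℝ) (p : ℤ) : (⨆ q : ℤ, ⨆ _ : p ≤ q, hA α q) =
    (⨆ q : ℤ, ⨆ _ : p + 1 ≤ q, hA α q) ⊔ hA α p := by
  apply le_antisymm
  · refine iSup₂_le fun q hq => ?_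
    rcases eq_or_lt_of_le hq with rfl | h
    · exact le_sup_right
    · exact le_trans (le_iSup₂_of_le q h le_rfl) le_sup_left
  · refine sup_le (iSup₂_le fun q hq => le_iSup₂_of_le q (by omega) le_rfl) (le_iSup₂_of_le p le_rfl le_rfl)

theorem indA (α T A B E : ℝ) (h : T • (1 : PL) + A • X 0 + B • X 2 + E • q4 1 0 1 α = 0) :
    T = 0 ∧ A = 0 ∧ B = 0 ∧ E = 0 := by
  have h1 := congrArg (eval (![0, 0, 0] : Fin 3 → ℝ)) h
  have h2 := congrArg (eval (![1, 0, 0] : Fin 3 → ℝ)) h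
  have h3 := congrArg (eval (![-1, 0, 0] : Fin 3 → ℝ)) h
  have h4 := congrArg (eval (![0, 0, 1] : Fin 3 → ℝ)) h
  simp [q4, TT, smul_eq_C_mul] at h1 h2 h3 h4
  refine ⟨?_, ?_, ?_, ?_⟩ <;> linarith

theorem nf_of_isoA (hneg : ∀ p : ℤ, p ≤ -2 → F p = ⊤) (h : Iso16 g F (Sum.inl (Sum.inr α))) :
    ∃ e v1 v2, NF F α 0 e v1 v2 := by
  obtain ⟨φ, hb, -, hh, hF⟩ := h
  have e0 : (⨆ q : ℤ, ⨆ _ : (0:ℤ) ≤ q, hA α q) = Submodule.span ℝ {q4 1 0 1 α} := by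
    rw [filA_step, filA_pos α (by norm_num), bot_sup_eq, hA_0]
  have e1 : (⨆ q : ℤ, ⨆ _ : (-1:ℤ) ≤ q, hA α q) = Submodule.span ℝ {q4 1 0 1 α, X 0, X 2} := by
    rw [filA_step, show (-1 + 1 : ℤ) = 0 by norm_num, e0, hA_m1, ← Submodule.span_union]; rfl
  have e2 : (⨆ q : ℤ, ⨆ _ : (-2:ℤ) ≤ q, hA α q) = Submodule.span ℝ {q4 1 0 1 α, X 0, X 2} ⊔
      Submodule.span ℝ {1} := by
    rw [filA_step, show (-2 + 1 : ℤ) = -1 by norm_num, e1, hA_m2]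
  refine NF.of_map φ hb lagr hh 1 (X 0) (X 2) (q4 1 0 1 α) (indA α) hneg ?_ ?_ ?_ ?_
    ?_ ?_ ?_ ?_ ?_ (by ring)
  · intro p hp; rw [hF, filA, filA_pos α hp]
  · rw [hF, filA, e0]
  · rw [hF, filA, e1]
  · rw [hF, filA, e2]
  · rw [lagr_X0]; simp [pderiv_X]
  · rw [lagr_skew, q4_X0]; simp [smul_eq_C_mul]; ring
  · rw [lagr_skew, q4_X2]; simp [smul_eq_C_mul]; ring
  · rw [lagr_one]; simp [pderiv_X]
  · rw [lagr_one]; simp [pderiv_X]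

theorem dim_span {n : ℕ} (b : Fin n → PL) (h : ∀ c : Fin n → ℝ, (∀ x y z : ℝ,
    ∑ i, c i * eval (![x, y, z] : Fin 3 → ℝ) (b i) = 0) → ∀ i, c i = 0) :
    ∀ V : Submodule ℝ PL, V = Submodule.span ℝ (Set.range b) → Module.finrank ℝ V = n := by
  rintro V rfl
  have : LinearIndependent ℝ b := by
    rw [Fintype.linearIndependent_iff]
    intro c hc
    apply h
    intro x y z
    have := congrArg (eval (![x, y, z] : Fin 3 → ℝ)) hc
    simpa [smul_eq_C_mul] using this
  rw [finrank_span_eq_card this, Fintype.card_fin]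

theorem iso_dim {i : Fin 5 ⊕ ℝ} (h : Iso16 g F (Sum.inl i)) :
    Module.finrank ℝ g = Module.finrank ℝ (Tgt i) := by
  obtain ⟨φ, hb, hr, -⟩ := h
  rw [← hr]
  exact (LinearEquiv.ofInjective φ hb).finrank_eq

theorem dim0 : Module.finrank ℝ (Tgt (Sum.inl 0)) = 10 := by
  have := dim_span ![1, X 0, X 1, X 2, X 0 ^ 2, X 0 * X 2, X 2 ^ 2,
            X 0 * (2 * X 1 - X 0 * X 2), X 2 * (2 * X 1 - X 0 * X 2),
            (2 * X 1 - X 0 * X 2) ^ 2] (by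
    intro c hc
    have a0 := hc 0 0 0
    have a1 := hc 1 0 0
    have a2 := hc (-1) 0 0
    have a3 := hc 0 0 1
    have a4 := hc 0 0 (-1)
    have a5 := hc 0 1 0
    have a6 := hc 0 (-1) 0
    have a7 := hc 1 1 0
    have a8 := hc 0 1 1
    have a9 := hc 1 0 1
    simp [Fin.sum_univ_succ, smul_eq_C_mul] at a0 a1 a2 a3 a4 a5 a6 a7 a8 a9
    intro i; fin_cases i <;> simp <;> linarith)
  refine this _ ?_
  simp only [Matrix.range_cons, Matrix.range_empty, Set.union_empty, Set.singleton_union]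
  rfl

theorem dim1 : Module.finrank ℝ (Tgt (Sum.inl 1)) = 7 := by
  have := dim_span ![1, X 0, X 1, X 2, X 0 ^ 2, X 0 * X 2, X 2 ^ 2] (by
    intro c hc
    have a0 := hc 0 0 0
    have a1 := hc 1 0 0
    have a2 := hc (-1) 0 0
    have a3 := hc 0 0 1
    have a4 := hc 0 0 (-1)
    have a5 := hc 0 1 0
    have a9 := hc 1 0 1
    simp [Fin.sum_univ_succ, smul_eq_C_mul] at a0 a1 a2 a3 a4 a5 a9
    intro i; fin_cases i <;> simp <;> linarith)
  refine this _ ?_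
  simp only [Matrix.range_cons, Matrix.range_empty, Set.union_empty, Set.singleton_union]
  rfl

theorem dim2 : Module.finrank ℝ (Tgt (Sum.inl 2)) = 6 := by
  have := dim_span ![1, X 0, X 2, X 0 ^ 2, X 0 * X 2, X 2 ^ 2] (by
    intro c hc
    have a0 := hc 0 0 0
    have a1 := hc 1 0 0
    have a2 := hc (-1) 0 0
    have a3 := hc 0 0 1
    have a4 := hc 0 0 (-1)
    have a9 := hc 1 0 1
    simp [Fin.sum_univ_succ, smul_eq_C_mul] at a0 a1 a2 a3 a4 a9
    intro i; fin_cases i <;> simp <;> linarith)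
  refine this _ ?_
  simp only [Matrix.range_cons, Matrix.range_empty, Set.union_empty, Set.singleton_union]
  rfl

theorem dim3 : Module.finrank ℝ (Tgt (Sum.inl 3)) = 8 := by
  have := dim_span ![1, X 0, X 2, X 0 ^ 2 + X 2 ^ 2, 2 * X 1 - X 0 * X 2,
            X 0 * (X 0 ^ 2 + X 2 ^ 2) - 2 * X 2 * (2 * X 1 - X 0 * X 2),
            X 2 * (X 0 ^ 2 + X 2 ^ 2) + 2 * X 0 * (2 * X 1 - X 0 * X 2),
            (X 0 ^ 2 + X 2 ^ 2) ^ 2 + 4 * (2 * X 1 - X 0 * X 2) ^ 2] (by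
    intro c hc
    have a0 := hc 0 0 0
    have a1 := hc 1 0 0
    have a2 := hc (-1) 0 0
    have a3 := hc 0 0 1
    have a4 := hc 0 0 (-1)
    have a5 := hc 0 1 0
    have a6 := hc 0 (-1) 0
    have a7 := hc 2 0 0
    have a8 := hc 0 0 2
    simp [Fin.sum_univ_succ, smul_eq_C_mul] at a0 a1 a2 a3 a4 a5 a6 a7 a8
    intro i; fin_cases i <;> simp <;> linarith)
  refine this _ ?_
  simp only [Matrix.range_cons, Matrix.range_empty, Set.union_empty, Set.singleton_union]
  rfl

theorem dim4 : Module.finrank ℝ (Tgt (Sum.inl 4)) = 5 := by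
  have := dim_span ![1, X 0, X 2, X 0 ^ 2 + X 2 ^ 2, 2 * X 1 - X 0 * X 2] (by
    intro c hc
    have a0 := hc 0 0 0
    have a1 := hc 1 0 0
    have a2 := hc (-1) 0 0
    have a3 := hc 0 0 1
    have a5 := hc 0 1 0
    simp [Fin.sum_univ_succ, smul_eq_C_mul] at a0 a1 a2 a3 a5
    intro i; fin_cases i <;> simp <;> linarith)
  refine this _ ?_
  simp only [Matrix.range_cons, Matrix.range_empty, Set.union_empty, Set.singleton_union]
  rfl

theorem dimT (i : Fin 5) : Module.finrank ℝ (Tgt (Sum.inl i)) = ![10, 7, 6, 8, 5] i := by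
  fin_cases i
  exacts [dim0, dim1, dim2, dim3, dim4]

/-- every four dimensional model has a normal form -/
theorem nf_of_iso4 (hneg : ∀ p : ℤ, p ≤ -2 → F p = ⊤) {j : (Fin 5 ⊕ ℝ) ⊕ Fin 2} (h : Iso16 g F j)
    (hj : ∀ α : ℝ, j = Sum.inl (Sum.inr α) → 0 ≤ α) (h4 : Module.finrank ℝ g = 4) :
    ∃ α κ e v1 v2, 0 ≤ α ∧ NF F α κ e v1 v2 ∧ ((κ = 0 ∧ j = Sum.inl (Sum.inr α)) ∨
      (κ = 4 ∧ j = Sum.inr 0) ∨ (κ = -4 ∧ j = Sum.inr 1)) := by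
  rcases j with (i | a) | i
  · exfalso
    have := iso_dim h
    rw [h4, dimT] at this
    fin_cases i <;> simp at this
  · obtain ⟨e, v1, v2, N⟩ := nf_of_isoA hneg h
    exact ⟨a, 0, e, v1, v2, hj a rfl, N, Or.inl ⟨rfl, rfl⟩⟩
  · fin_cases i
    · obtain ⟨e, v1, v2, N⟩ := nf_of_iso1 hneg h
      exact ⟨0, 4, e, v1, v2, le_rfl, N, Or.inr (Or.inl ⟨rfl, rfl⟩)⟩
    · obtain ⟨e, v1, v2, N⟩ := nf_of_iso2 hneg h
      exact ⟨0, -4, e, v1, v2, le_rfl, N, Or.inr (Or.inr ⟨rfl, rfl⟩)⟩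

theorem dim_iso4 (hneg : ∀ p : ℤ, p ≤ -2 → F p = ⊤) {j : (Fin 5 ⊕ ℝ) ⊕ Fin 2} (h : Iso16 g F j) :
    (∃ i : Fin 5, j = Sum.inl (Sum.inl i)) ∨ Module.finrank ℝ g = 4 := by
  rcases j with (i | a) | i
  · exact Or.inl ⟨i, rfl⟩
  · obtain ⟨e, v1, v2, N⟩ := nf_of_isoA hneg h
    exact Or.inr N.finrank
  · fin_cases i
    · obtain ⟨e, v1, v2, N⟩ := nf_of_iso1 hneg h
      exact Or.inr N.finrank
    · obtain ⟨e, v1, v2, N⟩ := nf_of_iso2 hneg h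
      exact Or.inr N.finrank

theorem iso_unique (hneg : ∀ p : ℤ, p ≤ -2 → F p = ⊤) {j k : (Fin 5 ⊕ ℝ) ⊕ Fin 2}
    (hj : ∀ α : ℝ, j = Sum.inl (Sum.inr α) → 0 ≤ α) (hj' : Iso16 g F j)
    (hk : ∀ α : ℝ, k = Sum.inl (Sum.inr α) → 0 ≤ α) (hk' : Iso16 g F k) : j = k := by
  have key : Module.finrank ℝ g = 4 → j = k := by
    intro h4
    obtain ⟨α, κ, e, v1, v2, ha, N, hd⟩ := nf_of_iso4 hneg hj' hj h4
    obtain ⟨α', κ', e', v1', v2', ha', N', hd'⟩ := nf_of_iso4 hneg hk' hk h4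
    obtain ⟨rfl, c, hc, hcc⟩ := N.uniq N' ha ha'
    rcases hd with ⟨rfl, rfl⟩ | ⟨rfl, rfl⟩ | ⟨rfl, rfl⟩ <;>
    rcases hd' with ⟨rfl, rfl⟩ | ⟨rfl, rfl⟩ | ⟨rfl, rfl⟩ <;>
    first | rfl | (exfalso; linarith)
  rcases dim_iso4 hneg hj' with ⟨i, rfl⟩ | h
  · rcases dim_iso4 hneg hk' with ⟨i', rfl⟩ | h
    · have e := (iso_dim hj').symm.trans (iso_dim hk')
      rw [dimT, dimT] at e
      fin_cases i <;> fin_cases i' <;> first | rfl | (exfalso; simp at e)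
    · exact key h
  · exact key h

end

/-- Every finite-dimensional irreducible contact Lie algebra — a
finite-dimensional real Lie algebra `g` with a filtration `(g_p)_{p∈ℤ}` such that
`g_p = g` for `p ≤ −2`, `codim g_{−1} = 1`, `codim g₀ = 3`, `[g_{−1},g_{−1}] + g_{−1} = g`,
`g_{p+1} = {x ∈ g_p : [x,g_{−1}] ⊆ g_p}` for `p ≥ 0`, `⋂ g_p = 0`, and whose `g₀`-module
`g_{−1}/g₀` is irreducible — is isomorphic as a filtered Lie algebra to exactly one of:
the six graded models `1°`–`6°` inside `L` (type I, with a unique `α ≥ 0` in case `6°`),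
`gl(2,ℝ)` with the filtration II.1, or the real form of `u(2)` with the filtration II.2. -/
theorem stmt16 (g : Type) [LieRing g] [LieAlgebra ℝ g] [FiniteDimensional ℝ g]
    (F : ℤ → Submodule ℝ g)
    (hneg : ∀ p : ℤ, p ≤ -2 → F p = ⊤)
    (hdec : ∀ p : ℤ, F (p + 1) ≤ F p)
    (hbr : ∀ p q : ℤ, ∀ x ∈ F p, ∀ y ∈ F q, ⁅x, y⁆ ∈ F (p + q))
    (hcodim1 : Module.finrank ℝ (g ⧸ F (-1)) = 1)
    (hcodim3 : Module.finrank ℝ (g ⧸ F 0) = 3)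
    (hgen : bracketSpan (F (-1)) (F (-1)) ⊔ F (-1) = ⊤)
    (hstep : ∀ p : ℤ, 0 ≤ p → ∀ x : g,
      (x ∈ F (p + 1) ↔ x ∈ F p ∧ ∀ y ∈ F (-1), ⁅x, y⁆ ∈ F p))
    (hint : (⨅ p : ℤ, F p) = ⊥)
    (hirr : ∀ W : Submodule ℝ g, F 0 ≤ W → W ≤ F (-1) →
      (∀ u ∈ F 0, ∀ w ∈ W, ⁅u, w⁆ ∈ W) → W = F 0 ∨ W = F (-1)) :
    ∃! j : (Fin 5 ⊕ ℝ) ⊕ Fin 2,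
      (∀ α : ℝ, j = Sum.inl (Sum.inr α) → 0 ≤ α) ∧ Iso16 g F j := by
  have H : CLA F := cla_mk hneg hdec hbr hstep hint
  obtain ⟨u, hu, w, hw, huw⟩ := frame_init hcodim1 hgen
  obtain ⟨lam, f⟩ := frame_ex H hcodim1 hcodim3 hu hw huw
  have ex : ∃ j : (Fin 5 ⊕ ℝ) ⊕ Fin 2,
      (∀ α : ℝ, j = Sum.inl (Sum.inr α) → 0 ≤ α) ∧ Iso16 g F j := by
    rcases reduce H f hirr with ⟨i, h⟩ | ⟨vx, vz, lam', d, hd, f', h0, F1⟩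
    · exact ⟨_, by simp, h⟩
    · obtain ⟨κ, e, v1, v2, N, hN⟩ := caseD H f' h0 F1
      by_cases hκ : κ = 0
      · refine ⟨_, ?_, hN hκ⟩
        intro α h
        have : d = α := Sum.inr.inj (Sum.inl.inj h)
        rw [← this]; exact hd
      · rcases N.norm hκ with ⟨v1, v2, N'⟩ | ⟨v1, v2, N'⟩
        · exact ⟨_, by simp, N'.iso1⟩
        · exact ⟨_, by simp, N'.iso2⟩
  obtain ⟨j, hj, hj'⟩ := ex
  refine ⟨j, ⟨hj, hj'⟩, ?_⟩
  rintro k ⟨hk, hk'⟩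
  exact iso_unique hneg hk hk' hj hj'
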